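/- Let N be a positive integer, let p, q > 0 with pq > 1, and let a, b ∈ ℝ. Assume the Lane–Emden system (LE) with the same parameters p, q admits no bounded positive solution (u,v) ∈ C^∞(ℝ^N) × C^∞(ℝ^N) that is stable in every bounded open subset of ℝ^N. Fix σ > 1. Then there exists a constant C > 0, depending only on N, p, q, a, b, σ (in particular independent of R₀ and of the solution), such that: for every R₀ ≥ 0 (with the convention cl(B₀) = {0}) and every pair (u,v) of positive C² functions on ℝ^N ∖ cl(B_{R₀}) satisfying −Δu = |x|^a v^p and −Δv = |x|^b u^q there, and stable on every open set whose closure is compact and contained in ℝ^N ∖ cl(B_{R₀}), one has |x|^{α̃} u(x) + |x|^{α̃+1} |∇u(x)| + |x|^{β̃} v(x) + |x|^{β̃+1} |∇v(x)| ≤ C for every x with |x| > σR₀. -/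

import Mathlib

open MeasureTheory Metric Set

noncomputable section

/-- Euclidean space `ℝ^N`. -/
abbrev Euc (N : ℕ) := EuclideanSpace ℝ (Fin N)

/-- The Laplacian of a function `f : ℝ^N → ℝ`, as the sum of the pure second
partial derivatives. -/
def lap {N : ℕ} (f : Euc N → ℝ) (x : Euc N) : ℝ :=
  ∑ i : Fin N, iteratedFDeriv ℝ 2 f x ![EuclideanSpace.single i 1, EuclideanSpace.single i 1]

/-- `(u, v)` is a solution of the Hénon–Lane–Emden system
`-Δu = |x|^a |v|^{p-1} v`, `-Δv = |x|^b |u|^{q-1} u` on `ℝ^N \ {0}`: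
`u, v` are `C²` on `ℝ^N \ {0}`, continuous on `ℝ^N`, and satisfy the equations pointwise. -/
def IsHLESol {N : ℕ} (p q a b : ℝ) (u v : Euc N → ℝ) : Prop :=
  ContDiffOn ℝ 2 u {x : Euc N | x ≠ 0} ∧ ContDiffOn ℝ 2 v {x : Euc N | x ≠ 0} ∧
  Continuous u ∧ Continuous v ∧
  (∀ x : Euc N, x ≠ 0 → -lap u x = ‖x‖ ^ a * (|v x| ^ (p - 1) * v x)) ∧
  (∀ x : Euc N, x ≠ 0 → -lap v x = ‖x‖ ^ b * (|u x| ^ (q - 1) * u x))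

/-- Stability of a (positive) solution of the Hénon–Lane–Emden system on an open set `Ω`:
there exist positive `C²` functions `ξ, ζ` on `Ω` with
`-Δξ ≥ p |x|^a v^{p-1} ζ` and `-Δζ ≥ q |x|^b u^{q-1} ξ` on `Ω`. -/
def HLEStableOn {N : ℕ} (p q a b : ℝ) (u v : Euc N → ℝ) (Ω : Set (Euc N)) : Prop :=
  ∃ ξ ζ : Euc N → ℝ, ContDiffOn ℝ 2 ξ Ω ∧ ContDiffOn ℝ 2 ζ Ω ∧
    (∀ x ∈ Ω, 0 < ξ x) ∧ (∀ x ∈ Ω, 0 < ζ x) ∧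
    (∀ x ∈ Ω, p * ‖x‖ ^ a * v x ^ (p - 1) * ζ x ≤ -lap ξ x) ∧
    (∀ x ∈ Ω, q * ‖x‖ ^ b * u x ^ (q - 1) * ξ x ≤ -lap ζ x)

/-- Stability outside a compact set `K`: stability on every open set whose closure is
compact and contained in `ℝ^N \ K`. -/
def HLEStableOutside {N : ℕ} (p q a b : ℝ) (u v : Euc N → ℝ) (K : Set (Euc N)) : Prop :=
  IsCompact K ∧
    ∀ Ω : Set (Euc N), IsOpen Ω → IsCompact (closure Ω) → closure Ω ⊆ Kᶜ →
      HLEStableOn p q a b u v Ω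

/-- `(u, v)` solves the Lane–Emden system `-Δu = |v|^{p-1} v`, `-Δv = |u|^{q-1} u` on `ℝ^N`. -/
def IsLESol {N : ℕ} (p q : ℝ) (u v : Euc N → ℝ) : Prop :=
  (∀ x : Euc N, -lap u x = |v x| ^ (p - 1) * v x) ∧
  (∀ x : Euc N, -lap v x = |u x| ^ (q - 1) * u x)

/-- Stability of a (positive) solution of the Lane–Emden system on an open set `Ω`. -/
def LEStableOn {N : ℕ} (p q : ℝ) (u v : Euc N → ℝ) (Ω : Set (Euc N)) : Prop :=
  ∃ ξ ζ : Euc N → ℝ, ContDiffOn ℝ 2 ξ Ω ∧ ContDiffOn ℝ 2 ζ Ω ∧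
    (∀ x ∈ Ω, 0 < ξ x) ∧ (∀ x ∈ Ω, 0 < ζ x) ∧
    (∀ x ∈ Ω, p * v x ^ (p - 1) * ζ x ≤ -lap ξ x) ∧
    (∀ x ∈ Ω, q * u x ^ (q - 1) * ξ x ≤ -lap ζ x)

/-- A function on `ℝ^N` is polynomially bounded. -/
def PolyBounded {N : ℕ} (w : Euc N → ℝ) : Prop :=
  ∃ K L R : ℝ, 0 < K ∧ 0 < L ∧ ∀ x : Euc N, R ≤ ‖x‖ → |w x| ≤ K * ‖x‖ ^ L

/-- The polynomial `G` from Theorem 1.4 (iii). -/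
def Gpoly (p q x : ℝ) : ℝ :=
  x ^ 4 - (4 * p * q * (q + 1) / (p + 1)) * x ^ 2 +
    (2 * p * q * (q + 1) * (p + q + 2) / (p + 1) ^ 2) * x -
    p * q * (q + 1) ^ 2 / (p + 1) ^ 2

section

open Filter Topology

variable {N : ℕ}

/-- The weighted average of the translates of `f`, with displacement `Y` and weight `w`. -/
def wavg {Ω : Type*} [MeasurableSpace Ω] (P : Measure Ω) (w : Ω → ℝ) (Y : Ω → Euc N)
    (f : Euc N → ℝ) (x : Euc N) : ℝ :=
  ∫ ω, w ω * f (x + Y ω) ∂P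

/-- Admissible weights and displacements: integrable weight, displacement at most `t` where the
weight does not vanish. -/
structure IsAvgKernel {Ω : Type*} [MeasurableSpace Ω] (P : Measure Ω) (w : Ω → ℝ)
    (Y : Ω → Euc N) (t : ℝ) : Prop where
  integrable : Integrable w P
  measurable : Measurable Y
  supp : ∀ᵐ ω ∂P, w ω ≠ 0 → ‖Y ω‖ ≤ t

lemma exists_bound_closedBall {F : Type*} [SeminormedAddCommGroup F] {f : Euc N → F}
    (hf : Continuous f) (x : Euc N) (t : ℝ) : ∃ C, 0 ≤ C ∧ ∀ y ∈ closedBall x t, ‖f y‖ ≤ C := by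
  obtain ⟨C, hC⟩ := (isCompact_closedBall x t).exists_bound_of_continuousOn hf.continuousOn
  exact ⟨max C 0, le_max_right _ _, fun y hy => (hC y hy).trans (le_max_left _ _)⟩

namespace IsAvgKernel

variable {Ω : Type*} [MeasurableSpace Ω] {P : Measure Ω} {w : Ω → ℝ} {Y : Ω → Euc N} {t : ℝ}
  {f g : Euc N → ℝ}

lemma ae_mem (h : IsAvgKernel P w Y t) (x : Euc N) :
    ∀ᵐ ω ∂P, w ω ≠ 0 → x + Y ω ∈ closedBall x t := by
  filter_upwards [h.supp] with ω hω h0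
  simpa [mem_closedBall, dist_eq_norm] using hω h0

lemma aestronglyMeasurable {F : Type*} [TopologicalSpace F]
    [TopologicalSpace.PseudoMetrizableSpace F]
    (h : IsAvgKernel P w Y t) {f : Euc N → F}
    (hf : Continuous f) (x : Euc N) : AEStronglyMeasurable (fun ω => f (x + Y ω)) P :=
  (hf.stronglyMeasurable.comp_measurable (h.measurable.const_add x)).aestronglyMeasurable

lemma integrable_smul {F : Type*} [NormedAddCommGroup F] [NormedSpace ℝ F]
    (h : IsAvgKernel P w Y t) {f : Euc N → F} (hf : Continuous f) (x : Euc N) :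
    Integrable (fun ω => w ω • f (x + Y ω)) P := by
  obtain ⟨C, hC0, hC⟩ := exists_bound_closedBall hf x t
  refine Integrable.mono' (h.integrable.norm.mul_const C)
    (h.integrable.aestronglyMeasurable.smul (h.aestronglyMeasurable hf x)) ?_
  filter_upwards [h.ae_mem x] with ω hω
  rw [norm_smul]
  by_cases h0 : w ω = 0
  · simp [h0]
  · exact mul_le_mul_of_nonneg_left (hC _ (hω h0)) (norm_nonneg _)

lemma integrable_mul (h : IsAvgKernel P w Y t) (hf : Continuous f) (x : Euc N) :
    Integrable (fun ω => w ω * f (x + Y ω)) P :=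
  h.integrable_smul (F := ℝ) hf x

lemma add (h : IsAvgKernel P w Y t) (hf : Continuous f) (hg : Continuous g) (x : Euc N) :
    wavg P w Y (fun y => f y + g y) x = wavg P w Y f x + wavg P w Y g x := by
  simp only [wavg, mul_add]
  exact integral_add (h.integrable_mul hf x) (h.integrable_mul hg x)

lemma sub (h : IsAvgKernel P w Y t) (hf : Continuous f) (hg : Continuous g) (x : Euc N) :
    wavg P w Y (fun y => f y - g y) x = wavg P w Y f x - wavg P w Y g x := by
  simp only [wavg, mul_sub]
  exact integral_sub (h.integrable_mul hf x) (h.integrable_mul hg x)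

lemma finset_sum {ι : Type*} (s : Finset ι) {f : ι → Euc N → ℝ} (h : IsAvgKernel P w Y t)
    (hf : ∀ i ∈ s, Continuous (f i)) (x : Euc N) :
    wavg P w Y (fun y => ∑ i ∈ s, f i y) x = ∑ i ∈ s, wavg P w Y (f i) x := by
  simp only [wavg, Finset.mul_sum]
  exact integral_finsetSum s fun i hi => h.integrable_mul (hf i hi) x

lemma mono (h : IsAvgKernel P w Y t) (hw : ∀ᵐ ω ∂P, 0 ≤ w ω) (hf : Continuous f)
    (hg : Continuous g) {x : Euc N} (hfg : ∀ y ∈ closedBall x t, f y ≤ g y) :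
    wavg P w Y f x ≤ wavg P w Y g x := by
  refine integral_mono_ae (h.integrable_mul hf x) (h.integrable_mul hg x) ?_
  filter_upwards [h.ae_mem x, hw] with ω hω hw
  by_cases h0 : w ω = 0
  · simp [h0]
  · exact mul_le_mul_of_nonneg_left (hfg _ (hω h0)) hw

lemma nonneg (h : IsAvgKernel P w Y t) (hw : ∀ᵐ ω ∂P, 0 ≤ w ω) {x : Euc N}
    (hf : ∀ y ∈ closedBall x t, 0 ≤ f y) : 0 ≤ wavg P w Y f x := by
  refine integral_nonneg_of_ae ?_
  filter_upwards [h.ae_mem x, hw] with ω hω hw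
  by_cases h0 : w ω = 0
  · simp [h0]
  · exact mul_nonneg hw (hf _ (hω h0))

lemma hasFDerivAt (h : IsAvgKernel P w Y t) (hf : ContDiff ℝ 1 f) (x : Euc N) :
    HasFDerivAt (wavg P w Y f) (∫ ω, w ω • fderiv ℝ f (x + Y ω) ∂P) x := by
  have hf' : Continuous (fderiv ℝ f) := hf.continuous_fderiv one_ne_zero
  obtain ⟨C, hC0, hC⟩ := exists_bound_closedBall hf' x (t + 1)
  refine hasFDerivAt_integral_of_dominated_of_fderiv_le (ball_mem_nhds x one_pos)
    (F' := fun y ω => w ω • fderiv ℝ f (y + Y ω)) (bound := fun ω => |w ω| * C)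
    (Eventually.of_forall fun y => (h.integrable_mul hf.continuous y).aestronglyMeasurable)
    (h.integrable_mul hf.continuous x) (h.integrable_smul hf' x).aestronglyMeasurable ?_
    (h.integrable.norm.mul_const C) ?_
  · filter_upwards [h.supp] with ω hω y hy
    rw [norm_smul]
    by_cases h0 : w ω = 0
    · simp [h0]
    · refine mul_le_mul_of_nonneg_left (hC _ ?_) (norm_nonneg _)
      rw [mem_closedBall, dist_eq_norm]
      rw [mem_ball, dist_eq_norm] at hy
      calc ‖y + Y ω - x‖ = ‖Y ω + (y - x)‖ := by congr 1; abel
        _ ≤ ‖Y ω‖ + ‖y - x‖ := norm_add_le _ _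
        _ ≤ t + 1 := add_le_add (hω h0) hy.le
  · refine Eventually.of_forall fun ω y _ => ?_
    have h1 : HasFDerivAt f (fderiv ℝ f (y + Y ω)) (y + Y ω) :=
      (hf.differentiable one_ne_zero _).hasFDerivAt
    have h2 : HasFDerivAt (fun z : Euc N => z + Y ω) (ContinuousLinearMap.id ℝ (Euc N)) y :=
      (hasFDerivAt_id y).add_const _
    have h3 := h1.comp y h2
    simpa using h3.const_mul (w ω)

lemma fderiv_apply (h : IsAvgKernel P w Y t) (hf : ContDiff ℝ 1 f) (x e : Euc N) :
    fderiv ℝ (wavg P w Y f) x e = wavg P w Y (fun y => fderiv ℝ f y e) x := by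
  rw [(h.hasFDerivAt hf x).fderiv, ContinuousLinearMap.integral_apply
    (h.integrable_smul (hf.continuous_fderiv one_ne_zero) x)]
  rfl

lemma tendsto {ι : Type*} {l : Filter ι} [l.IsCountablyGenerated] (h : IsAvgKernel P w Y t)
    {F : ι → Euc N → ℝ} (hF : ∀ k, Continuous (F k)) {x : Euc N} {M : ℝ}
    (hM : ∀ᶠ k in l, ∀ y ∈ closedBall x t, |F k y| ≤ M)
    (hlim : ∀ y ∈ closedBall x t, Tendsto (fun k => F k y) l (𝓝 (f y))) :
    Tendsto (fun k => wavg P w Y (F k) x) l (𝓝 (wavg P w Y f x)) := by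
  refine tendsto_integral_filter_of_dominated_convergence (fun ω => |w ω| * M)
    (Eventually.of_forall fun k => (h.integrable_mul (hF k) x).aestronglyMeasurable) ?_
    (h.integrable.norm.mul_const M) ?_
  · filter_upwards [hM] with k hk
    filter_upwards [h.ae_mem x] with ω hω
    rw [norm_mul]
    by_cases h0 : w ω = 0
    · simp [h0]
    · exact mul_le_mul_of_nonneg_left (hk _ (hω h0)) (norm_nonneg _)
  · filter_upwards [h.ae_mem x] with ω hω
    by_cases h0 : w ω = 0
    · simpa [h0] using tendsto_const_nhds
    · exact (hlim _ (hω h0)).const_mul _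

lemma continuous (h : IsAvgKernel P w Y t) (hf : Continuous f) : Continuous (wavg P w Y f) := by
  rw [continuous_iff_continuousAt]
  intro x
  obtain ⟨C, hC0, hC⟩ := exists_bound_closedBall hf x (t + 1)
  refine tendsto_integral_filter_of_dominated_convergence (fun ω => |w ω| * C)
    (Eventually.of_forall fun y => (h.integrable_mul hf y).aestronglyMeasurable) ?_
    (h.integrable.norm.mul_const C) ?_
  · filter_upwards [ball_mem_nhds x one_pos] with y hy
    filter_upwards [h.supp] with ω hω
    rw [norm_mul]
    by_cases h0 : w ω = 0
    · simp [h0]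
    · refine mul_le_mul_of_nonneg_left (hC _ ?_) (norm_nonneg _)
      rw [mem_closedBall, dist_eq_norm]
      rw [mem_ball, dist_eq_norm] at hy
      calc ‖y + Y ω - x‖ = ‖Y ω + (y - x)‖ := by congr 1; abel
        _ ≤ ‖Y ω‖ + ‖y - x‖ := norm_add_le _ _
        _ ≤ t + 1 := add_le_add (hω h0) hy.le
  · refine Eventually.of_forall fun ω => ?_
    have : Continuous fun y => w ω * f (y + Y ω) := by fun_prop
    exact this.tendsto x

lemma contDiff (h : IsAvgKernel P w Y t) (n : ℕ) (hf : ContDiff ℝ n f) :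
    ContDiff ℝ n (wavg P w Y f) := by
  induction n generalizing f with
  | zero =>
    rw [Nat.cast_zero, contDiff_zero] at hf ⊢
    exact h.continuous hf
  | succ n ih =>
    have hf1 : ContDiff ℝ 1 f := hf.of_le (by norm_cast; omega)
    push_cast at hf ⊢
    rw [contDiff_succ_iff_fderiv_apply] at hf ⊢
    refine ⟨fun x => (h.hasFDerivAt hf1 x).differentiableAt, by simp, fun e => ?_⟩
    have : (fun x => fderiv ℝ (wavg P w Y f) x e) = wavg P w Y (fun y => fderiv ℝ f y e) :=
      funext fun x => h.fderiv_apply hf1 x e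
    rw [this]
    exact ih (hf.2.2 e)

end IsAvgKernel

lemma lap_eq_fderiv (f : Euc N → ℝ) (hf : ContDiff ℝ 2 f) (x : Euc N) :
    lap f x = ∑ i : Fin N, fderiv ℝ (fun y => fderiv ℝ f y (EuclideanSpace.single i 1)) x
      (EuclideanSpace.single i 1) := by
  refine Finset.sum_congr rfl fun i _ => ?_
  rw [iteratedFDeriv_two_apply]
  have hd : DifferentiableAt ℝ (fderiv ℝ f) x :=
    ((hf.fderiv_right (m := 1) (by norm_num)).differentiable one_ne_zero) x
  rw [fderiv_clm_apply hd (differentiableAt_const _)]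
  simp

lemma contDiff_fderiv_apply {n : ℕ} {f : Euc N → ℝ} (hf : ContDiff ℝ (n + 1 : ℕ) f) (e : Euc N) :
    ContDiff ℝ n (fun y => fderiv ℝ f y e) := by
  push_cast at hf
  exact (contDiff_succ_iff_fderiv_apply.1 hf).2.2 e

lemma continuous_lap {f : Euc N → ℝ} (hf : ContDiff ℝ 2 f) : Continuous (lap f) := by
  have : lap f = fun x => ∑ i : Fin N,
      fderiv ℝ (fun y => fderiv ℝ f y (EuclideanSpace.single i 1)) x
      (EuclideanSpace.single i 1) := funext (lap_eq_fderiv f hf)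
  rw [this]
  refine continuous_finsetSum _ fun i _ => ?_
  exact (contDiff_fderiv_apply (n := 0)
    (contDiff_fderiv_apply (n := 1) (by exact_mod_cast hf) _) _).continuous

lemma lap_congr {f g : Euc N → ℝ} {x : Euc N} (h : f =ᶠ[𝓝 x] g) : lap f x = lap g x := by
  simp only [lap]
  refine Finset.sum_congr rfl fun i _ => ?_
  rw [(h.iteratedFDeriv ℝ 2).eq_of_nhds]

lemma IsAvgKernel.lap_eq {Ω : Type*} [MeasurableSpace Ω] {P : Measure Ω} {w : Ω → ℝ}
    {Y : Ω → Euc N} {t : ℝ} {f : Euc N → ℝ} (h : IsAvgKernel P w Y t) (hf : ContDiff ℝ 2 f)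
    (x : Euc N) : lap (wavg P w Y f) x = wavg P w Y (lap f) x := by
  have hlap : lap f = fun x => ∑ i : Fin N,
      fderiv ℝ (fun y => fderiv ℝ f y (EuclideanSpace.single i 1)) x
      (EuclideanSpace.single i 1) := funext (lap_eq_fderiv f hf)
  have hf2 : ContDiff ℝ (1 + 1 : ℕ) f := by exact_mod_cast hf
  have h1 : ∀ e : Euc N, ContDiff ℝ (0 + 1 : ℕ) (fun y => fderiv ℝ f y e) := fun e =>
    contDiff_fderiv_apply hf2 e
  rw [lap_eq_fderiv _ (by exact_mod_cast h.contDiff 2 (by exact_mod_cast hf)), hlap,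
    h.finset_sum _ fun i _ => (contDiff_fderiv_apply (h1 _) _).continuous]
  refine Finset.sum_congr rfl fun i _ => ?_
  rw [← h.fderiv_apply (by exact_mod_cast h1 _)]
  congr 2
  exact funext fun y => h.fderiv_apply (hf.of_le (by norm_num)) y _

/-- A continuous kernel vanishing outside of the open unit ball. -/
structure IsUnitKernel {F : Type*} [NormedAddCommGroup F] (κ : Euc N → F) : Prop where
  continuous : Continuous κ
  eq_zero : ∀ z, 1 ≤ ‖z‖ → κ z = 0

/-- The average of `f` at scale `s` with respect to the kernel `κ`. -/
def avg (κ : Euc N → ℝ) (s : ℝ) : (Euc N → ℝ) → Euc N → ℝ :=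
  wavg volume κ (fun z => s • z)

/-- The superposition of the averages of `f` at scales `s ∈ (0, t]`, with weight `s ^ j`. -/
def pot (j : ℕ) (κ : Euc N → ℝ) (t : ℝ) : (Euc N → ℝ) → Euc N → ℝ :=
  wavg ((volume.restrict (Ioc 0 t)).prod volume) (fun p => p.1 ^ j * κ p.2) (fun p => p.1 • p.2)

namespace IsUnitKernel

variable {F : Type*} [NormedAddCommGroup F]

lemma hasCompactSupport {κ : Euc N → F} (h : IsUnitKernel κ) : HasCompactSupport κ :=
  HasCompactSupport.intro (isCompact_closedBall 0 1) fun z hz => h.eq_zero z (by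
    simp only [mem_closedBall, dist_zero_right, not_le] at hz
    exact hz.le)

lemma integrable {κ : Euc N → F} (h : IsUnitKernel κ) : Integrable κ :=
  h.continuous.integrable_of_hasCompactSupport h.hasCompactSupport

lemma norm_le {κ : Euc N → F} (h : IsUnitKernel κ) {z : Euc N} (hz : κ z ≠ 0) : ‖z‖ ≤ 1 := by
  by_contra hc
  exact hz (h.eq_zero z (not_le.1 hc).le)

lemma apply {κ : Euc N → (Euc N →L[ℝ] ℝ)} (h : IsUnitKernel κ) (e : Euc N) :
    IsUnitKernel fun z => κ z e :=
  ⟨h.continuous.clm_apply continuous_const, fun z hz => by simp [h.eq_zero z hz]⟩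

variable {κ : Euc N → ℝ}

lemma avg (h : IsUnitKernel κ) {s : ℝ} (hs : 0 ≤ s) :
    IsAvgKernel volume κ (fun z => s • z) s where
  integrable := h.integrable
  measurable := by fun_prop
  supp := Eventually.of_forall fun z hz => by
    rw [norm_smul, Real.norm_of_nonneg hs]
    exact mul_le_of_le_one_right hs (h.norm_le hz)

lemma pot (h : IsUnitKernel κ) (j : ℕ) (t : ℝ) :
    IsAvgKernel ((volume.restrict (Ioc 0 t)).prod volume) (fun p : ℝ × Euc N => p.1 ^ j * κ p.2)
      (fun p => p.1 • p.2) t where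
  integrable := by
    refine Integrable.mul_prod ?_ h.integrable
    exact (continuous_id.pow j).continuousOn.integrableOn_Icc.mono_set Ioc_subset_Icc_self
  measurable := by fun_prop
  supp := by
    have h1 : ∀ᵐ p : ℝ × Euc N ∂((volume.restrict (Ioc 0 t)).prod volume), p.1 ∈ Ioc 0 t :=
      Measure.quasiMeasurePreserving_fst.ae (ae_restrict_mem measurableSet_Ioc)
    filter_upwards [h1] with p hp hz
    rw [norm_smul, Real.norm_of_nonneg hp.1.le]
    exact (mul_le_of_le_one_right hp.1.le (h.norm_le (right_ne_zero_of_mul hz))).trans hp.2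

lemma pot_nonneg (hκ : ∀ z, 0 ≤ κ z) (j : ℕ) (t : ℝ) :
    ∀ᵐ p : ℝ × Euc N ∂((volume.restrict (Ioc 0 t)).prod volume), 0 ≤ p.1 ^ j * κ p.2 := by
  have h1 : ∀ᵐ p : ℝ × Euc N ∂((volume.restrict (Ioc 0 t)).prod volume), p.1 ∈ Ioc 0 t :=
    Measure.quasiMeasurePreserving_fst.ae (ae_restrict_mem measurableSet_Ioc)
  filter_upwards [h1] with p hp
  exact mul_nonneg (pow_nonneg hp.1.le j) (hκ _)

lemma intervalIntegrable_avg (h : IsUnitKernel κ) (j : ℕ) {t : ℝ} (ht : 0 ≤ t) {f : Euc N → ℝ}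
    (hf : Continuous f) (x : Euc N) :
    IntervalIntegrable (fun s => s ^ j * _root_.avg κ s f x) volume 0 t := by
  rw [intervalIntegrable_iff_integrableOn_Ioc_of_le ht]
  have := ((h.pot j t).integrable_mul hf x).integral_prod_left
  refine this.congr (Eventually.of_forall fun s => ?_)
  simp only [_root_.avg, wavg, mul_assoc, integral_const_mul]

lemma pot_eq (h : IsUnitKernel κ) (j : ℕ) {t : ℝ} (ht : 0 ≤ t) {f : Euc N → ℝ}
    (hf : Continuous f) (x : Euc N) :
    _root_.pot j κ t f x = ∫ s in (0 : ℝ)..t, s ^ j * _root_.avg κ s f x := by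
  rw [intervalIntegral.integral_of_le ht]
  simp only [_root_.pot, wavg]
  rw [integral_prod _ ((h.pot j t).integrable_mul hf x)]
  simp only [_root_.avg, wavg, mul_assoc, integral_const_mul]

end IsUnitKernel

lemma integral_scale_translate {F : Type*} [NormedAddCommGroup F] [NormedSpace ℝ F]
    (κ : Euc N → F) (g : Euc N → ℝ) {s : ℝ} (hs : 0 < s) (x : Euc N) :
    ∫ z, g (x + s • z) • κ z = (s ^ N)⁻¹ • ∫ y, g y • κ (s⁻¹ • (y - x)) := by
  have h1 := Measure.integral_comp_smul (volume : Measure (Euc N))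
    (fun w => g (x + w) • κ (s⁻¹ • w)) s
  have h2 := integral_add_left_eq_self (μ := (volume : Measure (Euc N)))
    (fun y => g y • κ (s⁻¹ • (y - x))) x
  simp only [add_sub_cancel_left] at h2
  rw [h2, finrank_euclideanSpace_fin, abs_of_pos (by positivity)] at h1
  rw [← h1]
  simp only [smul_smul, inv_mul_cancel₀ hs.ne', one_smul]

lemma hasFDerivAt_avg {κ : Euc N → ℝ} {κ' : Euc N → (Euc N →L[ℝ] ℝ)} (hκ : IsUnitKernel κ)
    (hκ' : IsUnitKernel κ') (hd : ∀ z, HasFDerivAt κ (κ' z) z) {g : Euc N → ℝ}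
    (hg : Continuous g) {s : ℝ} (hs : 0 < s) (x : Euc N) :
    HasFDerivAt (avg κ s g) (-s⁻¹ • ∫ z, g (x + s • z) • κ' z) x := by
  have h0 : avg κ s g = fun x => (s ^ N)⁻¹ • ∫ y, g y * κ (s⁻¹ • (y - x)) := by
    funext x
    have := integral_scale_translate κ g hs x
    simp only [smul_eq_mul] at this ⊢
    rw [← this]
    simp only [avg, wavg, mul_comm]
  have h1 : -s⁻¹ • ∫ z, g (x + s • z) • κ' z =
      (s ^ N)⁻¹ • ∫ y, -s⁻¹ • g y • κ' (s⁻¹ • (y - x)) := by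
    rw [integral_scale_translate κ' g hs x, integral_smul, smul_comm]
  rw [h0, h1]
  refine HasFDerivAt.fun_const_smul ?_ _
  obtain ⟨C, hC⟩ := hκ'.continuous.bounded_above_of_compact_support hκ'.hasCompactSupport
  have hcs : ∀ y : Euc N, HasCompactSupport fun z => κ (s⁻¹ • (z - y)) := fun y => by
    refine HasCompactSupport.intro (isCompact_closedBall y s) fun z hz => hκ.eq_zero _ ?_
    rw [mem_closedBall, not_le, dist_eq_norm] at hz
    rw [norm_smul, Real.norm_of_nonneg (inv_nonneg.2 hs.le), ← div_eq_inv_mul, one_le_div hs]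
    exact hz.le
  have hInt : ∀ y : Euc N, Integrable fun z => g z * κ (s⁻¹ • (z - y)) := fun y => by
    refine Continuous.integrable_of_hasCompactSupport ?_ (hcs y).mul_left
    exact hg.mul (hκ.continuous.comp (by fun_prop))
  refine hasFDerivAt_integral_of_dominated_of_fderiv_le (ball_mem_nhds x one_pos)
    (F' := fun y z => -s⁻¹ • g z • κ' (s⁻¹ • (z - y)))
    (bound := (closedBall x (s + 1)).indicator fun z => s⁻¹ * (|g z| * C))
    (Eventually.of_forall fun y => (hInt y).aestronglyMeasurable) (hInt x) ?_ ?_ ?_ ?_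
  · refine Continuous.aestronglyMeasurable ?_
    have h2 : Continuous fun z : Euc N => s⁻¹ • (z - x) := by fun_prop
    exact (hg.smul (hκ'.continuous.comp h2)).const_smul (-s⁻¹)
  · refine Eventually.of_forall fun z y hy => ?_
    by_cases hz : z ∈ closedBall x (s + 1)
    · rw [indicator_of_mem hz, norm_smul, norm_smul, norm_neg,
        Real.norm_of_nonneg (inv_nonneg.2 hs.le)]
      gcongr
      · exact le_rfl
      · exact hC _
    · rw [indicator_of_notMem hz, hκ'.eq_zero]
      · simp
      · rw [norm_smul, Real.norm_of_nonneg (inv_nonneg.2 hs.le), ← div_eq_inv_mul, one_le_div hs]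
        rw [mem_closedBall, not_le] at hz
        rw [mem_ball, dist_comm] at hy
        have := dist_triangle z y x
        rw [← dist_eq_norm]
        rw [dist_comm] at hy
        linarith
  · rw [integrable_indicator_iff measurableSet_closedBall]
    have : Continuous fun z => s⁻¹ * (|g z| * C) := by fun_prop
    exact this.continuousOn.integrableOn_compact (isCompact_closedBall _ _)
  · refine Eventually.of_forall fun z y _ => ?_
    have h1 : HasFDerivAt (fun y : Euc N => s⁻¹ • (z - y))
        (s⁻¹ • -ContinuousLinearMap.id ℝ (Euc N)) y :=
      ((hasFDerivAt_id y).const_sub z).fun_const_smul _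
    have h2 := ((hd _).comp y h1).const_mul (g z)
    refine h2.congr_fderiv ?_
    ext e
    simp
    ring

lemma hasFDerivAt_pot {κ : Euc N → ℝ} {κ' : Euc N → (Euc N →L[ℝ] ℝ)} (hκ : IsUnitKernel κ)
    (hκ' : IsUnitKernel κ') (hd : ∀ z, HasFDerivAt κ (κ' z) z) {g : Euc N → ℝ}
    (hg : Continuous g) {t : ℝ} (ht : 0 ≤ t) (x : Euc N) :
    HasFDerivAt (pot 1 κ t g) (∫ s in Ioc 0 t, -∫ z, g (x + s • z) • κ' z) x := by
  have h0 : pot 1 κ t g = fun x => ∫ s in Ioc 0 t, s ^ 1 * avg κ s g x := by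
    funext x
    rw [hκ.pot_eq 1 ht hg x, intervalIntegral.integral_of_le ht]
  have hI : ∀ y, IntegrableOn (fun s => s ^ 1 * avg κ s g y) (Ioc 0 t) := fun y => by
    rw [← intervalIntegrable_iff_integrableOn_Ioc_of_le ht]
    exact hκ.intervalIntegrable_avg 1 ht hg y
  rw [h0]
  obtain ⟨C, hC0, hC⟩ := exists_bound_closedBall hg x (t + 1)
  refine hasFDerivAt_integral_of_dominated_of_fderiv_le (ball_mem_nhds x one_pos)
    (F' := fun y s => -∫ z, g (y + s • z) • κ' z) (bound := fun _ => ∫ z, C * ‖κ' z‖)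
    (Eventually.of_forall fun y => (hI y).aestronglyMeasurable) (hI x) ?_ ?_ ?_ ?_
  · refine AEStronglyMeasurable.neg ?_
    refine (StronglyMeasurable.integral_prod_right'
      (f := fun p : ℝ × Euc N => g (x + p.1 • p.2) • κ' p.2) ?_).aestronglyMeasurable
    refine Continuous.stronglyMeasurable ?_
    exact (hg.comp (by fun_prop)).smul (hκ'.continuous.comp continuous_snd)
  · filter_upwards [ae_restrict_mem measurableSet_Ioc] with s hs y hy
    rw [norm_neg]
    refine norm_integral_le_of_norm_le (hκ'.integrable.norm.const_mul C)
      (Eventually.of_forall fun z => ?_)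
    rw [norm_smul]
    by_cases hz : κ' z = 0
    · simp [hz]
    · refine mul_le_mul_of_nonneg_right (hC _ ?_) (norm_nonneg _)
      rw [mem_closedBall, dist_eq_norm]
      rw [mem_ball, dist_eq_norm] at hy
      have hz1 := hκ'.norm_le hz
      calc ‖y + s • z - x‖ = ‖s • z + (y - x)‖ := by congr 1; abel
        _ ≤ ‖s • z‖ + ‖y - x‖ := norm_add_le _ _
        _ ≤ t + 1 := by
          refine add_le_add ?_ hy.le
          rw [norm_smul, Real.norm_of_nonneg hs.1.le]
          exact (mul_le_of_le_one_right hs.1.le hz1).trans hs.2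
  · exact integrable_const _
  · filter_upwards [ae_restrict_mem measurableSet_Ioc] with s hs y _
    have := (hasFDerivAt_avg hκ hκ' hd hg hs.1 y).const_mul (s ^ 1)
    refine this.congr_fderiv ?_
    rw [smul_smul, pow_one, mul_neg, mul_inv_cancel₀ hs.1.ne', neg_one_smul]

lemma fderiv_pot_apply {κ : Euc N → ℝ} {κ' : Euc N → (Euc N →L[ℝ] ℝ)} (hκ : IsUnitKernel κ)
    (hκ' : IsUnitKernel κ') (hd : ∀ z, HasFDerivAt κ (κ' z) z) {g : Euc N → ℝ}
    (hg : Continuous g) {t : ℝ} (ht : 0 ≤ t) (x e : Euc N) :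
    fderiv ℝ (pot 1 κ t g) x e = -pot 0 (fun z => κ' z e) t g x := by
  have hi : Integrable (fun p : ℝ × Euc N => g (x + p.1 • p.2) • κ' p.2)
      ((volume.restrict (Ioc 0 t)).prod volume) := by
    obtain ⟨C, hC0, hC⟩ := exists_bound_closedBall hg x t
    have hc : Integrable (fun p : ℝ × Euc N => C * ‖κ' p.2‖)
      ((volume.restrict (Ioc 0 t)).prod volume) :=
      Integrable.mul_prod (integrable_const C) hκ'.integrable.norm
    refine hc.mono' (Continuous.aestronglyMeasurable
      ((hg.comp (by fun_prop)).smul (hκ'.continuous.comp continuous_snd))) ?_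
    have h1 : ∀ᵐ p : ℝ × Euc N ∂((volume.restrict (Ioc 0 t)).prod volume), p.1 ∈ Ioc 0 t :=
      Measure.quasiMeasurePreserving_fst.ae (ae_restrict_mem measurableSet_Ioc)
    filter_upwards [h1] with p hp
    rw [norm_smul]
    by_cases hz : κ' p.2 = 0
    · simp [hz]
    · refine mul_le_mul_of_nonneg_right (hC _ ?_) (norm_nonneg _)
      rw [mem_closedBall, dist_eq_norm, add_sub_cancel_left, norm_smul,
        Real.norm_of_nonneg hp.1.le]
      exact (mul_le_of_le_one_right hp.1.le (hκ'.norm_le hz)).trans hp.2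
  rw [(hasFDerivAt_pot hκ hκ' hd hg ht x).fderiv, integral_neg,
    ← integral_prod (fun p : ℝ × Euc N => g (x + p.1 • p.2) • κ' p.2) hi,
    neg_apply, ContinuousLinearMap.integral_apply hi]
  simp [pot, wavg, mul_comm]

lemma contDiff_avg_succ {κ : Euc N → ℝ} {κ' : Euc N → (Euc N →L[ℝ] ℝ)} (hκ : IsUnitKernel κ)
    (hκ' : IsUnitKernel κ') (hd : ∀ z, HasFDerivAt κ (κ' z) z) {g : Euc N → ℝ} {n : ℕ}
    (hg : ContDiff ℝ n g) {s : ℝ} (hs : 0 < s) : ContDiff ℝ (n + 1 : ℕ) (avg κ s g) := by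
  push_cast
  rw [contDiff_succ_iff_fderiv_apply]
  have hgc := hg.continuous
  refine ⟨fun x => (hasFDerivAt_avg hκ hκ' hd hgc hs x).differentiableAt, by simp, fun e => ?_⟩
  have : (fun x => fderiv ℝ (avg κ s g) x e) = fun x => -s⁻¹ * avg (fun z => κ' z e) s g x := by
    funext x
    have hi : Integrable fun z : Euc N => g (x + s • z) • κ' z :=
      Continuous.integrable_of_hasCompactSupport
        ((hgc.comp (by fun_prop)).smul hκ'.continuous) 
        (hκ'.hasCompactSupport.smul_left (f := fun z => g (x + s • z)))
    rw [(hasFDerivAt_avg hκ hκ' hd hgc hs x).fderiv, smul_apply,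
      ContinuousLinearMap.integral_apply hi]
    simp [avg, wavg, mul_comm]
  rw [this]
  exact contDiff_const.mul (((hκ'.apply e).avg hs.le).contDiff n hg)

lemma contDiff_pot_succ {κ : Euc N → ℝ} {κ' : Euc N → (Euc N →L[ℝ] ℝ)} (hκ : IsUnitKernel κ)
    (hκ' : IsUnitKernel κ') (hd : ∀ z, HasFDerivAt κ (κ' z) z) {g : Euc N → ℝ} {n : ℕ}
    (hg : ContDiff ℝ n g) {t : ℝ} (ht : 0 ≤ t) : ContDiff ℝ (n + 1 : ℕ) (pot 1 κ t g) := by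
  push_cast
  rw [contDiff_succ_iff_fderiv_apply]
  refine ⟨fun x => (hasFDerivAt_pot hκ hκ' hd hg.continuous ht x).differentiableAt, by simp,
    fun e => ?_⟩
  have : (fun x => fderiv ℝ (pot 1 κ t g) x e) = fun x => -pot 0 (fun z => κ' z e) t g x :=
    funext fun x => fderiv_pot_apply hκ hκ' hd hg.continuous ht x e
  rw [this]
  exact (((hκ'.apply e).pot 0 t).contDiff n hg).neg

lemma hasDerivAt_max_zero_pow (n : ℕ) (hn : n ≠ 0) (x : ℝ) :
    HasDerivAt (fun y : ℝ => max y 0 ^ (n + 1)) ((n + 1) * max x 0 ^ n) x := by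
  have hne : ∀ y : ℝ, y ≠ 0 →
      HasDerivAt (fun y : ℝ => max y 0 ^ (n + 1)) ((n + 1) * max y 0 ^ n) y := by
    intro y hy
    rcases lt_or_gt_of_ne hy with hy | hy
    · rw [max_eq_right hy.le, zero_pow hn, mul_zero]
      refine (hasDerivAt_const y (0 : ℝ)).congr_of_eventuallyEq ?_
      filter_upwards [eventually_lt_nhds hy] with z hz
      rw [max_eq_right hz.le, zero_pow n.succ_ne_zero]
    · rw [max_eq_left hy.le]
      have := hasDerivAt_pow (n + 1) y
      simp only [Nat.cast_add, Nat.cast_one, add_tsub_cancel_right] at this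
      refine this.congr_of_eventuallyEq ?_
      filter_upwards [eventually_gt_nhds hy] with z hz
      rw [max_eq_left hz.le]
  by_cases hx : x = 0
  · subst hx
    refine hasDerivAt_of_hasDerivAt_of_ne (g := fun x => (n + 1) * max x 0 ^ n) hne ?_ ?_
    · exact Continuous.continuousAt (by fun_prop)
    · exact Continuous.continuousAt (by fun_prop)
  · exact hne x hx

/-- The truncated paraboloid `(1 - ‖z‖²)₊ⁿ`. -/
def bump (n : ℕ) (z : Euc N) : ℝ := max (1 - ‖z‖ ^ 2) 0 ^ n
lemma bump_nonneg (n : ℕ) (z : Euc N) : 0 ≤ bump n z := pow_nonneg (le_max_right _ _) _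

lemma bump_le_one (n : ℕ) (z : Euc N) : bump n z ≤ 1 := by
  refine pow_le_one₀ (le_max_right _ _) (max_le ?_ zero_le_one)
  linarith [sq_nonneg ‖z‖]

lemma le_bump (n : ℕ) {z : Euc N} (hz : ‖z‖ ≤ 2 / 3) : (5 / 9 : ℝ) ^ n ≤ bump n z := by
  refine pow_le_pow_left₀ (by norm_num) (le_max_of_le_left ?_) n
  nlinarith [norm_nonneg z]

lemma isUnitKernel_bump (n : ℕ) (hn : n ≠ 0) : IsUnitKernel (bump (N := N) n) where
  continuous := by unfold bump; fun_prop
  eq_zero z hz := by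
    rw [bump, max_eq_right (by nlinarith), zero_pow hn]

lemma isUnitKernel_bump_inner (n : ℕ) (hn : n ≠ 0) (c : ℝ) :
    IsUnitKernel fun z : Euc N => (c * bump n z) • innerSL ℝ z where
  continuous := (continuous_const.mul (isUnitKernel_bump n hn).continuous).smul
    (innerSL ℝ).continuous
  eq_zero z hz := by simp [(isUnitKernel_bump n hn).eq_zero z hz]

lemma hasFDerivAt_bump (n : ℕ) (hn : n ≠ 0) (z : Euc N) :
    HasFDerivAt (bump (N := N) (n + 1)) ((-2 * (n + 1) * bump n z) • innerSL ℝ z) z := by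
  have h1 : HasFDerivAt (fun z : Euc N => 1 - ‖z‖ ^ 2) (-(2 • innerSL ℝ z)) z :=
    (hasStrictFDerivAt_norm_sq z).hasFDerivAt.const_sub 1
  refine ((hasDerivAt_max_zero_pow n hn _).comp_hasFDerivAt z h1).congr_fderiv ?_
  ext e
  simp [bump]
  ring

/-- The normalizing constant of the kernels. -/
def kconst (N : ℕ) : ℝ := (∫ z : Euc N, 6 * bump 2 z)⁻¹

lemma integral_bump_pos (n : ℕ) (hn : n ≠ 0) : 0 < ∫ z : Euc N, bump n z := by
  have hk := isUnitKernel_bump (N := N) n hn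
  refine hk.continuous.integral_pos_of_hasCompactSupport_nonneg_nonzero hk.hasCompactSupport
    (bump_nonneg n) (x := 0) ?_
  simp [bump]

lemma kconst_pos (N : ℕ) : 0 < kconst N := by
  rw [kconst, integral_const_mul]
  have := integral_bump_pos (N := N) 2 two_ne_zero
  positivity

/-- A probability kernel, which is minus the radial derivative of `kerB` divided by the radius. -/
def kerA (z : Euc N) : ℝ := kconst N * (6 * bump 2 z)

/-- The kernel for which `d/ds (avg kerA s f) = s * avg kerB s (lap f)`. -/
def kerB (z : Euc N) : ℝ := kconst N * bump 3 z

/-- The differential of `kerA`. -/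
def kerA' (z : Euc N) : Euc N →L[ℝ] ℝ := (-24 * kconst N * bump 1 z) • innerSL ℝ z

/-- The differential of `kerB`. -/
def kerB' (z : Euc N) : Euc N →L[ℝ] ℝ := (-6 * kconst N * bump 2 z) • innerSL ℝ z

lemma isUnitKernel_kerA : IsUnitKernel (kerA (N := N)) where
  continuous := continuous_const.mul
    (continuous_const.mul (isUnitKernel_bump 2 two_ne_zero).continuous)
  eq_zero z hz := by simp [kerA, (isUnitKernel_bump 2 two_ne_zero).eq_zero z hz]

lemma isUnitKernel_kerB : IsUnitKernel (kerB (N := N)) where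
  continuous := continuous_const.mul (isUnitKernel_bump 3 three_ne_zero).continuous
  eq_zero z hz := by simp [kerB, (isUnitKernel_bump 3 three_ne_zero).eq_zero z hz]

lemma isUnitKernel_kerA' : IsUnitKernel (kerA' (N := N)) :=
  isUnitKernel_bump_inner 1 one_ne_zero _

lemma isUnitKernel_kerB' : IsUnitKernel (kerB' (N := N)) :=
  isUnitKernel_bump_inner 2 two_ne_zero _

lemma hasFDerivAt_kerA (z : Euc N) : HasFDerivAt kerA (kerA' z) z := by
  refine (((hasFDerivAt_bump 1 one_ne_zero z).const_mul 6).const_mul (kconst N)).congr_fderiv ?_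
  ext e
  simp [kerA']
  ring

lemma hasFDerivAt_kerB (z : Euc N) : HasFDerivAt kerB (kerB' z) z := by
  refine ((hasFDerivAt_bump 2 two_ne_zero z).const_mul (kconst N)).congr_fderiv ?_
  ext e
  simp [kerB']
  ring

lemma kerA_nonneg (z : Euc N) : 0 ≤ kerA z :=
  mul_nonneg (kconst_pos N).le (mul_nonneg (by norm_num) (bump_nonneg _ _))

lemma kerB_nonneg (z : Euc N) : 0 ≤ kerB z := mul_nonneg (kconst_pos N).le (bump_nonneg _ _)

lemma integral_kerA : ∫ z : Euc N, kerA z = 1 := by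
  simp only [kerA]
  rw [integral_const_mul, kconst]
  refine inv_mul_cancel₀ ?_
  rw [integral_const_mul]
  have := integral_bump_pos (N := N) 2 two_ne_zero
  positivity

lemma integral_kerB_pos : 0 < ∫ z : Euc N, kerB z := by
  simp only [kerB]
  rw [integral_const_mul]
  exact mul_pos (kconst_pos N) (integral_bump_pos 3 three_ne_zero)

lemma kerA_zero_scale (f : Euc N → ℝ) (x : Euc N) : avg kerA 0 f x = f x := by
  simp only [avg, wavg, zero_smul, add_zero]
  rw [integral_mul_const, integral_kerA, one_mul]

lemma avg_kerA_deriv_integrand {f : Euc N → ℝ} (hf : ContDiff ℝ 2 f) (s : ℝ) (x : Euc N) :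
    ∫ z, kerA z * fderiv ℝ f (x + s • z) z = s * avg kerB s (lap f) x := by
  have hf2 : ContDiff ℝ (1 + 1 : ℕ) f := by exact_mod_cast hf
  set e : Fin N → Euc N := fun i => EuclideanSpace.single i 1 with he
  have hi : ∀ i, ContDiff ℝ 1 fun y => fderiv ℝ f y (e i) := fun i =>
    by exact_mod_cast contDiff_fderiv_apply hf2 (e i)
  have hii : ∀ i, Continuous fun y => fderiv ℝ (fun y => fderiv ℝ f y (e i)) y (e i) := fun i =>
    (contDiff_fderiv_apply (n := 0) (by exact_mod_cast hi i) _).continuous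
  have hkey : ∀ i, ∫ z, kerB' z (e i) * fderiv ℝ f (x + s • z) (e i) =
      -∫ z, kerB z * (s * fderiv ℝ (fun y => fderiv ℝ f y (e i)) (x + s • z) (e i)) := by
    intro i
    have hg : ∀ z, HasFDerivAt (fun z => fderiv ℝ f (x + s • z) (e i))
        (s • fderiv ℝ (fun y => fderiv ℝ f y (e i)) (x + s • z)) z := fun z => by
      have h1 : HasFDerivAt (fun z : Euc N => x + s • z) (s • ContinuousLinearMap.id ℝ (Euc N)) z :=
        ((hasFDerivAt_id z).fun_const_smul s).const_add x
      refine ((((hi i).differentiable one_ne_zero _).hasFDerivAt).comp z h1).congr_fderiv ?_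
      ext; simp
    have hB : ∀ z : Euc N, fderiv ℝ kerB z = kerB' z := fun z => (hasFDerivAt_kerB z).fderiv
    have hcg : Continuous fun z => fderiv ℝ f (x + s • z) (e i) :=
      (hi i).continuous.comp (by fun_prop)
    have hcg' : Continuous fun z => s * fderiv ℝ (fun y => fderiv ℝ f y (e i)) (x + s • z) (e i) :=
      continuous_const.mul ((hii i).comp (by fun_prop))
    have kB' := isUnitKernel_kerB'.apply (e i)
    have kB := isUnitKernel_kerB (N := N)
    have hp := integral_mul_fderiv_eq_neg_fderiv_mul_of_integrable (μ := (volume : Measure (Euc N)))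
      (f := kerB) (g := fun z => fderiv ℝ f (x + s • z) (e i)) (v := e i) ?_ ?_ ?_
      (fun z _ => (hasFDerivAt_kerB z).differentiableAt) (fun z _ => (hg z).differentiableAt)
    · simp only [hB, (hg _).fderiv] at hp
      simp only [smul_apply, smul_eq_mul] at hp
      rw [hp, neg_neg]
    · simp only [hB]
      exact (kB'.continuous.mul hcg).integrable_of_hasCompactSupport kB'.hasCompactSupport.mul_right
    · simp only [(hg _).fderiv]
      exact (kB.continuous.mul hcg').integrable_of_hasCompactSupport kB.hasCompactSupport.mul_right
    · exact (kB.continuous.mul hcg).integrable_of_hasCompactSupport kB.hasCompactSupport.mul_right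
  have hsum : ∀ z, kerA z * fderiv ℝ f (x + s • z) z =
      ∑ i, -(kerB' z (e i) * fderiv ℝ f (x + s • z) (e i)) := by
    intro z
    have hz : z = ∑ i, z i • e i := by
      ext j
      simp [he, Pi.single_apply]
    conv_lhs => rw [hz, map_sum, ← hz]
    rw [Finset.mul_sum]
    refine Finset.sum_congr rfl fun i _ => ?_
    simp [kerA, kerB', he, EuclideanSpace.inner_single_right]
    ring
  have hlap : lap f = fun x => ∑ i : Fin N, fderiv ℝ (fun y => fderiv ℝ f y (e i)) x (e i) :=
    funext (lap_eq_fderiv f hf)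
  simp only [hsum]
  have kA : IsAvgKernel volume kerB (fun z : Euc N => s • z) |s| :=
    ⟨isUnitKernel_kerB.integrable, by fun_prop, Eventually.of_forall fun z hz => by
      rw [norm_smul]
      exact mul_le_of_le_one_right (abs_nonneg s) (isUnitKernel_kerB.norm_le hz)⟩
  rw [integral_finsetSum, hlap, avg, kA.finset_sum _ fun i _ => hii i, Finset.mul_sum]
  · refine Finset.sum_congr rfl fun i _ => ?_
    rw [integral_neg, hkey, neg_neg, wavg, ← integral_const_mul]
    refine integral_congr_ae (Eventually.of_forall fun z => ?_)
    simp only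
    ring
  · intro i _
    have kB' := isUnitKernel_kerB'.apply (e i)
    have hcg : Continuous fun z => fderiv ℝ f (x + s • z) (e i) :=
      (hi i).continuous.comp (by fun_prop)
    exact ((kB'.continuous.mul hcg).integrable_of_hasCompactSupport
      kB'.hasCompactSupport.mul_right).neg

lemma hasDerivAt_avg_kerA {f : Euc N → ℝ} (hf : ContDiff ℝ 2 f) (s : ℝ) (x : Euc N) :
    HasDerivAt (fun s => avg kerA s f x) (s * avg kerB s (lap f) x) s := by
  have hf' : Continuous (fderiv ℝ f) := hf.continuous_fderiv two_ne_zero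
  rw [← avg_kerA_deriv_integrand hf]
  obtain ⟨C, hC0, hC⟩ := exists_bound_closedBall hf' x (|s| + 1)
  have kA := isUnitKernel_kerA (N := N)
  have hi : ∀ r : ℝ, Integrable fun z : Euc N => kerA z * f (x + r • z) := fun r =>
    (kA.continuous.mul (hf.continuous.comp (by fun_prop))).integrable_of_hasCompactSupport
      kA.hasCompactSupport.mul_right
  refine (hasDerivAt_integral_of_dominated_loc_of_deriv_le (ball_mem_nhds s one_pos)
    (F := fun r z => kerA z * f (x + r • z)) (F' := fun r z => kerA z * fderiv ℝ f (x + r • z) z)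
    (bound := fun z => |kerA z| * C) (Eventually.of_forall fun r => (hi r).aestronglyMeasurable)
    (hi s) ?_ ?_ (kA.integrable.norm.mul_const C) ?_).2
  · exact (kA.continuous.mul ((hf'.comp (by fun_prop)).clm_apply
      continuous_id)).aestronglyMeasurable
  · refine Eventually.of_forall fun z r hr => ?_
    rw [norm_mul]
    by_cases hz : kerA z = 0
    · simp [hz]
    have hz1 := kA.norm_le hz
    refine mul_le_mul_of_nonneg_left ?_ (norm_nonneg _)
    refine (ContinuousLinearMap.le_opNorm _ _).trans ?_
    refine (mul_le_of_le_one_right (norm_nonneg _) hz1).trans (hC _ ?_)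
    rw [mem_closedBall, dist_eq_norm, add_sub_cancel_left, norm_smul]
    rw [mem_ball, Real.dist_eq] at hr
    have : |r| ≤ |s| + 1 := by
      have := abs_sub_abs_le_abs_sub r s
      linarith
    exact (mul_le_of_le_one_right (norm_nonneg _) hz1).trans this
  · refine Eventually.of_forall fun z r _ => ?_
    have h1 : HasDerivAt (fun r : ℝ => x + r • z) z r := by
      simpa using ((hasDerivAt_id r).smul_const z).const_add x
    exact (((hf.differentiable two_ne_zero _).hasFDerivAt).comp_hasDerivAt r h1).const_mul _

/-- The mean value representation of a `C²` function. -/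
lemma eq_avg_sub_pot {f : Euc N → ℝ} (hf : ContDiff ℝ 2 f) {t : ℝ} (ht : 0 ≤ t) (x : Euc N) :
    f x = avg kerA t f x - pot 1 kerB t (lap f) x := by
  rw [isUnitKernel_kerB.pot_eq 1 ht (continuous_lap hf)]
  simp only [pow_one]
  have hI := isUnitKernel_kerB.intervalIntegrable_avg 1 ht (continuous_lap hf) x
  simp only [pow_one] at hI
  rw [intervalIntegral.integral_eq_sub_of_hasDerivAt (f := fun s => avg kerA s f x)
    (fun s _ => hasDerivAt_avg_kerA hf s x) hI, kerA_zero_scale]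
  ring

lemma lap_pot {g : Euc N → ℝ} (hg : ContDiff ℝ 2 g) {t : ℝ} (ht : 0 ≤ t) (x : Euc N) :
    lap (pot 1 kerB t g) x = avg kerA t g x - g x := by
  rw [pot, (isUnitKernel_kerB.pot 1 t).lap_eq hg x]
  have := eq_avg_sub_pot hg ht x
  rw [pot] at this
  linarith

lemma pot_const {t : ℝ} (ht : 0 ≤ t) (c : ℝ) (x : Euc N) :
    pot 1 kerB t (fun _ => c) x = t ^ 2 / 2 * ((∫ z : Euc N, kerB z) * c) := by
  rw [isUnitKernel_kerB.pot_eq 1 ht continuous_const]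
  simp only [avg, wavg, pow_one, integral_mul_const]
  rw [intervalIntegral.integral_mul_const, integral_id]
  ring

lemma avg_kerA_const (t c : ℝ) (x : Euc N) : avg kerA t (fun _ => c) x = c := by
  simp only [avg, wavg, integral_mul_const, integral_kerA, one_mul]

lemma avg_kerA_mono {t : ℝ} (ht : 0 ≤ t) {f g : Euc N → ℝ} (hf : Continuous f)
    (hg : Continuous g) {x : Euc N} (h : ∀ y ∈ closedBall x t, f y ≤ g y) :
    avg kerA t f x ≤ avg kerA t g x :=
  (isUnitKernel_kerA.avg ht).mono (Eventually.of_forall kerA_nonneg) hf hg h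

lemma avg_kerB_mono {t : ℝ} (ht : 0 ≤ t) {f g : Euc N → ℝ} (hf : Continuous f)
    (hg : Continuous g) {x : Euc N} (h : ∀ y ∈ closedBall x t, f y ≤ g y) :
    avg kerB t f x ≤ avg kerB t g x :=
  (isUnitKernel_kerB.avg ht).mono (Eventually.of_forall kerB_nonneg) hf hg h

lemma pot_kerB_mono (t : ℝ) {f g : Euc N → ℝ} (hf : Continuous f)
    (hg : Continuous g) {x : Euc N} (h : ∀ y ∈ closedBall x t, f y ≤ g y) :
    pot 1 kerB t f x ≤ pot 1 kerB t g x :=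
  (isUnitKernel_kerB.pot 1 t).mono (IsUnitKernel.pot_nonneg kerB_nonneg 1 t) hf hg h

lemma pot_kerB_nonneg (t : ℝ) {f : Euc N → ℝ} {x : Euc N} (h : ∀ y ∈ closedBall x t, 0 ≤ f y) :
    0 ≤ pot 1 kerB t f x :=
  (isUnitKernel_kerB.pot 1 t).nonneg (IsUnitKernel.pot_nonneg kerB_nonneg 1 t) h

lemma avg_kerA_nonneg {t : ℝ} (ht : 0 ≤ t) {f : Euc N → ℝ} {x : Euc N}
    (h : ∀ y ∈ closedBall x t, 0 ≤ f y) : 0 ≤ avg kerA t f x :=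
  (isUnitKernel_kerA.avg ht).nonneg (Eventually.of_forall kerA_nonneg) h

lemma pot_neg (t : ℝ) (f : Euc N → ℝ) (x : Euc N) :
    pot 1 kerB t (fun y => -f y) x = -pot 1 kerB t f x := by
  simp only [pot, wavg, mul_neg, integral_neg]

lemma pot_const_mul (t c : ℝ) (f : Euc N → ℝ) (x : Euc N) :
    pot 1 kerB t (fun y => c * f y) x = c * pot 1 kerB t f x := by
  simp only [pot, wavg]
  rw [← integral_const_mul]
  congr 1
  funext p
  ring

lemma avg_const_mul (κ : Euc N → ℝ) (t c : ℝ) (f : Euc N → ℝ) (x : Euc N) :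
    avg κ t (fun y => c * f y) x = c * avg κ t f x := by
  simp only [avg, wavg]
  rw [← integral_const_mul]
  congr 1
  funext p
  ring

/-- A continuous function whose small-scale potentials are nonnegative is nonnegative. -/
lemma nonneg_of_pot_nonneg {g : Euc N → ℝ} (hg : Continuous g) {x : Euc N} {δ : ℝ} (hδ : 0 < δ)
    (h : ∀ s, 0 < s → s < δ → 0 ≤ pot 1 kerB s g x) : 0 ≤ g x := by
  by_contra hx
  push Not at hx
  have h1 : ∀ᶠ y in 𝓝 x, g y < g x / 2 :=
    hg.continuousAt.eventually_lt continuousAt_const (by linarith)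
  obtain ⟨ε, hε, hb⟩ := Metric.nhds_basis_closedBall.eventually_iff.1 h1
  have hs : 0 < min ε (δ / 2) := lt_min hε (by linarith)
  have h2 := h _ hs ((min_le_right _ _).trans_lt (by linarith))
  have h3 := pot_kerB_mono (min ε (δ / 2)) hg (continuous_const (y := g x / 2)) (x := x)
    fun y hy => (hb (closedBall_subset_closedBall (min_le_left _ _) hy)).le
  rw [pot_const hs.le] at h3
  have h4 : (min ε (δ / 2)) ^ 2 / 2 * ((∫ z : Euc N, kerB z) * (g x / 2)) < 0 :=
    mul_neg_of_pos_of_neg (by positivity)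
      (mul_neg_of_pos_of_neg integral_kerB_pos (by linarith))
  linarith

/-- The constant in the gradient estimate. -/
def gradConst (N : ℕ) : ℝ := (∫ z : Euc N, ‖kerA' z‖) + ∫ z : Euc N, ‖kerB' z‖

lemma gradConst_nonneg (N : ℕ) : 0 ≤ gradConst N :=
  add_nonneg (integral_nonneg fun _ => norm_nonneg _) (integral_nonneg fun _ => norm_nonneg _)

lemma norm_fderiv_avg_add_pot_le {f g : Euc N → ℝ} (hf : Continuous f) (hg : Continuous g) {t : ℝ}
    (ht : 0 < t) {x : Euc N} {A B : ℝ} (hA : ∀ y ∈ closedBall x t, |f y| ≤ A)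
    (hB : ∀ y ∈ closedBall x t, |g y| ≤ B) :
    ‖fderiv ℝ (fun y => avg kerA t f y + pot 1 kerB t g y) x‖ ≤
      gradConst N * (t⁻¹ * A + t * B) := by
  have hA0 : 0 ≤ A := (abs_nonneg _).trans (hA x (mem_closedBall_self ht.le))
  have hB0 : 0 ≤ B := (abs_nonneg _).trans (hB x (mem_closedBall_self ht.le))
  have h1 := hasFDerivAt_avg isUnitKernel_kerA isUnitKernel_kerA' hasFDerivAt_kerA hf ht x
  have h2 := hasFDerivAt_pot isUnitKernel_kerB isUnitKernel_kerB' hasFDerivAt_kerB hg ht.le x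
  have hIA : 0 ≤ ∫ z : Euc N, ‖kerA' z‖ := integral_nonneg fun _ => norm_nonneg _
  have hIB : 0 ≤ ∫ z : Euc N, ‖kerB' z‖ := integral_nonneg fun _ => norm_nonneg _
  have hkA : ‖∫ z, f (x + t • z) • kerA' z‖ ≤ A * ∫ z : Euc N, ‖kerA' z‖ := by
    rw [← integral_const_mul]
    refine norm_integral_le_of_norm_le (isUnitKernel_kerA'.integrable.norm.const_mul A)
      (Eventually.of_forall fun z => ?_)
    rw [norm_smul]
    by_cases hz : kerA' z = 0
    · simp [hz]
    refine mul_le_mul_of_nonneg_right (hA _ ?_) (norm_nonneg _)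
    rw [mem_closedBall, dist_eq_norm, add_sub_cancel_left, norm_smul, Real.norm_of_nonneg ht.le]
    exact mul_le_of_le_one_right ht.le (isUnitKernel_kerA'.norm_le hz)
  have hkB : ∀ s ∈ Ioc 0 t, ‖-∫ z, g (x + s • z) • kerB' z‖ ≤ B * ∫ z : Euc N, ‖kerB' z‖ := by
    intro s hs
    rw [norm_neg, ← integral_const_mul]
    refine norm_integral_le_of_norm_le (isUnitKernel_kerB'.integrable.norm.const_mul B)
      (Eventually.of_forall fun z => ?_)
    rw [norm_smul]
    by_cases hz : kerB' z = 0
    · simp [hz]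
    refine mul_le_mul_of_nonneg_right (hB _ ?_) (norm_nonneg _)
    rw [mem_closedBall, dist_eq_norm, add_sub_cancel_left, norm_smul, Real.norm_of_nonneg hs.1.le]
    exact (mul_le_of_le_one_right hs.1.le (isUnitKernel_kerB'.norm_le hz)).trans hs.2
  have hkB2 : ‖∫ s in Ioc 0 t, -∫ z, g (x + s • z) • kerB' z‖ ≤
      B * (∫ z : Euc N, ‖kerB' z‖) * t := by
    refine (norm_setIntegral_le_of_norm_le_const (μ := volume) (by simp) hkB).trans_eq ?_
    simp [Measure.real, ht.le]
  have hsum := (h1.add h2).fderiv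
  have hfun : (avg kerA t f + pot 1 kerB t g) = fun y => avg kerA t f y + pot 1 kerB t g y := rfl
  rw [hfun] at hsum
  rw [hsum]
  refine (norm_add_le _ _).trans ?_
  rw [norm_smul, norm_neg, norm_inv, Real.norm_of_nonneg ht.le, gradConst]
  have ht' : 0 < t⁻¹ := inv_pos.2 ht
  have e1 := mul_le_mul_of_nonneg_left hkA ht'.le
  have e2 : 0 ≤ t * B * ∫ z : Euc N, ‖kerA' z‖ := by positivity
  have e3 : 0 ≤ t⁻¹ * A * ∫ z : Euc N, ‖kerB' z‖ := by positivity
  nlinarith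

/-- Interior gradient estimate for the Poisson equation. -/
lemma norm_fderiv_le {f : Euc N → ℝ} (hf : ContDiff ℝ 2 f) {t : ℝ} (ht : 0 < t) {x : Euc N}
    {A B : ℝ} (hA : ∀ y ∈ closedBall x t, |f y| ≤ A) (hB : ∀ y ∈ closedBall x t, |lap f y| ≤ B) :
    ‖fderiv ℝ f x‖ ≤ gradConst N * (t⁻¹ * A + t * B) := by
  have h : f = fun y => avg kerA t f y + pot 1 kerB t (fun z => -lap f z) y := by
    funext y
    rw [pot_neg, ← sub_eq_add_neg]
    exact eq_avg_sub_pot hf ht.le y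
  have hneg : Continuous fun z => -lap f z := (continuous_lap hf).neg
  have := norm_fderiv_avg_add_pot_le hf.continuous hneg ht (x := x) hA
    (B := B) (by simpa using hB)
  rwa [← h] at this

/-- Kernels comparable with the indicator function of a ball. -/
structure IsBallKernel (κ : Euc N → ℝ) : Prop extends IsUnitKernel κ where
  nonneg : ∀ z, 0 ≤ κ z
  le : ∀ z, κ z ≤ 6 * kconst N
  ge : ∀ z, ‖z‖ ≤ 2 / 3 → kconst N / 6 ≤ κ z

lemma isBallKernel_kerA : IsBallKernel (kerA (N := N)) where
  toIsUnitKernel := isUnitKernel_kerA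
  nonneg := kerA_nonneg
  le z := by
    have := kconst_pos N
    have := bump_le_one 2 z
    unfold kerA
    nlinarith
  ge z hz := by
    have := kconst_pos N
    have := le_bump 2 hz
    unfold kerA
    norm_num at this
    nlinarith

lemma isBallKernel_kerB : IsBallKernel (kerB (N := N)) where
  toIsUnitKernel := isUnitKernel_kerB
  nonneg := kerB_nonneg
  le z := by
    have := kconst_pos N
    have := bump_le_one 3 z
    unfold kerB
    nlinarith
  ge z hz := by
    have := kconst_pos N
    have := le_bump 3 hz
    unfold kerB
    norm_num at this
    nlinarith

lemma IsBallKernel.avg_le_avg {κ κ' : Euc N → ℝ} (hκ : IsBallKernel κ) (hκ' : IsBallKernel κ')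
    {f : Euc N → ℝ} (hf : Continuous f) (hf0 : ∀ y, 0 ≤ f y) {s s' : ℝ} (hs : 0 < s) {x x' : Euc N}
    (h : ‖x - x'‖ + s ≤ 2 / 3 * s') :
    avg κ s f x ≤ 36 * (s' / s) ^ N * avg κ' s' f x' := by
  have hs' : 0 < s' := by linarith [norm_nonneg (x - x')]
  have key : ∀ {κ : Euc N → ℝ} {s : ℝ} (x : Euc N), 0 < s →
      avg κ s f x = (s ^ N)⁻¹ * ∫ y, f y * κ (s⁻¹ • (y - x)) := by
    intro κ s x hs
    have := integral_scale_translate κ f hs x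
    simp only [smul_eq_mul] at this
    rw [← this, avg, wavg]
    simp only [mul_comm]
  have hInt : ∀ {κ : Euc N → ℝ} {s : ℝ} (x : Euc N), IsUnitKernel κ → 0 < s →
      Integrable fun y => f y * κ (s⁻¹ • (y - x)) := by
    intro κ s x hk hs
    have hc : Continuous fun y => f y * κ (s⁻¹ • (y - x)) :=
      hf.mul (hk.continuous.comp (by fun_prop))
    refine hc.integrable_of_hasCompactSupport ?_
    refine HasCompactSupport.intro (isCompact_closedBall x s) fun y hy => ?_
    rw [hk.eq_zero, mul_zero]
    rw [norm_smul, norm_inv, Real.norm_of_nonneg hs.le, ← div_eq_inv_mul, one_le_div hs]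
    rw [mem_closedBall, dist_eq_norm, not_le] at hy
    exact hy.le
  rw [key x hs, key x' hs']
  have hle : ∫ y, f y * κ (s⁻¹ • (y - x)) ≤ 36 * ∫ y, f y * κ' (s'⁻¹ • (y - x')) := by
    rw [← integral_const_mul]
    refine integral_mono (hInt x hκ.toIsUnitKernel hs)
      ((hInt x' hκ'.toIsUnitKernel hs').const_mul 36) fun y => ?_
    simp only
    rw [mul_left_comm]
    refine mul_le_mul_of_nonneg_left ?_ (hf0 y)
    by_cases hz : κ (s⁻¹ • (y - x)) = 0
    · rw [hz]
      exact mul_nonneg (by norm_num) (hκ'.nonneg _)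
    have h1 := hκ.norm_le hz
    rw [norm_smul, norm_inv, Real.norm_of_nonneg hs.le, ← div_eq_inv_mul, div_le_one hs] at h1
    have h2 := hκ'.ge (s'⁻¹ • (y - x')) (by
      rw [norm_smul, norm_inv, Real.norm_of_nonneg hs'.le, ← div_eq_inv_mul, div_le_iff₀ hs']
      calc ‖y - x'‖ = ‖(y - x) + (x - x')‖ := by congr 1; abel
        _ ≤ ‖y - x‖ + ‖x - x'‖ := norm_add_le _ _
        _ ≤ _ := by linarith)
    have h3 := hκ.le (s⁻¹ • (y - x))
    linarith
  refine (mul_le_mul_of_nonneg_left hle (by positivity)).trans_eq ?_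
  rw [div_pow]
  have : s' ^ N ≠ 0 := by positivity
  field_simp

/-- Potential version of the weak Harnack comparison. -/
lemma avg_le_pot {f : Euc N → ℝ} (hf : Continuous f) (hf0 : ∀ y, 0 ≤ f y) {s s' : ℝ} (hs : 0 < s)
    {x x' : Euc N} (h : ‖x - x'‖ + s ≤ 2 / 3 * s') (h1 : 1 ≤ s') :
    avg kerA s f x ≤ 36 * ((s' + 1) / s) ^ N * pot 1 kerB (s' + 1) f x' := by
  have hs' : 0 < s' := by linarith
  have hge : ∀ r ∈ Icc s' (s' + 1), (36 * ((s' + 1) / s) ^ N)⁻¹ * avg kerA s f x ≤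
      r ^ 1 * avg kerB r f x' := by
    intro r hr
    have h2 := isBallKernel_kerA.avg_le_avg isBallKernel_kerB hf hf0 (s' := r) hs (x := x)
      (x' := x') (by linarith [hr.1])
    have h0 : 0 ≤ avg kerB r f x' :=
      (isUnitKernel_kerB.avg (hs'.le.trans hr.1)).nonneg (Eventually.of_forall kerB_nonneg)
        fun y _ => hf0 y
    rw [inv_mul_le_iff₀ (by positivity), pow_one]
    refine h2.trans ?_
    have hr0 : 0 ≤ r := by linarith [hr.1]
    have hr1 : 1 ≤ r := by linarith [hr.1]
    have : (r / s) ^ N ≤ ((s' + 1) / s) ^ N :=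
      pow_le_pow_left₀ (by positivity) (by gcongr; exact hr.2) N
    have h4 : avg kerB r f x' ≤ r * avg kerB r f x' := le_mul_of_one_le_left h0 hr1
    calc 36 * (r / s) ^ N * avg kerB r f x' ≤ 36 * ((s' + 1) / s) ^ N * avg kerB r f x' := by gcongr
      _ ≤ _ := by gcongr
  have hInt := isUnitKernel_kerB.intervalIntegrable_avg 1 (by linarith : 0 ≤ s' + 1) hf x'
  have hi1 : IntervalIntegrable (fun r => r ^ 1 * avg kerB r f x') volume 0 s' :=
    hInt.mono_set (by
      rw [uIcc_of_le hs'.le, uIcc_of_le (by linarith)]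
      exact Icc_subset_Icc_right (by linarith))
  have hi2 : IntervalIntegrable (fun r => r ^ 1 * avg kerB r f x') volume s' (s' + 1) :=
    hInt.mono_set (by
      rw [uIcc_of_le (by linarith), uIcc_of_le (by linarith)]
      exact Icc_subset_Icc_left hs'.le)
  have h5 : (36 * ((s' + 1) / s) ^ N)⁻¹ * avg kerA s f x ≤ pot 1 kerB (s' + 1) f x' := by
    rw [isUnitKernel_kerB.pot_eq 1 (by linarith) hf,
      ← intervalIntegral.integral_add_adjacent_intervals hi1 hi2]
    have e1 : 0 ≤ ∫ r in (0 : ℝ)..s', r ^ 1 * avg kerB r f x' :=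
      intervalIntegral.integral_nonneg hs'.le fun r hr => mul_nonneg (pow_nonneg hr.1 1)
        ((isUnitKernel_kerB.avg hr.1).nonneg (Eventually.of_forall kerB_nonneg) fun y _ => hf0 y)
    have e2 := intervalIntegral.integral_mono_on (by linarith : s' ≤ s' + 1)
      (intervalIntegrable_const (μ := volume) (c := (36 * ((s' + 1) / s) ^ N)⁻¹ * avg kerA s f x))
      hi2 hge
    rw [intervalIntegral.integral_const, smul_eq_mul, add_sub_cancel_left, one_mul] at e2
    linarith
  rwa [inv_mul_le_iff₀ (by positivity)] at h5

/-- Mean value inequality for supersolutions. -/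
lemma avg_add_pot_le {f h : Euc N → ℝ} (hf : ContDiff ℝ 2 f) (hh : Continuous h) {t : ℝ}
    (ht : 0 ≤ t) {x : Euc N} (hle : ∀ y ∈ closedBall x t, h y ≤ -lap f y) :
    avg kerA t f x + pot 1 kerB t h x ≤ f x := by
  have h1 := eq_avg_sub_pot hf ht x
  have h2 := pot_kerB_mono t hh (g := fun z => -lap f z) (continuous_lap hf).neg hle
  rw [pot_neg] at h2
  linarith

/-- A `C²` function on a ball agrees near a smaller closed ball with a global `C²` function. -/
lemma exists_contDiff_eq {f : Euc N → ℝ} {x : Euc N} {r s : ℝ} (hs : 0 < s) (hsr : s < r)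
    (hf : ContDiffOn ℝ 2 f (ball x r)) :
    ∃ F : Euc N → ℝ, ContDiff ℝ 2 F ∧ (∀ y ∈ closedBall x s, F =ᶠ[𝓝 y] f) ∧
      ((∀ y ∈ ball x r, 0 ≤ f y) → ∀ y, 0 ≤ F y) := by
  let χ : ContDiffBump x := ⟨(2 * s + r) / 3, (s + 2 * r) / 3, by linarith, by linarith⟩
  refine ⟨fun y => χ y * f y, ?_, fun y hy => ?_, fun h y => ?_⟩
  · rw [contDiff_iff_contDiffAt]
    intro y
    by_cases hy : y ∈ ball x r
    · exact χ.contDiffAt.mul (hf.contDiffAt (isOpen_ball.mem_nhds hy))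
    · have hy' : y ∈ (closedBall x ((s + 2 * r) / 3))ᶜ := fun h =>
        hy (closedBall_subset_ball (by linarith) h)
      have h0 : (fun y => χ y * f y) =ᶠ[𝓝 y] fun _ => 0 := by
        filter_upwards [isClosed_closedBall.isOpen_compl.mem_nhds hy'] with z hz
        rw [χ.zero_of_le_dist, zero_mul]
        simp only [mem_compl_iff, mem_closedBall, not_le] at hz
        exact hz.le
      exact contDiffAt_const.congr_of_eventuallyEq h0
  · filter_upwards [isOpen_ball.mem_nhds (closedBall_subset_ball
      (by linarith : s < (2 * s + r) / 3) hy)] with z hz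
    rw [χ.one_of_mem_closedBall (ball_subset_closedBall hz), one_mul]
  · by_cases hy : y ∈ ball x r
    · exact mul_nonneg χ.nonneg (h y hy)
    · beta_reduce
      rw [χ.zero_of_le_dist, zero_mul]
      rw [mem_ball, not_lt] at hy
      have : χ.rOut = (s + 2 * r) / 3 := rfl
      linarith

lemma lap_comp_affine {f : Euc N → ℝ} (hf : ContDiff ℝ 2 f) (A l : ℝ) (y z : Euc N) :
    lap (fun z => A * f (y + l • z)) z = A * l ^ 2 * lap f (y + l • z) := by
  have h1 : ContDiff ℝ 2 fun w => f (y + w) := hf.comp (by fun_prop)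
  have h2 : ContDiff ℝ 2 fun z => f (y + l • z) := hf.comp (by fun_prop)
  have h3 := congrFun (iteratedFDeriv_comp_const_smul (i := 2) l (by exact_mod_cast h1)) z
  simp only [lap, Finset.mul_sum]
  refine Finset.sum_congr rfl fun i _ => ?_
  have h4 : (fun z => A * f (y + l • z)) = A • fun z => f (y + l • z) := rfl
  rw [h4, iteratedFDeriv_const_smul_apply (by exact_mod_cast h2.contDiffAt), h3,
    iteratedFDeriv_comp_add_left]
  simp [mul_assoc]

lemma lap_comp_affine_of_contDiffOn {f : Euc N → ℝ} {U : Set (Euc N)} (hU : IsOpen U)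
    (hf : ContDiffOn ℝ 2 f U) (A l : ℝ) (y z : Euc N) (hz : y + l • z ∈ U) :
    lap (fun z => A * f (y + l • z)) z = A * l ^ 2 * lap f (y + l • z) := by
  obtain ⟨r, hr, hb⟩ := Metric.isOpen_iff.1 hU _ hz
  obtain ⟨F, hF, hFf, -⟩ := exists_contDiff_eq (half_pos hr) (half_lt_self hr) (hf.mono hb)
  have h1 := hFf _ (mem_closedBall_self (half_pos hr).le)
  rw [← lap_congr h1, ← lap_comp_affine hF]
  refine (lap_congr ?_).symm
  have hc : ContinuousAt (fun z : Euc N => y + l • z) z := by fun_prop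
  filter_upwards [hc.eventually h1] with w hw
  rw [hw]

/-- A form of the Arzelà–Ascoli theorem. -/
lemma exists_subseq_tendsto {L : NNReal} {f : ℕ → Euc N → ℝ} (hf : ∀ k, LipschitzWith L (f k))
    {C : ℝ} (hC : ∀ k, |f k 0| ≤ C) :
    ∃ (φ : ℕ → ℕ) (g : Euc N → ℝ), StrictMono φ ∧ Continuous g ∧
      ∀ x, Tendsto (fun k => f (φ k) x) atTop (𝓝 (g x)) := by
  let d : ℕ → Euc N := TopologicalSpace.denseSeq (Euc N)
  have hK : IsCompact
      (Set.univ.pi fun n : ℕ => Icc (-(C + L * dist (d n) 0)) (C + L * dist (d n) 0)) :=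
    isCompact_univ_pi fun n => isCompact_Icc
  obtain ⟨G, -, φ, hφ, hG⟩ := hK.tendsto_subseq (x := fun k n => f k (d n)) fun k n _ => by
    have h1 := (hf k).dist_le_mul (d n) 0
    rw [Real.dist_eq] at h1
    have h2 := abs_sub_abs_le_abs_sub (f k (d n)) (f k 0)
    exact abs_le.1 (by linarith [hC k])
  rw [tendsto_pi_nhds] at hG
  have hcau : ∀ x, CauchySeq fun k => f (φ k) x := by
    intro x
    rw [Metric.cauchySeq_iff]
    intro ε hε
    have hL : 0 < (L : ℝ) + 1 := by positivity
    obtain ⟨n, hn⟩ := (TopologicalSpace.denseRange_denseSeq (Euc N)).exists_dist_lt x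
      (ε := ε / 3 / (L + 1)) (by positivity)
    obtain ⟨K, hK⟩ := Metric.cauchySeq_iff.1 (hG n).cauchySeq (ε / 3) (by positivity)
    have hd : ∀ k, dist (f (φ k) x) (f (φ k) (d n)) < ε / 3 := fun k => by
      refine ((hf _).dist_le_mul _ _).trans_lt ?_
      have := (lt_div_iff₀ hL).1 hn
      have h0 : 0 ≤ dist x (d n) := dist_nonneg
      change dist x (d n) * _ < _ at this
      nlinarith
    refine ⟨K, fun m hm k hk => ?_⟩
    have h1 := hK m hm k hk
    have h2 := hd m
    have h3 := hd k
    rw [dist_comm] at h3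
    calc dist (f (φ m) x) (f (φ k) x) ≤ dist (f (φ m) x) (f (φ m) (d n)) +
          dist (f (φ m) (d n)) (f (φ k) (d n)) + dist (f (φ k) (d n)) (f (φ k) x) :=
        dist_triangle4 _ _ _ _
      _ < ε := by
        have h4 : dist (f (φ m) (d n)) (f (φ k) (d n)) < ε / 3 := h1
        linarith
  choose g hg using fun x => cauchySeq_tendsto_of_complete (hcau x)
  refine ⟨φ, g, hφ, ?_, hg⟩
  have : LipschitzWith L g := LipschitzWith.of_dist_le_mul fun x y =>
    le_of_tendsto ((hg x).dist (hg y)) (Eventually.of_forall fun k => (hf _).dist_le_mul x y)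
  exact this.continuous

/-- Averaging operators commute. -/
lemma wavg_comm {Ω Ω' : Type*} [MeasurableSpace Ω] [MeasurableSpace Ω'] {P : Measure Ω}
    {P' : Measure Ω'} [SFinite P] [SFinite P'] {w : Ω → ℝ} {w' : Ω' → ℝ} {Y : Ω → Euc N}
    {Y' : Ω' → Euc N} {t t' : ℝ} (h : IsAvgKernel P w Y t) (h' : IsAvgKernel P' w' Y' t')
    {f : Euc N → ℝ} (hf : Continuous f) (x : Euc N) :
    wavg P w Y (wavg P' w' Y' f) x = wavg P' w' Y' (wavg P w Y f) x := by
  simp only [wavg, ← integral_const_mul]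
  rw [integral_integral_swap]
  · refine integral_congr_ae (Eventually.of_forall fun ω' => ?_)
    refine integral_congr_ae (Eventually.of_forall fun ω => ?_)
    simp only
    rw [add_right_comm]
    ring
  · obtain ⟨C, hC0, hC⟩ := exists_bound_closedBall hf x (t + t')
    refine Integrable.mono' ((h.integrable.norm.mul_prod h'.integrable.norm).mul_const C) ?_ ?_
    · have hm : Measurable fun p : Ω × Ω' => x + Y p.1 + Y' p.2 :=
        ((h.measurable.comp measurable_fst).const_add x).add (h'.measurable.comp measurable_snd)
      exact h.integrable.aestronglyMeasurable.comp_fst.mul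
        (h'.integrable.aestronglyMeasurable.comp_snd.mul
          (hf.stronglyMeasurable.comp_measurable hm).aestronglyMeasurable)
    · have h1 : ∀ᵐ p ∂P.prod P', w p.1 ≠ 0 → ‖Y p.1‖ ≤ t :=
        Measure.quasiMeasurePreserving_fst.ae h.supp
      have h2 : ∀ᵐ p ∂P.prod P', w' p.2 ≠ 0 → ‖Y' p.2‖ ≤ t' :=
        Measure.quasiMeasurePreserving_snd.ae h'.supp
      filter_upwards [h1, h2] with p hp1 hp2
      simp only [Function.uncurry, norm_mul]
      rw [← mul_assoc]
      by_cases h0 : w p.1 = 0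
      · simp [h0]
      by_cases h0' : w' p.2 = 0
      · simp [h0']
      refine mul_le_mul_of_nonneg_left (hC _ ?_) (by positivity)
      rw [mem_closedBall, dist_eq_norm, add_assoc, add_sub_cancel_left]
      exact (norm_add_le _ _).trans (add_le_add (hp1 h0) (hp2 h0'))

/-- A function with bounded gradient on a ball agrees there with a global Lipschitz function. -/
lemma exists_lipschitz_eq {f : Euc N → ℝ} {x : Euc N} {r L : ℝ} (hL : 0 ≤ L)
    (hd : ∀ y ∈ ball x r, DifferentiableAt ℝ f y) (hf : ∀ y ∈ ball x r, ‖fderiv ℝ f y‖ ≤ L) :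
    ∃ g : Euc N → ℝ, LipschitzWith L.toNNReal g ∧ EqOn f g (ball x r) := by
  refine LipschitzOnWith.extend_real ?_
  refine (convex_ball x r).lipschitzOnWith_of_nnnorm_fderiv_le (𝕜 := ℝ) hd fun y hy => ?_
  rw [← NNReal.coe_le_coe, Real.coe_toNNReal _ hL]
  exact hf y hy

lemma closedBall_subset_ball_zero {x : Euc N} {ρ ρ' t : ℝ} (hx : x ∈ ball (0 : Euc N) ρ')
    (h : ρ' + t ≤ ρ) : closedBall x t ⊆ ball 0 ρ := by
  refine closedBall_subset_ball' ?_
  rw [mem_ball] at hx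
  linarith

lemma lap_add {f g : Euc N → ℝ} (hf : ContDiff ℝ 2 f) (hg : ContDiff ℝ 2 g) (x : Euc N) :
    lap (fun y => f y + g y) x = lap f x + lap g x := by
  have h : (fun y => f y + g y) = f + g := rfl
  simp only [lap, h]
  rw [← Finset.sum_add_distrib]
  refine Finset.sum_congr rfl fun i _ => ?_
  rw [iteratedFDeriv_add_apply (by exact_mod_cast hf.contDiffAt) (by exact_mod_cast hg.contDiffAt)]
  rfl

lemma lap_const_mul {f : Euc N → ℝ} (hf : ContDiff ℝ 2 f) (c : ℝ) (x : Euc N) :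
    lap (fun y => c * f y) x = c * lap f x := by
  have := lap_comp_affine hf c 1 0 x
  simpa using this

lemma avg_kerA_pos {f : Euc N → ℝ} (hf : Continuous f) (hf0 : ∀ y, 0 ≤ f y) {x x₀ : Euc N}
    (h : 0 < f x₀) {s : ℝ} (hs : ‖x₀ - x‖ < 2 / 3 * s) : 0 < avg kerA s f x := by
  have h1 : ∀ᶠ y in 𝓝 x₀, f x₀ / 2 < f y :=
    continuousAt_const.eventually_lt hf.continuousAt (by linarith)
  obtain ⟨ε, hε, hb⟩ := Metric.nhds_basis_closedBall.eventually_iff.1 h1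
  have hs0 : 0 < s := by linarith [norm_nonneg (x₀ - x)]
  have hr : 0 < min ε (2 / 3 * s - ‖x₀ - x‖) := lt_min hε (by linarith)
  have h2 := avg_kerA_mono hr.le (continuous_const (y := f x₀ / 2)) hf (x := x₀)
    fun y hy => (hb (closedBall_subset_closedBall (min_le_left _ _) hy)).le
  rw [avg_kerA_const] at h2
  have h3 := isBallKernel_kerA.avg_le_avg isBallKernel_kerA hf hf0 (s' := s) hr (x := x₀) (x' := x)
    (by linarith [min_le_right ε (2 / 3 * s - ‖x₀ - x‖)])
  by_contra hc
  have : 36 * (s / min ε (2 / 3 * s - ‖x₀ - x‖)) ^ N * avg kerA s f x ≤ 0 :=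
    mul_nonpos_of_nonneg_of_nonpos (by positivity) (not_lt.1 hc)
  linarith

/-- The regularization of a supersolution of `-Δξ = V ζ`. -/
def improve (V ξ ζ : Euc N → ℝ) (x : Euc N) : ℝ :=
  avg kerA 1 ξ x + pot 1 kerB 1 (fun y => V y * ζ y) x

section Improve

variable {V W ξ ζ : Euc N → ℝ} {ρ : ℝ}

lemma contDiff_improve (n : ℕ) (hV : ContDiff ℝ n V) (hξ : ContDiff ℝ n ξ) (hζ : ContDiff ℝ n ζ) :
    ContDiff ℝ n (improve V ξ ζ) :=
  ((isUnitKernel_kerA.avg zero_le_one).contDiff n hξ).add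
    ((isUnitKernel_kerB.pot 1 1).contDiff n (hV.mul hζ))

lemma contDiff_improve_succ (n : ℕ) (hV : ContDiff ℝ n V) (hξ : ContDiff ℝ n ξ)
    (hζ : ContDiff ℝ n ζ) : ContDiff ℝ (n + 1 : ℕ) (improve V ξ ζ) :=
  (contDiff_avg_succ isUnitKernel_kerA isUnitKernel_kerA' hasFDerivAt_kerA hξ one_pos).add
    (contDiff_pot_succ isUnitKernel_kerB isUnitKernel_kerB' hasFDerivAt_kerB (hV.mul hζ)
      zero_le_one)

lemma improve_nonneg (hV : ∀ y, 0 ≤ V y) (hξ : ∀ y, 0 ≤ ξ y) (hζ : ∀ y, 0 ≤ ζ y) (x : Euc N) :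
    0 ≤ improve V ξ ζ x :=
  add_nonneg (avg_kerA_nonneg zero_le_one fun y _ => hξ y)
    (pot_kerB_nonneg 1 fun y _ => mul_nonneg (hV y) (hζ y))

lemma improve_le (hV : Continuous V) (hξ : ContDiff ℝ 2 ξ) (hζ : Continuous ζ)
    (h : ∀ y ∈ ball (0 : Euc N) ρ, V y * ζ y ≤ -lap ξ y) {x : Euc N}
    (hx : x ∈ ball (0 : Euc N) (ρ - 1)) : improve V ξ ζ x ≤ ξ x :=
  avg_add_pot_le hξ (hV.mul hζ) zero_le_one fun y hy =>
    h y (closedBall_subset_ball_zero hx (by linarith) hy)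

lemma le_neg_lap_improve (hV : ContDiff ℝ 2 V) (hξ : ContDiff ℝ 2 ξ) (hζ : ContDiff ℝ 2 ζ)
    (h : ∀ y ∈ ball (0 : Euc N) ρ, V y * ζ y ≤ -lap ξ y) {x : Euc N}
    (hx : x ∈ ball (0 : Euc N) (ρ - 1)) : V x * ζ x ≤ -lap (improve V ξ ζ) x := by
  have h1 : ContDiff ℝ 2 (avg kerA 1 ξ) := (isUnitKernel_kerA.avg zero_le_one).contDiff 2 hξ
  have h2 : ContDiff ℝ 2 (pot 1 kerB 1 (fun y => V y * ζ y)) :=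
    (isUnitKernel_kerB.pot 1 1).contDiff 2 (hV.mul hζ)
  have h3 : lap (avg kerA 1 ξ) x = avg kerA 1 (lap ξ) x :=
    (isUnitKernel_kerA.avg zero_le_one).lap_eq hξ x
  have h5 := avg_kerA_mono zero_le_one (f := lap ξ) (g := fun y => (-1) * (V y * ζ y)) (x := x)
    (continuous_lap hξ) (continuous_const.mul (hV.mul hζ).continuous) fun y hy => by
      have := h y (closedBall_subset_ball_zero hx (by linarith) hy)
      linarith
  rw [avg_const_mul] at h5
  unfold improve
  rw [lap_add h1 h2, h3, lap_pot (hV.mul hζ) zero_le_one]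
  linarith

lemma le_improve {c : ℝ} (hV : ∀ y, 0 ≤ V y) (hξ : Continuous ξ) (hζ : ∀ y, 0 ≤ ζ y)
    (h : ∀ y ∈ ball (0 : Euc N) ρ, c ≤ ξ y) {x : Euc N}
    (hx : x ∈ ball (0 : Euc N) (ρ - 1)) : c ≤ improve V ξ ζ x := by
  have h1 := avg_kerA_mono zero_le_one (f := fun _ => c) (g := ξ) (x := x) continuous_const hξ
    fun y hy => h y (closedBall_subset_ball_zero hx (by linarith) hy)
  rw [avg_kerA_const] at h1
  have h2 : 0 ≤ pot 1 kerB 1 (fun y => V y * ζ y) x :=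
    pot_kerB_nonneg 1 fun y _ => mul_nonneg (hV y) (hζ y)
  unfold improve
  linarith

/-- A nonnegative supersolution `(ξ, ζ)` of `-Δξ = V ζ`, `-Δζ = W ξ` in a ball. -/
structure SuperOn (V W ξ ζ : Euc N → ℝ) (ρ : ℝ) : Prop where
  contDiff₁ : ContDiff ℝ 2 ξ
  contDiff₂ : ContDiff ℝ 2 ζ
  nonneg₁ : ∀ y, 0 ≤ ξ y
  nonneg₂ : ∀ y, 0 ≤ ζ y
  le₁ : ∀ y ∈ ball (0 : Euc N) ρ, V y * ζ y ≤ -lap ξ y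
  le₂ : ∀ y ∈ ball (0 : Euc N) ρ, W y * ξ y ≤ -lap ζ y

lemma SuperOn.mono {ρ' : ℝ} (h : SuperOn V W ξ ζ ρ) (hρ : ρ' ≤ ρ) : SuperOn V W ξ ζ ρ' :=
  { h with
    le₁ := fun y hy => h.le₁ y (ball_subset_ball hρ hy)
    le₂ := fun y hy => h.le₂ y (ball_subset_ball hρ hy) }

lemma SuperOn.improve (h : SuperOn V W ξ ζ ρ) (hV : ContDiff ℝ 2 V) (hW : ContDiff ℝ 2 W)
    (hV0 : ∀ y, 0 ≤ V y) (hW0 : ∀ y, 0 ≤ W y) :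
    SuperOn V W (improve V ξ ζ) (improve W ζ ξ) (ρ - 1) where
  contDiff₁ := contDiff_improve 2 hV h.contDiff₁ h.contDiff₂
  contDiff₂ := contDiff_improve 2 hW h.contDiff₂ h.contDiff₁
  nonneg₁ := improve_nonneg hV0 h.nonneg₁ h.nonneg₂
  nonneg₂ := improve_nonneg hW0 h.nonneg₂ h.nonneg₁
  le₁ y hy := (mul_le_mul_of_nonneg_left
    (improve_le hW.continuous h.contDiff₂ h.contDiff₁.continuous h.le₂ hy) (hV0 y)).trans
    (le_neg_lap_improve hV h.contDiff₁ h.contDiff₂ h.le₁ hy)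
  le₂ y hy := (mul_le_mul_of_nonneg_left
    (improve_le hV.continuous h.contDiff₁ h.contDiff₂.continuous h.le₁ hy) (hW0 y)).trans
    (le_neg_lap_improve hW h.contDiff₂ h.contDiff₁ h.le₂ hy)

/-- Bounds on the averages of a function: at unit scale, and at small scales with a power-like
blow-up. -/
structure MassBound (K M : ℝ) (m : ℕ) (ξ : Euc N → ℝ) (ρ : ℝ) : Prop where
  unit : ∀ x ∈ ball (0 : Euc N) ρ, avg kerA 1 ξ x ≤ K
  small : ∀ x ∈ ball (0 : Euc N) ρ, ∀ s, 0 < s → s ≤ 1 → avg kerB s ξ x ≤ M * (s ^ m)⁻¹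

lemma pot_kerB_mul_le {Λ : ℝ} (hV : Continuous V) (hζ : Continuous ζ)
    (hζ0 : ∀ y, 0 ≤ ζ y) (hΛ : ∀ y ∈ ball (0 : Euc N) ρ, V y ≤ Λ) {x : Euc N}
    (hx : x ∈ ball (0 : Euc N) (ρ - 1)) :
    pot 1 kerB 1 (fun y => V y * ζ y) x ≤ Λ * pot 1 kerB 1 ζ x := by
  rw [← pot_const_mul]
  exact pot_kerB_mono 1 (hV.mul hζ) (continuous_const.mul hζ) fun y hy =>
    mul_le_mul_of_nonneg_right (hΛ y (closedBall_subset_ball_zero hx (by linarith) hy)) (hζ0 y)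

lemma pot_kerB_le_of_avg_le {f : Euc N → ℝ} (hf : Continuous f) {M : ℝ} {x : Euc N}
    (h : ∀ s, 0 < s → s ≤ 1 → avg kerB s f x ≤ M * s⁻¹) : pot 1 kerB 1 f x ≤ M := by
  rw [isUnitKernel_kerB.pot_eq 1 zero_le_one hf]
  have h1 : ∫ s in (0 : ℝ)..1, s ^ 1 * avg kerB s f x ≤ ∫ _ in (0 : ℝ)..1, M := by
    refine intervalIntegral.integral_mono_on_of_le_Ioo zero_le_one
      (isUnitKernel_kerB.intervalIntegrable_avg 1 zero_le_one hf x) intervalIntegrable_const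
      fun s hs => ?_
    have := mul_le_mul_of_nonneg_left (h s hs.1 hs.2.le) hs.1.le
    rw [mul_left_comm, mul_inv_cancel₀ hs.1.ne', mul_one] at this
    rwa [pow_one]
  simpa using h1

lemma improve_le_of_massBound {Λ K M : ℝ} (hΛ0 : 0 ≤ Λ) (hV : Continuous V)
    (hζ : Continuous ζ) (hζ0 : ∀ y, 0 ≤ ζ y) (hΛ : ∀ y ∈ ball (0 : Euc N) ρ, V y ≤ Λ)
    {m : ℕ} (h1 : MassBound K M m ξ ρ) (h2 : MassBound K M 1 ζ ρ) {x : Euc N}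
    (hx : x ∈ ball (0 : Euc N) (ρ - 1)) : improve V ξ ζ x ≤ K + Λ * M := by
  have hx' : x ∈ ball (0 : Euc N) ρ := ball_subset_ball (by linarith) hx
  refine add_le_add (h1.unit x hx') ((pot_kerB_mul_le hV hζ hζ0 hΛ hx).trans ?_)
  refine mul_le_mul_of_nonneg_left (pot_kerB_le_of_avg_le hζ fun s hs hs1 => ?_) hΛ0
  simpa using h2.small x hx' s hs hs1

lemma avg_kerB_le_of_le {f : Euc N → ℝ} (hf : Continuous f) {C s : ℝ} (hs : 0 ≤ s) {x : Euc N}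
    (h : ∀ y ∈ closedBall x s, f y ≤ C) : avg kerB s f x ≤ C * ∫ z : Euc N, kerB z := by
  have := avg_kerB_mono hs hf (continuous_const (y := C)) h
  refine this.trans_eq ?_
  simp only [avg, wavg]
  rw [integral_mul_const, mul_comm]

lemma MassBound.improve {Λ K M : ℝ} (hK : 0 ≤ K) (hM : 0 ≤ M) (hΛ0 : 0 ≤ Λ) (hV : Continuous V)
    (hξ : Continuous ξ) (hζ : Continuous ζ) (hζ0 : ∀ y, 0 ≤ ζ y)
    (hΛ : ∀ y ∈ ball (0 : Euc N) ρ, V y ≤ Λ) {m : ℕ}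
    (hle : ∀ x ∈ ball (0 : Euc N) (ρ - 1), improve V ξ ζ x ≤ ξ x)
    (h1 : MassBound K M (m + 2) ξ ρ) (h2 : MassBound K M (m + 2) ζ ρ) :
    MassBound K ((K + Λ * M) * ∫ z : Euc N, kerB z) (m + 1) (improve V ξ ζ) (ρ - 2) := by
  have hI : 0 < ∫ z : Euc N, kerB z := integral_kerB_pos
  have cA : Continuous (avg kerA 1 ξ) := (isUnitKernel_kerA.avg zero_le_one).continuous hξ
  have cP : Continuous (pot 1 kerB 1 fun y => V y * ζ y) :=
    (isUnitKernel_kerB.pot 1 1).continuous (hV.mul hζ)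
  have cP' : Continuous (pot 1 kerB 1 ζ) := (isUnitKernel_kerB.pot 1 1).continuous hζ
  have ci : Continuous (_root_.improve V ξ ζ) := cA.add cP
  refine ⟨fun x hx => ?_, fun x hx r hr hr1 => ?_⟩
  · refine (avg_kerA_mono zero_le_one ci hξ fun y hy => hle y
      (closedBall_subset_ball_zero hx (by linarith) hy)).trans
      (h1.unit x (ball_subset_ball (by linarith) hx))
  · have e1 : avg kerB r (_root_.improve V ξ ζ) x =
        avg kerB r (avg kerA 1 ξ) x + avg kerB r (pot 1 kerB 1 fun y => V y * ζ y) x :=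
      (isUnitKernel_kerB.avg hr.le).add cA cP x
    have e2 : avg kerB r (avg kerA 1 ξ) x ≤ K * ∫ z : Euc N, kerB z :=
      avg_kerB_le_of_le cA hr.le fun y hy =>
        h1.unit y (closedBall_subset_ball_zero hx (by linarith) hy)
    have e3 : avg kerB r (pot 1 kerB 1 fun y => V y * ζ y) x ≤
        Λ * avg kerB r (pot 1 kerB 1 ζ) x := by
      rw [← avg_const_mul]
      exact avg_kerB_mono hr.le cP (continuous_const.mul cP') fun y hy =>
        pot_kerB_mul_le hV hζ hζ0 hΛ (closedBall_subset_ball_zero hx (by linarith) hy)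
    have e4 : avg kerB r (pot 1 kerB 1 ζ) x = pot 1 kerB 1 (avg kerB r ζ) x :=
      wavg_comm (isUnitKernel_kerB.avg hr.le) (isUnitKernel_kerB.pot 1 1) hζ x
    have cr : Continuous (avg kerB r ζ) := (isUnitKernel_kerB.avg hr.le).continuous hζ
    have e5 : pot 1 kerB 1 (avg kerB r ζ) x ≤ M * (r ^ (m + 1))⁻¹ * ∫ z : Euc N, kerB z := by
      refine pot_kerB_le_of_avg_le cr fun s hs hs1 => ?_
      have cs : Continuous (avg kerB s ζ) := (isUnitKernel_kerB.avg hs.le).continuous hζ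
      have hmin : ∀ a b : ℝ, 0 < a → 0 < b → a ≤ b →
          (b ^ (m + 2))⁻¹ ≤ (a ^ (m + 1))⁻¹ * b⁻¹ ∧ (b ^ (m + 2))⁻¹ ≤ (b ^ (m + 1))⁻¹ * a⁻¹ := by
        intro a b ha hb hab
        have : (b ^ (m + 2))⁻¹ = (b ^ (m + 1))⁻¹ * b⁻¹ := by rw [pow_succ b (m + 1), mul_inv]
        rw [this]
        exact ⟨by gcongr, by gcongr⟩
      have hb : avg kerB s (avg kerB r ζ) x ≤
          M * ((r ^ (m + 1))⁻¹ * s⁻¹) * ∫ z : Euc N, kerB z := by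
        rcases le_total s r with h | h
        · refine (avg_kerB_le_of_le cr hs.le (C := M * (r ^ (m + 2))⁻¹) fun y hy =>
            h2.small y (closedBall_subset_ball_zero hx (by linarith) hy) r hr hr1).trans ?_
          have := (hmin s r hs hr h).2
          gcongr
        · rw [avg, avg, wavg_comm (isUnitKernel_kerB.avg hs.le) (isUnitKernel_kerB.avg hr.le) hζ]
          refine (avg_kerB_le_of_le cs hr.le (C := M * (s ^ (m + 2))⁻¹) fun y hy =>
            h2.small y (closedBall_subset_ball_zero hx (by linarith) hy) s hs hs1).trans ?_
          have := (hmin r s hr hs h).1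
          gcongr
      refine hb.trans_eq ?_
      ring
    have e6 : (1 : ℝ) ≤ (r ^ (m + 1))⁻¹ := (one_le_inv₀ (by positivity)).2 (pow_le_one₀ hr.le hr1)
    have e7 : K * ∫ z : Euc N, kerB z ≤ (K * ∫ z : Euc N, kerB z) * (r ^ (m + 1))⁻¹ :=
      le_mul_of_one_le_right (by positivity) e6
    rw [e4] at e3
    have e8 := mul_le_mul_of_nonneg_left e5 hΛ0
    rw [e1]
    calc _ ≤ (K * ∫ z : Euc N, kerB z) * (r ^ (m + 1))⁻¹ +
          Λ * (M * (r ^ (m + 1))⁻¹ * ∫ z : Euc N, kerB z) := by linarith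
      _ = _ := by ring

lemma SuperOn.exists_bounded (Λ K : ℝ) (hΛ0 : 0 ≤ Λ) (hK : 0 ≤ K) (m : ℕ) (M : ℝ) (hM : 0 ≤ M) :
    ∃ M' : ℝ, 0 ≤ M' ∧ ∀ (V W ξ ζ : Euc N → ℝ) (ρ c : ℝ), ContDiff ℝ 2 V → ContDiff ℝ 2 W →
      (∀ y, 0 ≤ V y) → (∀ y, 0 ≤ W y) → (∀ y ∈ ball (0 : Euc N) ρ, V y ≤ Λ) →
      (∀ y ∈ ball (0 : Euc N) ρ, W y ≤ Λ) → SuperOn V W ξ ζ ρ →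
      (∀ y ∈ ball (0 : Euc N) ρ, c ≤ ξ y) → (∀ y ∈ ball (0 : Euc N) ρ, c ≤ ζ y) →
      MassBound K M (m + 1) ξ ρ → MassBound K M (m + 1) ζ ρ →
      ∃ ξ' ζ' : Euc N → ℝ, SuperOn V W ξ' ζ' (ρ - 2 * (m + 1)) ∧
        (∀ y ∈ ball (0 : Euc N) (ρ - 2 * (m + 1)), ξ' y ∈ Icc c M') ∧
        ∀ y ∈ ball (0 : Euc N) (ρ - 2 * (m + 1)), ζ' y ∈ Icc c M' := by
  induction m generalizing M with
  | zero =>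
    refine ⟨K + Λ * M, by positivity, ?_⟩
    intro V W ξ ζ ρ c hV hW hV0 hW0 hVΛ hWΛ hS hcξ hcζ h1 h2
    refine ⟨_root_.improve V ξ ζ, _root_.improve W ζ ξ,
      (hS.improve hV hW hV0 hW0).mono (by push_cast; linarith), fun y hy => ?_, fun y hy => ?_⟩
    · have hy' : y ∈ ball (0 : Euc N) (ρ - 1) := ball_subset_ball (by push_cast; linarith) hy
      exact ⟨le_improve hV0 hS.contDiff₁.continuous hS.nonneg₂ hcξ hy',
        improve_le_of_massBound hΛ0 hV.continuous hS.contDiff₂.continuous hS.nonneg₂ hVΛ h1 h2 hy'⟩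
    · have hy' : y ∈ ball (0 : Euc N) (ρ - 1) := ball_subset_ball (by push_cast; linarith) hy
      exact ⟨le_improve hW0 hS.contDiff₂.continuous hS.nonneg₁ hcζ hy',
        improve_le_of_massBound hΛ0 hW.continuous hS.contDiff₁.continuous hS.nonneg₁ hWΛ h2 h1 hy'⟩
  | succ m ih =>
    have hI : 0 < ∫ z : Euc N, kerB z := integral_kerB_pos
    obtain ⟨M', hM', H⟩ := ih ((K + Λ * M) * ∫ z : Euc N, kerB z) (by positivity)
    refine ⟨M', hM', ?_⟩
    intro V W ξ ζ ρ c hV hW hV0 hW0 hVΛ hWΛ hS hcξ hcζ h1 h2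
    have hsub : ball (0 : Euc N) (ρ - 2) ⊆ ball 0 ρ := ball_subset_ball (by linarith)
    have hsub' : ball (0 : Euc N) (ρ - 2) ⊆ ball 0 (ρ - 1) := ball_subset_ball (by linarith)
    have := H V W (_root_.improve V ξ ζ) (_root_.improve W ζ ξ) (ρ - 2) c hV hW hV0 hW0
      (fun y hy => hVΛ y (hsub hy)) (fun y hy => hWΛ y (hsub hy))
      ((hS.improve hV hW hV0 hW0).mono (by linarith))
      (fun y hy => le_improve hV0 hS.contDiff₁.continuous hS.nonneg₂ hcξ (hsub' hy))
      (fun y hy => le_improve hW0 hS.contDiff₂.continuous hS.nonneg₁ hcζ (hsub' hy))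
      (h1.improve hK hM hΛ0 hV.continuous hS.contDiff₁.continuous hS.contDiff₂.continuous
        hS.nonneg₂ hVΛ (fun x hx => improve_le hV.continuous hS.contDiff₁ hS.contDiff₂.continuous
          hS.le₁ hx) h2)
      (h2.improve hK hM hΛ0 hW.continuous hS.contDiff₂.continuous hS.contDiff₁.continuous
        hS.nonneg₁ hWΛ (fun x hx => improve_le hW.continuous hS.contDiff₂ hS.contDiff₁.continuous
          hS.le₂ hx) h1)
    have he : ρ - 2 - 2 * ((m : ℝ) + 1) = ρ - 2 * (((m + 1 : ℕ) : ℝ) + 1) := by push_cast; ring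
    rwa [he] at this

end Improve

/-- A sequence of continuous functions which is bounded and converges pointwise in a ball. -/
structure ConvOn (F : ℕ → Euc N → ℝ) (f : Euc N → ℝ) (ρ M : ℝ) : Prop where
  continuous : ∀ k, Continuous (F k)
  bound : ∀ k, ∀ y ∈ ball (0 : Euc N) ρ, |F k y| ≤ M
  tendsto : ∀ y ∈ ball (0 : Euc N) ρ, Tendsto (fun k => F k y) atTop (𝓝 (f y))

namespace ConvOn

variable {F G : ℕ → Euc N → ℝ} {f g : Euc N → ℝ} {ρ ρ' M M' : ℝ}

lemma mono (h : ConvOn F f ρ M) (hρ : ρ' ≤ ρ) : ConvOn F f ρ' M :=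
  ⟨h.continuous, fun k y hy => h.bound k y (ball_subset_ball hρ hy),
    fun y hy => h.tendsto y (ball_subset_ball hρ hy)⟩

lemma comp (h : ConvOn F f ρ M) {φ : ℕ → ℕ} (hφ : StrictMono φ) :
    ConvOn (fun k => F (φ k)) f ρ M :=
  ⟨fun _ => h.continuous _, fun _ => h.bound _, fun y hy => (h.tendsto y hy).comp hφ.tendsto_atTop⟩

lemma mul (h : ConvOn F f ρ M) (h' : ConvOn G g ρ M') :
    ConvOn (fun k y => F k y * G k y) (fun y => f y * g y) ρ (M * M') :=
  ⟨fun k => (h.continuous k).mul (h'.continuous k), fun k y hy => by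
    rw [abs_mul]
    exact mul_le_mul (h.bound k y hy) (h'.bound k y hy) (abs_nonneg _)
      ((abs_nonneg _).trans (h.bound k y hy)),
    fun y hy => (h.tendsto y hy).mul (h'.tendsto y hy)⟩

lemma tendsto_wavg (h : ConvOn F f ρ M) {Ω : Type*} [MeasurableSpace Ω] {P : Measure Ω}
    {w : Ω → ℝ} {Y : Ω → Euc N} {t : ℝ} (hk : IsAvgKernel P w Y t) {x : Euc N}
    (hx : x ∈ ball (0 : Euc N) (ρ - t)) :
    Tendsto (fun k => wavg P w Y (F k) x) atTop (𝓝 (wavg P w Y f x)) := by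
  have hsub := closedBall_subset_ball_zero hx (ρ := ρ) (t := t) (by linarith)
  exact hk.tendsto h.continuous (Eventually.of_forall fun k y hy => h.bound k y (hsub hy))
    fun y hy => h.tendsto y (hsub hy)

lemma tendsto_avg (h : ConvOn F f ρ M) {t : ℝ} (ht : 0 ≤ t) {x : Euc N}
    (hx : x ∈ ball (0 : Euc N) (ρ - t)) :
    Tendsto (fun k => avg kerA t (F k) x) atTop (𝓝 (avg kerA t f x)) :=
  h.tendsto_wavg (isUnitKernel_kerA.avg ht) hx

lemma tendsto_pot (h : ConvOn F f ρ M) {t : ℝ} {x : Euc N}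
    (hx : x ∈ ball (0 : Euc N) (ρ - t)) :
    Tendsto (fun k => pot 1 kerB t (F k) x) atTop (𝓝 (pot 1 kerB t f x)) :=
  h.tendsto_wavg (isUnitKernel_kerB.pot 1 t) hx

end ConvOn

lemma SuperOn.const_mul {V W ξ ζ : Euc N → ℝ} {ρ c : ℝ} (h : SuperOn V W ξ ζ ρ) (hc : 0 ≤ c) :
    SuperOn V W (fun y => c * ξ y) (fun y => c * ζ y) ρ where
  contDiff₁ := contDiff_const.mul h.contDiff₁
  contDiff₂ := contDiff_const.mul h.contDiff₂
  nonneg₁ y := mul_nonneg hc (h.nonneg₁ y)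
  nonneg₂ y := mul_nonneg hc (h.nonneg₂ y)
  le₁ y hy := by
    rw [lap_const_mul h.contDiff₁]
    nlinarith [h.le₁ y hy]
  le₂ y hy := by
    rw [lap_const_mul h.contDiff₂]
    nlinarith [h.le₂ y hy]

/-- Normalized supersolutions have uniform lower bounds and mass bounds. -/
lemma SuperOn.exists_normalized (N : ℕ) {R Λ : ℝ} (hR : 0 < R) (hΛ : 1 ≤ Λ) :
    ∃ c K : ℝ, 0 < c ∧ 0 ≤ K ∧ ∀ V W ξ ζ : Euc N → ℝ, Continuous V → Continuous W →
      (∀ y ∈ ball (0 : Euc N) (8 * (R + 1)), Λ⁻¹ ≤ V y) →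
      (∀ y ∈ ball (0 : Euc N) (8 * (R + 1)), Λ⁻¹ ≤ W y) →
      SuperOn V W ξ ζ (8 * (R + 1)) → 0 < ξ 0 → 0 < ζ 0 →
      ∃ ξ' ζ' : Euc N → ℝ, SuperOn V W ξ' ζ' R ∧
        (∀ y ∈ ball (0 : Euc N) R, c ≤ ξ' y) ∧ (∀ y ∈ ball (0 : Euc N) R, c ≤ ζ' y) ∧
        MassBound K K (N + 1) ξ' R ∧ MassBound K K (N + 1) ζ' R := by
  set ρ₀ : ℝ := 2 * (R + 1) with hρ₀
  set s' : ℝ := 6 * (R + 1) with hs'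
  set H : ℝ := 36 * ((s' + 1) / ρ₀) ^ N with hH
  have hρ0 : 0 < ρ₀ := by positivity
  have hs0 : 0 < s' := by positivity
  have hH0 : 0 < H := by positivity
  have hΛ0 : 0 < Λ := by linarith
  refine ⟨(Λ * H)⁻¹, 36 * ρ₀ ^ N, by positivity, by positivity, ?_⟩
  intro V W ξ ζ hV hW hVΛ hWΛ hS hξ0 hζ0
  have key : ∀ {V ξ ζ : Euc N → ℝ}, Continuous V → ContDiff ℝ 2 ξ → ContDiff ℝ 2 ζ →
      (∀ y, 0 ≤ ξ y) → (∀ y, 0 ≤ ζ y) → (∀ y ∈ ball (0 : Euc N) (8 * (R + 1)), Λ⁻¹ ≤ V y) →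
      (∀ y ∈ ball (0 : Euc N) (8 * (R + 1)), V y * ζ y ≤ -lap ξ y) →
      ∀ x ∈ ball (0 : Euc N) R,
        (Λ * H)⁻¹ * (avg kerA ρ₀ ξ 0 + avg kerA ρ₀ ζ 0) ≤ ξ x := by
    intro V ξ ζ hV hξ hζ hξ0 hζ0 hVΛ hle x hx
    have hsub : closedBall x (s' + 1) ⊆ ball 0 (8 * (R + 1)) :=
      closedBall_subset_ball_zero hx (by linarith)
    rw [mem_ball, dist_zero_right] at hx
    have h1 := isBallKernel_kerA.avg_le_avg isBallKernel_kerA hξ.continuous hξ0 (s' := s' + 1)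
      hρ0 (x := 0) (x' := x) (by rw [zero_sub, norm_neg]; linarith)
    have h2 := avg_le_pot hζ.continuous hζ0 (s' := s') hρ0 (x := 0) (x' := x)
      (by rw [zero_sub, norm_neg]; linarith) (by linarith)
    rw [← hH] at h1 h2
    have h3 := avg_add_pot_le hξ (continuous_const.mul hζ.continuous) (h := fun y => Λ⁻¹ * ζ y)
      (t := s' + 1) (by linarith) (x := x) fun y hy =>
        (mul_le_mul_of_nonneg_right (hVΛ y (hsub hy)) (hζ0 y)).trans (hle y (hsub hy))
    rw [pot_const_mul] at h3
    have h4 : 0 ≤ avg kerA (s' + 1) ξ x := avg_kerA_nonneg (by linarith) fun y _ => hξ0 y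
    have h5 : Λ⁻¹ * avg kerA (s' + 1) ξ x ≤ avg kerA (s' + 1) ξ x :=
      mul_le_of_le_one_left h4 (inv_le_one_of_one_le₀ hΛ)
    refine le_trans ?_ h3
    refine le_trans ?_ (add_le_add_left h5 _)
    rw [← mul_add, mul_inv, mul_assoc]
    refine mul_le_mul_of_nonneg_left ?_ (by positivity)
    rw [inv_mul_le_iff₀ hH0]
    linarith
  have hmξ : 0 < avg kerA ρ₀ ξ 0 := avg_kerA_pos hS.contDiff₁.continuous hS.nonneg₁ hξ0
    (by simpa using by positivity)
  have hmζ : 0 < avg kerA ρ₀ ζ 0 := avg_kerA_pos hS.contDiff₂.continuous hS.nonneg₂ hζ0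
    (by simpa using by positivity)
  set μ : ℝ := avg kerA ρ₀ ξ 0 + avg kerA ρ₀ ζ 0 with hμ
  have hμ0 : 0 < μ := by positivity
  have mass : ∀ {ξ : Euc N → ℝ}, Continuous ξ → (∀ y, 0 ≤ ξ y) → avg kerA ρ₀ ξ 0 ≤ μ →
      MassBound (36 * ρ₀ ^ N) (36 * ρ₀ ^ N) (N + 1) (fun y => μ⁻¹ * ξ y) R := by
    intro ξ hξ hξ0 hm
    refine ⟨fun x hx => ?_, fun x hx s hs hs1 => ?_⟩
    · rw [mem_ball, dist_zero_right] at hx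
      have h1 := isBallKernel_kerA.avg_le_avg isBallKernel_kerA hξ hξ0 (s' := ρ₀)
        one_pos (x := x) (x' := 0) (by rw [sub_zero]; linarith)
      rw [div_one] at h1
      rw [avg_const_mul, inv_mul_le_iff₀ hμ0]
      refine h1.trans ?_
      rw [mul_comm μ]
      gcongr
    · rw [mem_ball, dist_zero_right] at hx
      have h1 := isBallKernel_kerB.avg_le_avg isBallKernel_kerA hξ hξ0 (s' := ρ₀)
        hs (x := x) (x' := 0) (by rw [sub_zero]; linarith)
      rw [avg_const_mul, inv_mul_le_iff₀ hμ0]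
      refine h1.trans ?_
      have h2 : (s ^ N)⁻¹ ≤ (s ^ (N + 1))⁻¹ :=
        inv_anti₀ (by positivity) (pow_le_pow_of_le_one hs.le hs1 (by omega))
      have h3 : 0 ≤ avg kerA ρ₀ ξ 0 := avg_kerA_nonneg hρ0.le fun y _ => hξ0 y
      rw [mul_comm μ, div_eq_mul_inv, mul_pow, inv_pow, ← mul_assoc]
      gcongr
  refine ⟨_, _, (hS.const_mul (inv_nonneg.2 hμ0.le)).mono (by linarith), fun x hx => ?_,
    fun x hx => ?_, mass hS.contDiff₁.continuous hS.nonneg₁ (by linarith),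
    mass hS.contDiff₂.continuous hS.nonneg₂ (by linarith)⟩
  · rw [le_inv_mul_iff₀ hμ0, mul_comm]
    exact key hV hS.contDiff₁ hS.contDiff₂ hS.nonneg₁ hS.nonneg₂ hVΛ hS.le₁ x hx
  · rw [le_inv_mul_iff₀ hμ0, mul_comm, hμ, add_comm]
    exact key hW hS.contDiff₂ hS.contDiff₁ hS.nonneg₂ hS.nonneg₁ hWΛ hS.le₂ x hx

lemma ConvOn.improve {V ξ ζ : ℕ → Euc N → ℝ} {v g h : Euc N → ℝ} {ρ Λ M M' : ℝ}
    (hV : ConvOn V v ρ Λ) (hξ : ConvOn ξ g ρ M) (hζ : ConvOn ζ h ρ M)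
    (hle : ∀ k, ∀ y ∈ ball (0 : Euc N) (ρ - 1), |_root_.improve (V k) (ξ k) (ζ k) y| ≤ M') :
    ConvOn (fun k => _root_.improve (V k) (ξ k) (ζ k)) (_root_.improve v g h) (ρ - 1) M' where
  continuous k := ((isUnitKernel_kerA.avg zero_le_one).continuous (hξ.continuous k)).add
    ((isUnitKernel_kerB.pot 1 1).continuous ((hV.continuous k).mul (hζ.continuous k)))
  bound := hle
  tendsto _ hy := (hξ.tendsto_avg zero_le_one hy).add ((hV.mul hζ).tendsto_pot hy)

/-- Supersolutions can be replaced by ones with uniform two-sided bounds and uniform gradient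
bounds in a smaller ball. -/
lemma SuperOn.exists_regular (N : ℕ) {R : ℝ} (hR : 0 < R) : ∃ R' : ℝ, R < R' ∧
    ∀ Λ : ℝ, 1 ≤ Λ → ∃ c M L : ℝ, 0 < c ∧ 0 ≤ M ∧ 0 ≤ L ∧ ∀ V W ξ ζ : Euc N → ℝ,
      ContDiff ℝ 2 V → ContDiff ℝ 2 W → (∀ y, 0 ≤ V y) → (∀ y, 0 ≤ W y) →
      (∀ y ∈ ball (0 : Euc N) R', V y ∈ Icc Λ⁻¹ Λ) →
      (∀ y ∈ ball (0 : Euc N) R', W y ∈ Icc Λ⁻¹ Λ) →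
      SuperOn V W ξ ζ R' → 0 < ξ 0 → 0 < ζ 0 →
      ∃ ξ' ζ' : Euc N → ℝ, SuperOn V W ξ' ζ' R ∧
        (∀ y ∈ ball (0 : Euc N) R, ξ' y ∈ Icc c M ∧ ζ' y ∈ Icc c M ∧
          ‖fderiv ℝ ξ' y‖ ≤ L ∧ ‖fderiv ℝ ζ' y‖ ≤ L) := by
  have hR1 : 0 < R + 1 + 2 * ((N : ℝ) + 1) := by positivity
  refine ⟨8 * (R + 1 + 2 * ((N : ℝ) + 1) + 1), by linarith, fun Λ hΛ => ?_⟩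
  obtain ⟨c, K, hc, hK, H1⟩ := SuperOn.exists_normalized N hR1 hΛ
  have hΛ0 : 0 ≤ Λ := by linarith
  obtain ⟨M, hM, H2⟩ := SuperOn.exists_bounded (N := N) Λ K hΛ0 hK N K hK
  refine ⟨c, M, gradConst N * (1⁻¹ * M + 1 * (Λ * M)), hc, hM,
    mul_nonneg (gradConst_nonneg N) (by positivity), ?_⟩
  intro V W ξ ζ hV hW hV0 hW0 hVΛ hWΛ hS hξ hζ
  obtain ⟨ξ₁, ζ₁, hS₁, hc₁, hc₁', m₁, m₂⟩ := H1 V W ξ ζ hV.continuous hW.continuous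
    (fun y hy => (hVΛ y hy).1) (fun y hy => (hWΛ y hy).1) hS hξ hζ
  have hsub : ball (0 : Euc N) (R + 1 + 2 * ((N : ℝ) + 1)) ⊆
      ball 0 (8 * (R + 1 + 2 * ((N : ℝ) + 1) + 1)) := ball_subset_ball (by linarith)
  obtain ⟨ξ₂, ζ₂, hS₂, b₁, b₂⟩ := H2 V W ξ₁ ζ₁ _ c hV hW hV0 hW0
    (fun y hy => (hVΛ y (hsub hy)).2) (fun y hy => (hWΛ y (hsub hy)).2) hS₁
    hc₁ hc₁' m₁ m₂
  rw [add_sub_cancel_right] at hS₂ b₁ b₂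
  have hsub₁ : ball (0 : Euc N) (R + 1) ⊆ ball 0 (8 * (R + 1 + 2 * ((N : ℝ) + 1) + 1)) :=
    ball_subset_ball (by
      have : (0 : ℝ) ≤ N := Nat.cast_nonneg N
      linarith)
  have hsub₂ : ball (0 : Euc N) R ⊆ ball 0 (R + 1 - 1) := ball_subset_ball (by linarith)
  have grad : ∀ {V ξ ζ : Euc N → ℝ}, Continuous V → Continuous ξ → Continuous ζ →
      (∀ y, 0 ≤ V y) → (∀ y ∈ ball (0 : Euc N) (8 * (R + 1 + 2 * ((N : ℝ) + 1) + 1)), V y ≤ Λ) →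
      (∀ y ∈ ball (0 : Euc N) (R + 1), ξ y ∈ Icc c M) →
      (∀ y ∈ ball (0 : Euc N) (R + 1), ζ y ∈ Icc c M) → ∀ y ∈ ball (0 : Euc N) R,
      ‖fderiv ℝ (_root_.improve V ξ ζ) y‖ ≤ gradConst N * (1⁻¹ * M + 1 * (Λ * M)) := by
    intro V ξ ζ hV hξ hζ hV0 hVΛ hξM hζM y hy
    refine norm_fderiv_avg_add_pot_le hξ (hV.mul hζ) one_pos (fun z hz => ?_) fun z hz => ?_
    · have hz' := closedBall_subset_ball_zero hy (ρ := R + 1) (by linarith) hz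
      rw [abs_of_nonneg (hc.le.trans (hξM z hz').1)]
      exact (hξM z hz').2
    · have hz' := closedBall_subset_ball_zero hy (ρ := R + 1) (by linarith) hz
      rw [Pi.mul_apply, abs_mul, abs_of_nonneg (hV0 z), abs_of_nonneg (hc.le.trans (hζM z hz').1)]
      exact mul_le_mul (hVΛ z (hsub₁ hz')) (hζM z hz').2 (hc.le.trans (hζM z hz').1) hΛ0
  have hS₃ := (hS₂.improve hV hW hV0 hW0).mono (ρ' := R) (by linarith)
  have hsub₃ : ball (0 : Euc N) R ⊆ ball 0 (R + 1) := ball_subset_ball (by linarith)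
  refine ⟨_, _, hS₃, fun y hy => ⟨⟨?_, ?_⟩, ⟨?_, ?_⟩, ?_, ?_⟩⟩
  · exact le_improve hV0 hS₂.contDiff₁.continuous hS₂.nonneg₂ (fun z hz => (b₁ z hz).1) (hsub₂ hy)
  · exact (improve_le hV.continuous hS₂.contDiff₁ hS₂.contDiff₂.continuous hS₂.le₁ (hsub₂ hy)).trans
      (b₁ y (hsub₃ hy)).2
  · exact le_improve hW0 hS₂.contDiff₂.continuous hS₂.nonneg₁ (fun z hz => (b₂ z hz).1) (hsub₂ hy)
  · exact (improve_le hW.continuous hS₂.contDiff₂ hS₂.contDiff₁.continuous hS₂.le₂ (hsub₂ hy)).trans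
      (b₂ y (hsub₃ hy)).2
  · exact grad hV.continuous hS₂.contDiff₁.continuous hS₂.contDiff₂.continuous hV0
      (fun y hy => (hVΛ y hy).2) b₁ b₂ y hy
  · exact grad hW.continuous hS₂.contDiff₂.continuous hS₂.contDiff₁.continuous hW0
      (fun y hy => (hWΛ y hy).2) b₂ b₁ y hy

/-- A sequence of functions with uniform bounds and gradient bounds in a ball has a subsequence
converging there. -/
lemma exists_subseq_convOn {F : ℕ → Euc N → ℝ} {ρ M L : ℝ} (hρ : 0 < ρ) (hL : 0 ≤ L)
    (hd : ∀ k, Differentiable ℝ (F k)) (hM : ∀ k, ∀ y ∈ ball (0 : Euc N) ρ, |F k y| ≤ M)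
    (hf : ∀ k, ∀ y ∈ ball (0 : Euc N) ρ, ‖fderiv ℝ (F k) y‖ ≤ L) :
    ∃ (φ : ℕ → ℕ) (g : Euc N → ℝ), StrictMono φ ∧ Continuous g ∧
      ConvOn (fun k => F (φ k)) g ρ M := by
  choose G hG hE using fun k => exists_lipschitz_eq hL
    (fun y _ => (hd k).differentiableAt) (hf k)
  obtain ⟨φ, g, hφ, hg, ht⟩ := exists_subseq_tendsto hG (C := M) fun k => by
    rw [← hE k (mem_ball_self hρ)]
    exact hM k 0 (mem_ball_self hρ)
  refine ⟨φ, g, hφ, hg, fun k => (hd _).continuous, fun k => hM _, fun y hy => ?_⟩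
  refine (ht y).congr fun k => ?_
  exact (hE (φ k) hy).symm

/-- Passing to the limit in the inequality `h ≤ -lap f`. -/
lemma le_neg_lap_of_convOn {F H : ℕ → Euc N → ℝ} {f h : Euc N → ℝ} {ρ M M' : ℝ}
    (hF : ConvOn F f ρ M) (hH : ConvOn H h ρ M') (hF2 : ∀ k, ContDiff ℝ 2 (F k))
    (hf : ContDiff ℝ 2 f) (hh : Continuous h)
    (hle : ∀ k, ∀ y ∈ ball (0 : Euc N) ρ, H k y ≤ -lap (F k) y) {x : Euc N}
    (hx : x ∈ ball (0 : Euc N) ρ) : h x ≤ -lap f x := by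
  have hx' := hx
  rw [mem_ball, dist_zero_right] at hx'
  have key := nonneg_of_pot_nonneg (g := fun y => (-1) * lap f y - h y) (x := x)
    (δ := ρ - ‖x‖) ((continuous_const.mul (continuous_lap hf)).sub hh) (by linarith)
    fun s hs hsδ => by
      have hxs : x ∈ ball (0 : Euc N) (ρ - s) := by
        rw [mem_ball, dist_zero_right]; linarith
      have h1 : avg kerA s f x + pot 1 kerB s h x ≤ f x := by
        refine le_of_tendsto_of_tendsto' ((hF.tendsto_avg hs.le hxs).add (hH.tendsto_pot hxs))
          (hF.tendsto x hx) fun k => ?_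
        exact avg_add_pot_le (hF2 k) (hH.continuous k) hs.le fun y hy =>
          hle k y (closedBall_subset_ball_zero hxs (by linarith) hy)
      have h2 := eq_avg_sub_pot hf hs.le x
      have h3 : pot 1 kerB s (fun y => (-1) * lap f y - h y) x =
          pot 1 kerB s (fun y => (-1) * lap f y) x - pot 1 kerB s h x :=
        (isUnitKernel_kerB.pot 1 s).sub (continuous_const.mul (continuous_lap hf)) hh x
      rw [h3, pot_const_mul]
      linarith
  linarith

/-- Stability of the existence of positive supersolutions under convergence of the
coefficients. -/
lemma exists_super_of_tendsto {R : ℝ} (hR : 0 < R) : ∃ R' : ℝ, 0 < R' ∧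
    ∀ Λ : ℝ, 1 ≤ Λ → ∀ (V W ξ ζ : ℕ → Euc N → ℝ) (v w : Euc N → ℝ),
      (∀ k, ContDiff ℝ 2 (V k)) → (∀ k, ContDiff ℝ 2 (W k)) →
      (∀ k y, 0 ≤ V k y) → (∀ k y, 0 ≤ W k y) →
      (∀ k, ∀ y ∈ ball (0 : Euc N) R', V k y ∈ Icc Λ⁻¹ Λ) →
      (∀ k, ∀ y ∈ ball (0 : Euc N) R', W k y ∈ Icc Λ⁻¹ Λ) →
      (∀ k, SuperOn (V k) (W k) (ξ k) (ζ k) R') → (∀ k, 0 < ξ k 0) → (∀ k, 0 < ζ k 0) →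
      ContDiff ℝ 1 v → ContDiff ℝ 1 w →
      (∀ y ∈ ball (0 : Euc N) R', Tendsto (fun k => V k y) atTop (𝓝 (v y))) →
      (∀ y ∈ ball (0 : Euc N) R', Tendsto (fun k => W k y) atTop (𝓝 (w y))) →
      ∃ ξ' ζ' : Euc N → ℝ, ContDiff ℝ 2 ξ' ∧ ContDiff ℝ 2 ζ' ∧
        ∀ y ∈ ball (0 : Euc N) R, 0 < ξ' y ∧ 0 < ζ' y ∧
          v y * ζ' y ≤ -lap ξ' y ∧ w y * ξ' y ≤ -lap ζ' y := by
  obtain ⟨R', hRR', H⟩ := SuperOn.exists_regular N (R := R + 1 + 1) (by linarith)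
  refine ⟨R', by linarith, fun Λ hΛ => ?_⟩
  obtain ⟨c, M, L, hc, hM, hL, H⟩ := H Λ hΛ
  intro V W ξ ζ v w hV hW hV0 hW0 hVΛ hWΛ hS hξ hζ hv hw hVv hWw
  choose ξ₁ ζ₁ hS₁ hb using fun k => H (V k) (W k) (ξ k) (ζ k) (hV k) (hW k) (hV0 k) (hW0 k)
    (hVΛ k) (hWΛ k) (hS k) (hξ k) (hζ k)
  have hsub : ball (0 : Euc N) (R + 1 + 1) ⊆ ball 0 R' := ball_subset_ball hRR'.le
  have hCV : ConvOn V v (R + 1 + 1) Λ := ⟨fun k => (hV k).continuous, fun k y hy => by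
    rw [abs_of_nonneg (hV0 k y)]; exact (hVΛ k y (hsub hy)).2, fun y hy => hVv y (hsub hy)⟩
  have hCW : ConvOn W w (R + 1 + 1) Λ := ⟨fun k => (hW k).continuous, fun k y hy => by
    rw [abs_of_nonneg (hW0 k y)]; exact (hWΛ k y (hsub hy)).2, fun y hy => hWw y (hsub hy)⟩
  have habs : ∀ {r : ℝ}, r ∈ Icc c M → |r| ≤ M := fun hr => by
    rw [abs_of_nonneg (hc.le.trans hr.1)]; exact hr.2
  obtain ⟨φ, g, hφ, hg, hCg⟩ := exists_subseq_convOn (F := ξ₁) (ρ := R + 1 + 1) (by linarith) hL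
    (fun k => (hS₁ k).contDiff₁.differentiable two_ne_zero) (fun k y hy => habs (hb k y hy).1)
    fun k y hy => (hb k y hy).2.2.1
  obtain ⟨ψ, h, hψ, hh, hCh⟩ := exists_subseq_convOn (F := fun k => ζ₁ (φ k)) (ρ := R + 1 + 1)
    (by linarith) hL
    (fun k => (hS₁ _).contDiff₂.differentiable two_ne_zero) (fun k y hy => habs (hb _ y hy).2.1)
    fun k y hy => (hb _ y hy).2.2.2
  replace hCg := hCg.comp hψ
  replace hCV := (hCV.comp hφ).comp hψ
  replace hCW := (hCW.comp hφ).comp hψ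
  have step : ∀ {ξ ζ : ℕ → Euc N → ℝ} {g h : Euc N → ℝ} {ρ : ℝ}, ρ ≤ R + 1 →
      (∀ k, SuperOn (V (φ (ψ k))) (W (φ (ψ k))) (ξ k) (ζ k) (ρ + 1)) →
      (∀ k, ∀ y ∈ ball (0 : Euc N) (ρ + 1), ξ k y ∈ Icc c M ∧ ζ k y ∈ Icc c M) →
      ConvOn ξ g (ρ + 1) M → ConvOn ζ h (ρ + 1) M →
      ∃ ξ' ζ' : ℕ → Euc N → ℝ,
        (∀ k, SuperOn (V (φ (ψ k))) (W (φ (ψ k))) (ξ' k) (ζ' k) ρ) ∧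
        (∀ k, ∀ y ∈ ball (0 : Euc N) ρ, ξ' k y ∈ Icc c M ∧ ζ' k y ∈ Icc c M) ∧
        ConvOn ξ' (improve v g h) ρ M ∧ ConvOn ζ' (improve w h g) ρ M := by
    intro ξ ζ g h ρ hρ hS hb hξ hζ
    have hsub : ball (0 : Euc N) ρ ⊆ ball 0 (ρ + 1) := ball_subset_ball (by linarith)
    have he : ρ + 1 - 1 = ρ := by ring
    have b1 : ∀ k, ∀ y ∈ ball (0 : Euc N) ρ,
        improve (V (φ (ψ k))) (ξ k) (ζ k) y ∈ Icc c M := fun k y hy =>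
      ⟨le_improve (hV0 _) (hS k).contDiff₁.continuous (hS k).nonneg₂
        (fun z hz => (hb k z hz).1.1) (he.symm ▸ hy),
      (improve_le (hV _).continuous (hS k).contDiff₁ (hS k).contDiff₂.continuous (hS k).le₁
        (he.symm ▸ hy)).trans (hb k y (hsub hy)).1.2⟩
    have b2 : ∀ k, ∀ y ∈ ball (0 : Euc N) ρ,
        improve (W (φ (ψ k))) (ζ k) (ξ k) y ∈ Icc c M := fun k y hy =>
      ⟨le_improve (hW0 _) (hS k).contDiff₂.continuous (hS k).nonneg₁
        (fun z hz => (hb k z hz).2.1) (he.symm ▸ hy),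
      (improve_le (hW _).continuous (hS k).contDiff₂ (hS k).contDiff₁.continuous (hS k).le₂
        (he.symm ▸ hy)).trans (hb k y (hsub hy)).2.2⟩
    have c1 := (hCV.mono (ρ' := ρ + 1) (by linarith)).improve hξ hζ (M' := M)
      fun k y hy => habs (b1 k y (he ▸ hy))
    have c2 := (hCW.mono (ρ' := ρ + 1) (by linarith)).improve hζ hξ (M' := M)
      fun k y hy => habs (b2 k y (he ▸ hy))
    rw [he] at c1 c2
    exact ⟨_, _, fun k => ((hS k).improve (hV _) (hW _) (hV0 _) (hW0 _)).mono (by linarith),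
      fun k y hy => ⟨b1 k y hy, b2 k y hy⟩, c1, c2⟩
  obtain ⟨ξ₂, ζ₂, hS₂, hb₂, cξ₂, cζ₂⟩ := step (ρ := R + 1) le_rfl (fun k => hS₁ (φ (ψ k)))
    (fun k y hy => ⟨(hb _ y hy).1, (hb _ y hy).2.1⟩) hCg hCh
  obtain ⟨ξ₃, ζ₃, hS₃, hb₃, cξ₃, cζ₃⟩ := step (ρ := R) (by linarith) hS₂ hb₂ cξ₂ cζ₂
  have s2 : ContDiff ℝ 1 (improve v g h) := by
    simpa using contDiff_improve_succ 0 (hv.of_le (by simp)) (contDiff_zero.2 hg)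
      (contDiff_zero.2 hh)
  have s2' : ContDiff ℝ 1 (improve w h g) := by
    simpa using contDiff_improve_succ 0 (hw.of_le (by simp)) (contDiff_zero.2 hh)
      (contDiff_zero.2 hg)
  have s3 : ContDiff ℝ 2 (improve v (improve v g h) (improve w h g)) :=
    contDiff_improve_succ 1 (by exact_mod_cast hv) (by exact_mod_cast s2) (by exact_mod_cast s2')
  have s3' : ContDiff ℝ 2 (improve w (improve w h g) (improve v g h)) :=
    contDiff_improve_succ 1 (by exact_mod_cast hw) (by exact_mod_cast s2') (by exact_mod_cast s2)
  have hV' := hCV.mono (ρ' := R) (by linarith)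
  have hW' := hCW.mono (ρ' := R) (by linarith)
  refine ⟨_, _, s3, s3', fun y hy => ⟨?_, ?_, ?_, ?_⟩⟩
  · exact hc.trans_le (ge_of_tendsto' (cξ₃.tendsto y hy) fun k => (hb₃ k y hy).1.1)
  · exact hc.trans_le (ge_of_tendsto' (cζ₃.tendsto y hy) fun k => (hb₃ k y hy).2.1)
  · exact le_neg_lap_of_convOn cξ₃ (hV'.mul cζ₃) (fun k => (hS₃ k).contDiff₁) s3
      (hv.continuous.mul s3'.continuous) (fun k => (hS₃ k).le₁) hy
  · exact le_neg_lap_of_convOn cζ₃ (hW'.mul cξ₃) (fun k => (hS₃ k).contDiff₂) s3'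
      (hw.continuous.mul s3.continuous) (fun k => (hS₃ k).le₂) hy

lemma exists_subseq_tendsto_of_fderiv {F : ℕ → Euc N → ℝ} {M L : ℝ} (hL : 0 ≤ L)
    (hd : ∀ k, Differentiable ℝ (F k)) (hM : ∀ k, |F k 0| ≤ M)
    (hf : ∀ k : ℕ, ∀ y ∈ ball (0 : Euc N) (k + 1), ‖fderiv ℝ (F k) y‖ ≤ L) :
    ∃ (φ : ℕ → ℕ) (g : Euc N → ℝ), StrictMono φ ∧ Continuous g ∧
      ∀ y, Tendsto (fun k => F (φ k) y) atTop (𝓝 (g y)) := by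
  choose G hG hE using fun k => exists_lipschitz_eq hL
    (fun y _ => (hd k).differentiableAt) (hf k)
  obtain ⟨φ, g, hφ, hg, ht⟩ := exists_subseq_tendsto hG (C := M) fun k => by
    rw [← hE k (mem_ball_self (by positivity))]
    exact hM k
  refine ⟨φ, g, hφ, hg, fun y => (ht y).congr' ?_⟩
  filter_upwards [eventually_ge_atTop ⌈‖y‖⌉₊] with k hk
  refine (hE (φ k) ?_).symm
  rw [mem_ball, dist_zero_right]
  have h1 : (k : ℝ) ≤ φ k := by exact_mod_cast hφ.le_apply
  have h2 := Nat.ceil_le.1 hk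
  linarith

/-- The strong maximum principle for solutions of `-Δf = g` given by averages. -/
lemma eq_zero_of_eq_avg_add_pot {f g : Euc N → ℝ} (hf : Continuous f) (hg : Continuous g)
    (hf0 : ∀ x, 0 ≤ f x) (hg0 : ∀ x, 0 ≤ g x)
    (h : ∀ t, 0 ≤ t → ∀ x, f x = avg kerA t f x + pot 1 kerB t g x) {x₀ : Euc N} (h0 : f x₀ = 0) :
    (∀ x, f x = 0) ∧ ∀ x, g x = 0 := by
  have hA : ∀ {t x}, 0 ≤ t → 0 ≤ avg kerA t f x := fun ht => avg_kerA_nonneg ht fun y _ => hf0 y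
  have hB : ∀ {t x}, 0 ≤ pot 1 kerB t g x := pot_kerB_nonneg _ fun y _ => hg0 y
  have hfz : ∀ x, f x = 0 := by
    intro x
    by_contra hx
    have hx' : 0 < f x := lt_of_le_of_ne (hf0 x) (Ne.symm hx)
    have ht : 0 ≤ 2 * (‖x - x₀‖ + 1) := by positivity
    have h1 := avg_kerA_pos (s := 2 * (‖x - x₀‖ + 1)) hf hf0 hx'
      (by linarith [norm_nonneg (x - x₀)] : ‖x - x₀‖ < _)
    have h2 := h _ ht x₀
    have h3 := hB (t := 2 * (‖x - x₀‖ + 1)) (x := x₀)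
    linarith
  refine ⟨hfz, fun x => le_antisymm ?_ (hg0 x)⟩
  have := nonneg_of_pot_nonneg (g := fun y => -g y) hg.neg one_pos (x := x) fun s hs _ => by
    rw [pot_neg]
    have h1 := h s hs.le x
    rw [hfz] at h1
    linarith [hA (t := s) (x := x) hs.le]
  linarith

lemma neg_lap_eq_of_eq_avg_add_pot {f g : Euc N → ℝ} (hf : ContDiff ℝ 2 f) (hg : Continuous g)
    (h : ∀ t, 0 ≤ t → ∀ x, f x = avg kerA t f x + pot 1 kerB t g x) (x : Euc N) :
    -lap f x = g x := by
  have hl := continuous_lap hf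
  have key : ∀ s, 0 < s → pot 1 kerB s (lap f) x = -pot 1 kerB s g x := fun s hs => by
    have h1 := h s hs.le x
    have h2 := eq_avg_sub_pot hf hs.le x
    linarith
  have hP : ∀ s, pot 1 kerB s (fun y => lap f y + g y) x =
      pot 1 kerB s (lap f) x + pot 1 kerB s g x := fun s =>
    (isUnitKernel_kerB.pot 1 s).add hl hg x
  have h1 := nonneg_of_pot_nonneg (g := fun y => lap f y + g y) (hl.add hg) one_pos (x := x)
    fun s hs _ => by rw [hP, key s hs]; simp
  have h2 := nonneg_of_pot_nonneg (g := fun y => -(lap f y + g y)) (hl.add hg).neg one_pos (x := x)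
    fun s hs _ => by rw [pot_neg, hP, key s hs]; simp
  linarith

/-- Superharmonic functions converging to a function which is positive at the origin are
bounded below on bounded sets. -/
lemma exists_lower_bound {f : ℕ → Euc N → ℝ} {g : Euc N → ℝ} {M : ℝ}
    (hf : ∀ k, ContDiff ℝ 2 (f k)) (hf0 : ∀ k y, 0 ≤ f k y)
    (hM : ∀ k : ℕ, ∀ y ∈ ball (0 : Euc N) (k + 2), f k y ≤ M)
    (hl : ∀ k : ℕ, ∀ y ∈ ball (0 : Euc N) (k + 2), 0 ≤ -lap (f k) y)
    (ht : ∀ y, Tendsto (fun k => f k y) atTop (𝓝 (g y))) (hg : Continuous g)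
    (hg0 : 0 < g 0) {R : ℝ} (hR : 0 < R) :
    ∃ c : ℝ, 0 < c ∧ ∃ n : ℕ, ∀ k, n ≤ k → ∀ x ∈ ball (0 : Euc N) R, c ≤ f k x := by
  have hg0' : ∀ y, 0 ≤ g y := fun y => ge_of_tendsto' (ht y) fun k => hf0 k y
  have hm : 0 < avg kerA 1 g 0 := avg_kerA_pos hg hg0' hg0 (by simp)
  have hc : ConvOn f g 2 M := ⟨fun k => (hf k).continuous, fun k y hy => by
    rw [abs_of_nonneg (hf0 k y)]
    exact hM k y (ball_subset_ball (by simp) hy), fun y _ => ht y⟩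
  have hev := (hc.tendsto_avg zero_le_one (x := 0) (mem_ball_self (by norm_num))).eventually
    (eventually_gt_nhds (show avg kerA 1 g 0 / 2 < _ by linarith))
  obtain ⟨n, hn⟩ := eventually_atTop.1 hev
  refine ⟨avg kerA 1 g 0 / 2 / (36 * (2 * (R + 1) / 1) ^ N), by positivity,
    max n ⌈R + 2 * (R + 1)⌉₊, fun k hk x hx => ?_⟩
  have h1 := isBallKernel_kerA.avg_le_avg isBallKernel_kerA (hf k).continuous (hf0 k) one_pos
    (x := 0) (x' := x) (s' := 2 * (R + 1)) (by
      rw [mem_ball, dist_zero_right] at hx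
      rw [zero_sub, norm_neg]; linarith)
  have h2 := avg_add_pot_le (hf k) (h := fun _ => 0) continuous_const (t := 2 * (R + 1))
    (by positivity) (x := x) fun y hy => hl k y (closedBall_subset_ball_zero hx (by
      have := Nat.ceil_le.1 ((le_max_right _ _).trans hk)
      linarith) hy)
  have h3 : 0 ≤ pot 1 kerB (2 * (R + 1)) (fun _ => 0) x := pot_kerB_nonneg _ fun _ _ => le_rfl
  have h4 := hn k ((le_max_left _ _).trans hk)
  rw [div_le_iff₀ (by positivity)]
  have h5 : 36 * (2 * (R + 1) / 1) ^ N * avg kerA (2 * (R + 1)) (f k) x ≤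
      36 * (2 * (R + 1) / 1) ^ N * f k x := by
    refine mul_le_mul_of_nonneg_left ?_ (by positivity)
    linarith
  linarith

lemma exists_rpow_mem_Icc {c C : ℝ} (hc : 0 < c) (e : ℝ) :
    ∃ K : ℝ, 1 ≤ K ∧ ∀ y ∈ Icc c C, y ^ e ∈ Icc K⁻¹ K := by
  have hb : ∀ e : ℝ, ∃ K : ℝ, ∀ y ∈ Icc c C, y ^ e ≤ K := fun e => by
    obtain ⟨K, hK⟩ := (isCompact_Icc (a := c) (b := C)).bddAbove_image (f := fun y : ℝ => y ^ e)
      (continuousOn_id.rpow_const fun y hy => Or.inl (hc.trans_le hy.1).ne')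
    exact ⟨K, fun y hy => hK (mem_image_of_mem _ hy)⟩
  obtain ⟨K₁, h₁⟩ := hb e
  obtain ⟨K₂, h₂⟩ := hb (-e)
  refine ⟨max 1 (max K₁ K₂), le_max_left _ _, fun y hy => ⟨?_, ?_⟩⟩
  · have hy0 : 0 < y := hc.trans_le hy.1
    have h3 := h₂ y hy
    rw [Real.rpow_neg hy0.le] at h3
    exact inv_le_of_inv_le₀ (by positivity)
      (h3.trans ((le_max_right _ _).trans (le_max_right _ _)))
  · exact (h₁ y hy).trans ((le_max_left _ _).trans (le_max_right _ _))

lemma mul_mem_Icc_inv {K₁ K₂ y₁ y₂ : ℝ} (h1 : 1 ≤ K₁) (h2 : 1 ≤ K₂) (hy₁ : y₁ ∈ Icc K₁⁻¹ K₁)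
    (hy₂ : y₂ ∈ Icc K₂⁻¹ K₂) : y₁ * y₂ ∈ Icc (K₁ * K₂)⁻¹ (K₁ * K₂) := by
  have p1 : 0 < K₁⁻¹ := by positivity
  have p2 : 0 < K₂⁻¹ := by positivity
  rw [mul_inv]
  exact ⟨mul_le_mul hy₁.1 hy₂.1 p2.le (p1.le.trans hy₁.1),
    mul_le_mul hy₁.2 hy₂.2 (p2.le.trans hy₂.1) (by linarith)⟩

lemma exists_coef_mem_Icc {Λ p c C : ℝ} (hΛ : 1 ≤ Λ) (hp : 0 < p) (hc : 0 < c) (e : ℝ) :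
    ∃ K : ℝ, 1 ≤ K ∧ ∀ A ∈ Icc Λ⁻¹ Λ, ∀ y ∈ Icc c C, p * A * y ^ e ∈ Icc K⁻¹ K := by
  obtain ⟨K, hK, h⟩ := exists_rpow_mem_Icc (C := C) hc e
  have hP : p ∈ Icc (max p p⁻¹)⁻¹ (max p p⁻¹) :=
    ⟨inv_le_of_inv_le₀ hp (le_max_right _ _), le_max_left _ _⟩
  have hP1 : 1 ≤ max p p⁻¹ := by
    rcases le_total 1 p with h | h
    · exact h.trans (le_max_left _ _)
    · exact ((one_le_inv₀ hp).2 h).trans (le_max_right _ _)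
  have h1 : 1 ≤ max p p⁻¹ * Λ := one_le_mul_of_one_le_of_one_le hP1 hΛ
  exact ⟨_, one_le_mul_of_one_le_of_one_le h1 hK, fun A hA y hy =>
    mul_mem_Icc_inv h1 hK (mul_mem_Icc_inv hP1 hΛ hP hA) (h y hy)⟩

lemma Icc_inv_subset {K K' : ℝ} (hK : 1 ≤ K) (h : K ≤ K') : Icc K⁻¹ K ⊆ Icc K'⁻¹ K' :=
  Icc_subset_Icc (inv_anti₀ (by linarith) h) h

/-- A positive solution of `-Δu = A v ^ p`, `-Δv = B u ^ q` in a ball, bounded by `C`, normalized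
at the origin and stable in the ball. -/
structure StableSol (p q C Λ s t ρ : ℝ) (A B u v : Euc N → ℝ) : Prop where
  contDiff₁ : ContDiff ℝ 2 u
  contDiff₂ : ContDiff ℝ 2 v
  nonneg₁ : ∀ y, 0 ≤ u y
  nonneg₂ : ∀ y, 0 ≤ v y
  mem₁ : ∀ y ∈ ball (0 : Euc N) ρ, u y ∈ Ioc 0 C
  mem₂ : ∀ y ∈ ball (0 : Euc N) ρ, v y ∈ Ioc 0 C
  coef₁ : ∀ y ∈ ball (0 : Euc N) ρ, A y ∈ Icc Λ⁻¹ Λ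
  coef₂ : ∀ y ∈ ball (0 : Euc N) ρ, B y ∈ Icc Λ⁻¹ Λ
  eq₁ : ∀ y ∈ ball (0 : Euc N) ρ, -lap u y = A y * v y ^ p
  eq₂ : ∀ y ∈ ball (0 : Euc N) ρ, -lap v y = B y * u y ^ q
  normalized : u 0 ^ s + v 0 ^ t = 1
  stable : ∃ P Q ξ ζ : Euc N → ℝ, ContDiff ℝ 2 P ∧ ContDiff ℝ 2 Q ∧ (∀ y, 0 ≤ P y) ∧
    (∀ y, 0 ≤ Q y) ∧ (∀ y ∈ ball (0 : Euc N) ρ, P y = p * A y * v y ^ (p - 1)) ∧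
    (∀ y ∈ ball (0 : Euc N) ρ, Q y = q * B y * u y ^ (q - 1)) ∧ SuperOn P Q ξ ζ ρ ∧
    0 < ξ 0 ∧ 0 < ζ 0

namespace StableSol

variable {p q C Λ s t ρ : ℝ} {A B u v : Euc N → ℝ}

lemma symm (h : StableSol p q C Λ s t ρ A B u v) : StableSol q p C Λ t s ρ B A v u where
  contDiff₁ := h.contDiff₂
  contDiff₂ := h.contDiff₁
  nonneg₁ := h.nonneg₂
  nonneg₂ := h.nonneg₁
  mem₁ := h.mem₂
  mem₂ := h.mem₁
  coef₁ := h.coef₂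
  coef₂ := h.coef₁
  eq₁ := h.eq₂
  eq₂ := h.eq₁
  normalized := (add_comm _ _).trans h.normalized
  stable := by
    obtain ⟨P, Q, ξ, ζ, hP, hQ, hP0, hQ0, hPe, hQe, hS, hξ, hζ⟩ := h.stable
    exact ⟨Q, P, ζ, ξ, hQ, hP, hQ0, hP0, hQe, hPe,
      ⟨hS.contDiff₂, hS.contDiff₁, hS.nonneg₂, hS.nonneg₁, hS.le₂, hS.le₁⟩, hζ, hξ⟩

lemma mono {ρ' : ℝ} (h : StableSol p q C Λ s t ρ A B u v) (hρ : ρ' ≤ ρ) :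
    StableSol p q C Λ s t ρ' A B u v := by
  have hs : ball (0 : Euc N) ρ' ⊆ ball 0 ρ := ball_subset_ball hρ
  obtain ⟨P, Q, ξ, ζ, hP, hQ, hP0, hQ0, hPe, hQe, hS, hξ, hζ⟩ := h.stable
  exact ⟨h.contDiff₁, h.contDiff₂, h.nonneg₁, h.nonneg₂, fun y hy => h.mem₁ y (hs hy),
    fun y hy => h.mem₂ y (hs hy), fun y hy => h.coef₁ y (hs hy), fun y hy => h.coef₂ y (hs hy),
    fun y hy => h.eq₁ y (hs hy), fun y hy => h.eq₂ y (hs hy), h.normalized,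
    P, Q, ξ, ζ, hP, hQ, hP0, hQ0, fun y hy => hPe y (hs hy), fun y hy => hQe y (hs hy),
    hS.mono hρ, hξ, hζ⟩

lemma abs_lap_le (h : StableSol p q C Λ s t ρ A B u v) (hp : 0 < p) (hΛ : 1 ≤ Λ) {y : Euc N}
    (hy : y ∈ ball (0 : Euc N) ρ) : |lap u y| ≤ Λ * C ^ p := by
  have hA := h.coef₁ y hy
  have hv := h.mem₂ y hy
  have hA0 : 0 ≤ A y := (inv_nonneg.2 (by linarith)).trans hA.1
  rw [← abs_neg, h.eq₁ y hy, abs_of_nonneg (mul_nonneg hA0 (Real.rpow_nonneg hv.1.le _))]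
  exact mul_le_mul hA.2 (Real.rpow_le_rpow hv.1.le hv.2 hp.le) (Real.rpow_nonneg hv.1.le _)
    (by linarith)

lemma norm_fderiv_le (h : StableSol p q C Λ s t (ρ + 1) A B u v) (hp : 0 < p) (hΛ : 1 ≤ Λ)
    {y : Euc N} (hy : y ∈ ball (0 : Euc N) ρ) :
    ‖fderiv ℝ u y‖ ≤ gradConst N * (1⁻¹ * C + 1 * (Λ * C ^ p)) :=
  _root_.norm_fderiv_le h.contDiff₁ one_pos (fun z hz => by
      have hz' := closedBall_subset_ball_zero hy le_rfl hz
      rw [abs_of_pos (h.mem₁ z hz').1]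
      exact (h.mem₁ z hz').2)
    fun z hz => h.abs_lap_le hp hΛ (closedBall_subset_ball_zero hy le_rfl hz)

end StableSol

namespace StableSol

section Limit

variable {p q C Λ s t : ℝ} {A B u v : ℕ → Euc N → ℝ} {U V : Euc N → ℝ}

lemma convOn (h : ∀ k : ℕ, StableSol p q C Λ s t (k + 2) (A k) (B k) (u k) (v k))
    (hu : ∀ y, Tendsto (fun k => u k y) atTop (𝓝 (U y))) {ρ : ℝ} {n : ℕ} (hn : ρ ≤ n) :
    ConvOn (fun k => u (k + n)) U ρ C where
  continuous k := (h _).contDiff₁.continuous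
  bound k y hy := by
    rw [abs_of_nonneg ((h _).nonneg₁ y)]
    refine ((h (k + n)).mem₁ y (ball_subset_ball ?_ hy)).2
    push_cast
    linarith [Nat.cast_nonneg (α := ℝ) k]
  tendsto y _ := (tendsto_add_atTop_iff_nat n).2 (hu y)

lemma convOn_neg_lap (h : ∀ k : ℕ, StableSol p q C Λ s t (k + 2) (A k) (B k) (u k) (v k))
    (hp : 0 < p) (hΛ : 1 ≤ Λ) (hv : ∀ y, Tendsto (fun k => v k y) atTop (𝓝 (V y)))
    (hA : ∀ y, Tendsto (fun k => A k y) atTop (𝓝 1)) {ρ : ℝ} {n : ℕ} (hn : ρ ≤ n) :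
    ConvOn (fun k y => -lap (u (k + n)) y) (fun y => V y ^ p) ρ (Λ * C ^ p) := by
  have hsub : ∀ k : ℕ, ball (0 : Euc N) ρ ⊆ ball 0 ((k + n : ℕ) + 2) := fun k =>
    ball_subset_ball (by push_cast; linarith [Nat.cast_nonneg (α := ℝ) k])
  refine ⟨fun k => (continuous_lap (h _).contDiff₁).neg, fun k y hy => ?_, fun y hy => ?_⟩
  · rw [abs_neg]
    exact (h _).abs_lap_le hp hΛ (hsub k hy)
  · have h1 : Tendsto (fun k => A (k + n) y * v (k + n) y ^ p) atTop (𝓝 (1 * V y ^ p)) :=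
      ((tendsto_add_atTop_iff_nat n).2 (hA y)).mul
        (((tendsto_add_atTop_iff_nat n).2 (hv y)).rpow_const (Or.inr hp.le))
    rw [one_mul] at h1
    exact h1.congr fun k => ((h _).eq₁ y (hsub k hy)).symm

lemma eq_avg_add_pot_of_tendsto
    (h : ∀ k : ℕ, StableSol p q C Λ s t (k + 2) (A k) (B k) (u k) (v k)) (hp : 0 < p)
    (hΛ : 1 ≤ Λ) (hu : ∀ y, Tendsto (fun k => u k y) atTop (𝓝 (U y)))
    (hv : ∀ y, Tendsto (fun k => v k y) atTop (𝓝 (V y)))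
    (hA : ∀ y, Tendsto (fun k => A k y) atTop (𝓝 1)) (r : ℝ) (hr : 0 ≤ r) (x : Euc N) :
    U x = avg kerA r U x + pot 1 kerB r (fun y => V y ^ p) x := by
  obtain ⟨n, hn⟩ := exists_nat_ge (‖x‖ + 1 + r)
  have hx : x ∈ ball (0 : Euc N) (‖x‖ + 1 + r - r) := by
    rw [mem_ball, dist_zero_right]; linarith
  have hx' : x ∈ ball (0 : Euc N) (‖x‖ + 1 + r) := by
    rw [mem_ball, dist_zero_right]; linarith
  have h1 := convOn h hu hn
  have h2 := convOn_neg_lap h hp hΛ hv hA hn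
  refine tendsto_nhds_unique (h1.tendsto x hx')
    (((h1.tendsto_avg hr hx).add (h2.tendsto_pot hx)).congr fun k => ?_)
  rw [pot_neg, ← sub_eq_add_neg]
  exact (eq_avg_sub_pot (h _).contDiff₁ hr x).symm

/-- Convergence and local two-sided bounds of the coefficients of the linearized system. -/
lemma exists_linearized (h : ∀ k : ℕ, StableSol p q C Λ s t (k + 2) (A k) (B k) (u k) (v k))
    (hp : 0 < p) (hq : 0 < q) (hΛ : 1 ≤ Λ) (hu : ∀ y, Tendsto (fun k => u k y) atTop (𝓝 (U y)))
    (hv : ∀ y, Tendsto (fun k => v k y) atTop (𝓝 (V y)))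
    (hA : ∀ y, Tendsto (fun k => A k y) atTop (𝓝 1))
    (hB : ∀ y, Tendsto (fun k => B k y) atTop (𝓝 1)) (hU : ContDiff ℝ 1 U) (hV : ContDiff ℝ 1 V)
    (hU0 : ∀ y, 0 < U y) (hV0 : ∀ y, 0 < V y) {R : ℝ} (hR : 0 < R) :
    ∃ ξ ζ : Euc N → ℝ, ContDiff ℝ 2 ξ ∧ ContDiff ℝ 2 ζ ∧ ∀ y ∈ ball (0 : Euc N) R,
      0 < ξ y ∧ 0 < ζ y ∧ p * V y ^ (p - 1) * ζ y ≤ -lap ξ y ∧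
      q * U y ^ (q - 1) * ξ y ≤ -lap ζ y := by
  obtain ⟨R', hR', H⟩ := exists_super_of_tendsto (N := N) hR
  have lower : ∀ {p q s t : ℝ} {A B u v : ℕ → Euc N → ℝ} {U : Euc N → ℝ},
      (∀ k : ℕ, StableSol p q C Λ s t (k + 2) (A k) (B k) (u k) (v k)) →
      (∀ y, Tendsto (fun k => u k y) atTop (𝓝 (U y))) → ContDiff ℝ 1 U → (∀ y, 0 < U y) →
      ∃ c : ℝ, 0 < c ∧ ∃ n : ℕ, ∀ k, n ≤ k → ∀ x ∈ ball (0 : Euc N) R', c ≤ u k x :=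
    fun h hu hU hU0 => exists_lower_bound (fun k => (h k).contDiff₁) (fun k => (h k).nonneg₁)
      (fun k y hy => ((h k).mem₁ y hy).2) (fun k y hy => by
        rw [(h k).eq₁ y hy]
        exact mul_nonneg ((inv_nonneg.2 (by linarith)).trans ((h k).coef₁ y hy).1)
          (Real.rpow_nonneg ((h k).nonneg₂ y) _)) hu hU.continuous (hU0 0) hR'
  obtain ⟨c₁, hc₁, n₁, hn₁⟩ := lower h hu hU hU0
  obtain ⟨c₂, hc₂, n₂, hn₂⟩ := lower (fun k => (h k).symm) hv hV hV0
  obtain ⟨K₁, hK₁, hb₁⟩ := exists_coef_mem_Icc (C := C) hΛ hp hc₂ (p - 1)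
  obtain ⟨K₂, hK₂, hb₂⟩ := exists_coef_mem_Icc (C := C) hΛ hq hc₁ (q - 1)
  obtain ⟨n₃, hn₃⟩ := exists_nat_ge R'
  set n := max (max n₁ n₂) n₃ with hn
  have hsub : ∀ k : ℕ, ball (0 : Euc N) R' ⊆ ball 0 ((k + n : ℕ) + 2) := fun k =>
    ball_subset_ball (by
      have : (n₃ : ℝ) ≤ n := by exact_mod_cast le_max_right _ _
      push_cast
      linarith [Nat.cast_nonneg (α := ℝ) k])
  choose P Q ξ ζ hP hQ hP0 hQ0 hPe hQe hS hξ hζ using fun k => (h (k + n)).stable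
  refine H (max K₁ K₂) (hK₁.trans (le_max_left _ _)) P Q ξ ζ (fun y => p * V y ^ (p - 1))
    (fun y => q * U y ^ (q - 1)) hP hQ hP0 hQ0 (fun k y hy => ?_) (fun k y hy => ?_)
    (fun k => (hS k).mono ?_) hξ hζ
    (contDiff_const.mul (hV.rpow_const_of_ne fun y => (hV0 y).ne'))
    (contDiff_const.mul (hU.rpow_const_of_ne fun y => (hU0 y).ne')) (fun y hy => ?_) fun y hy => ?_
  · rw [hPe k y (hsub k hy)]
    exact Icc_inv_subset hK₁ (le_max_left _ _) (hb₁ _ ((h _).coef₁ y (hsub k hy)) _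
      ⟨hn₂ _ ((le_max_right _ _).trans ((le_max_left _ _).trans (Nat.le_add_left _ _))) y hy,
        ((h _).mem₂ y (hsub k hy)).2⟩)
  · rw [hQe k y (hsub k hy)]
    exact Icc_inv_subset hK₂ (le_max_right _ _) (hb₂ _ ((h _).coef₂ y (hsub k hy)) _
      ⟨hn₁ _ ((le_max_left _ _).trans ((le_max_left _ _).trans (Nat.le_add_left _ _))) y hy,
        ((h _).mem₁ y (hsub k hy)).2⟩)
  · have : (n₃ : ℝ) ≤ n := by exact_mod_cast le_max_right _ _
    push_cast
    linarith [Nat.cast_nonneg (α := ℝ) k]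
  · have h1 : Tendsto (fun k => p * A (k + n) y * v (k + n) y ^ (p - 1)) atTop
        (𝓝 (p * 1 * V y ^ (p - 1))) :=
      (((tendsto_add_atTop_iff_nat n).2 (hA y)).const_mul p).mul
        (((tendsto_add_atTop_iff_nat n).2 (hv y)).rpow_const (Or.inl (hV0 y).ne'))
    rw [mul_one] at h1
    exact h1.congr fun k => (hPe k y (hsub k hy)).symm
  · have h1 : Tendsto (fun k => q * B (k + n) y * u (k + n) y ^ (q - 1)) atTop
        (𝓝 (q * 1 * U y ^ (q - 1))) :=
      (((tendsto_add_atTop_iff_nat n).2 (hB y)).const_mul q).mul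
        (((tendsto_add_atTop_iff_nat n).2 (hu y)).rpow_const (Or.inl (hU0 y).ne'))
    rw [mul_one] at h1
    exact h1.congr fun k => (hQe k y (hsub k hy)).symm

/-- The limit of stable solutions is an entire stable solution of the Lane–Emden system. -/
lemma exists_entire_of_tendsto
    (h : ∀ k : ℕ, StableSol p q C Λ s t (k + 2) (A k) (B k) (u k) (v k)) (hp : 0 < p) (hq : 0 < q)
    (hs : 0 < s) (ht : 0 < t) (hΛ : 1 ≤ Λ)
    (hu : ∀ y, Tendsto (fun k => u k y) atTop (𝓝 (U y)))
    (hv : ∀ y, Tendsto (fun k => v k y) atTop (𝓝 (V y)))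
    (hA : ∀ y, Tendsto (fun k => A k y) atTop (𝓝 1))
    (hB : ∀ y, Tendsto (fun k => B k y) atTop (𝓝 1)) (hU : Continuous U) (hV : Continuous V) :
    ContDiff ℝ (⊤ : ℕ∞) U ∧ ContDiff ℝ (⊤ : ℕ∞) V ∧ (∀ x, 0 < U x) ∧ (∀ x, 0 < V x) ∧
      (∃ M : ℝ, ∀ x, U x ≤ M ∧ V x ≤ M) ∧ IsLESol p q U V ∧
      ∀ Ω : Set (Euc N), IsOpen Ω → Bornology.IsBounded Ω → LEStableOn p q U V Ω := by
  have idU := eq_avg_add_pot_of_tendsto h hp hΛ hu hv hA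
  have idV := eq_avg_add_pot_of_tendsto (fun k => (h k).symm) hq hΛ hv hu hB
  have hU0 : ∀ y, 0 ≤ U y := fun y => ge_of_tendsto' (hu y) fun k => (h k).nonneg₁ y
  have hV0 : ∀ y, 0 ≤ V y := fun y => ge_of_tendsto' (hv y) fun k => (h k).nonneg₂ y
  have hVp : Continuous fun y => V y ^ p := hV.rpow_const fun _ => Or.inr hp.le
  have hUq : Continuous fun y => U y ^ q := hU.rpow_const fun _ => Or.inr hq.le
  have hnorm : U 0 ^ s + V 0 ^ t = 1 := tendsto_nhds_unique
    (((hu 0).rpow_const (Or.inr hs.le)).add ((hv 0).rpow_const (Or.inr ht.le)))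
    (tendsto_const_nhds.congr fun k => (h k).normalized.symm)
  have hne : ¬ (U 0 = 0 ∧ V 0 = 0) := by
    rintro ⟨h1, h2⟩
    rw [h1, h2, Real.zero_rpow hs.ne', Real.zero_rpow ht.ne'] at hnorm
    norm_num at hnorm
  have hUpos : ∀ x, 0 < U x := fun x => by
    refine lt_of_le_of_ne (hU0 x) fun h0 => hne ?_
    obtain ⟨h1, h2⟩ := eq_zero_of_eq_avg_add_pot hU hVp hU0
      (fun y => Real.rpow_nonneg (hV0 y) p) idU h0.symm
    exact ⟨h1 0, ((Real.rpow_eq_zero (hV0 0) hp.ne').1 (h2 0))⟩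
  have hVpos : ∀ x, 0 < V x := fun x => by
    refine lt_of_le_of_ne (hV0 x) fun h0 => hne ?_
    obtain ⟨h1, h2⟩ := eq_zero_of_eq_avg_add_pot hV hUq hV0
      (fun y => Real.rpow_nonneg (hU0 y) q) idV h0.symm
    exact ⟨((Real.rpow_eq_zero (hU0 0) hq.ne').1 (h2 0)), h1 0⟩
  have smooth : ∀ n : ℕ, ContDiff ℝ n U ∧ ContDiff ℝ n V := fun n => by
    induction n with
    | zero => exact ⟨contDiff_zero.2 hU, contDiff_zero.2 hV⟩
    | succ n ih =>
      have e1 : U = fun x => avg kerA 1 U x + pot 1 kerB 1 (fun y => V y ^ p) x :=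
        funext (idU 1 zero_le_one)
      have e2 : V = fun x => avg kerA 1 V x + pot 1 kerB 1 (fun y => U y ^ q) x :=
        funext (idV 1 zero_le_one)
      refine ⟨?_, ?_⟩
      · rw [e1]
        exact (contDiff_avg_succ isUnitKernel_kerA isUnitKernel_kerA' hasFDerivAt_kerA ih.1
          one_pos).add (contDiff_pot_succ isUnitKernel_kerB isUnitKernel_kerB' hasFDerivAt_kerB
          (ih.2.rpow_const_of_ne fun y => (hVpos y).ne') zero_le_one)
      · rw [e2]
        exact (contDiff_avg_succ isUnitKernel_kerA isUnitKernel_kerA' hasFDerivAt_kerA ih.2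
          one_pos).add (contDiff_pot_succ isUnitKernel_kerB isUnitKernel_kerB' hasFDerivAt_kerB
          (ih.1.rpow_const_of_ne fun y => (hUpos y).ne') zero_le_one)
  have hU2 : ContDiff ℝ 2 U := by exact_mod_cast (smooth 2).1
  have hV2 : ContDiff ℝ 2 V := by exact_mod_cast (smooth 2).2
  refine ⟨contDiff_infty.2 fun n => (smooth n).1, contDiff_infty.2 fun n => (smooth n).2, hUpos,
    hVpos, ⟨C, fun x => ⟨?_, ?_⟩⟩, ⟨fun x => ?_, fun x => ?_⟩, fun Ω _ hΩ => ?_⟩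
  · refine le_of_tendsto (hu x) ?_
    filter_upwards [eventually_ge_atTop ⌈‖x‖⌉₊] with k hk
    refine ((h k).mem₁ x ?_).2
    rw [mem_ball, dist_zero_right]
    linarith [Nat.ceil_le.1 hk]
  · refine le_of_tendsto (hv x) ?_
    filter_upwards [eventually_ge_atTop ⌈‖x‖⌉₊] with k hk
    refine ((h k).mem₂ x ?_).2
    rw [mem_ball, dist_zero_right]
    linarith [Nat.ceil_le.1 hk]
  · rw [neg_lap_eq_of_eq_avg_add_pot hU2 hVp idU, abs_of_pos (hVpos x),
      ← Real.rpow_add_one (hVpos x).ne', sub_add_cancel]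
  · rw [neg_lap_eq_of_eq_avg_add_pot hV2 hUq idV, abs_of_pos (hUpos x),
      ← Real.rpow_add_one (hUpos x).ne', sub_add_cancel]
  · obtain ⟨R, hR, hsub⟩ := hΩ.subset_ball_lt 0 0
    obtain ⟨ξ, ζ, hξ, hζ, H⟩ := exists_linearized h hp hq hΛ hu hv hA hB
      (hU2.of_le one_le_two) (hV2.of_le one_le_two) hUpos hVpos hR
    exact ⟨ξ, ζ, hξ.contDiffOn, hζ.contDiffOn, fun x hx => (H x (hsub hx)).1,
      fun x hx => (H x (hsub hx)).2.1, fun x hx => (H x (hsub hx)).2.2.1,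
      fun x hx => (H x (hsub hx)).2.2.2⟩

/-- If there are normalized stable solutions in arbitrarily large balls, with coefficients
converging to `1`, then the Lane–Emden system has an entire bounded stable solution. -/
lemma exists_entire (h : ∀ k : ℕ, StableSol p q C Λ s t (k + 2) (A k) (B k) (u k) (v k))
    (hp : 0 < p) (hq : 0 < q) (hs : 0 < s) (ht : 0 < t) (hΛ : 1 ≤ Λ)
    (hA : ∀ y, Tendsto (fun k => A k y) atTop (𝓝 1))
    (hB : ∀ y, Tendsto (fun k => B k y) atTop (𝓝 1)) :
    ∃ U V : Euc N → ℝ, ContDiff ℝ (⊤ : ℕ∞) U ∧ ContDiff ℝ (⊤ : ℕ∞) V ∧ (∀ x, 0 < U x) ∧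
      (∀ x, 0 < V x) ∧ (∃ M : ℝ, ∀ x, U x ≤ M ∧ V x ≤ M) ∧ IsLESol p q U V ∧
      ∀ Ω : Set (Euc N), IsOpen Ω → Bornology.IsBounded Ω → LEStableOn p q U V Ω := by
  have hsub : ∀ k : ℕ, (0 : Euc N) ∈ ball (0 : Euc N) (k + 2) := fun k =>
    mem_ball_self (by positivity)
  have sub : ∀ {p q s t : ℝ} {A B u v : ℕ → Euc N → ℝ}, 0 < p →
      (∀ k : ℕ, StableSol p q C Λ s t (k + 2) (A k) (B k) (u k) (v k)) →
      ∃ (φ : ℕ → ℕ) (U : Euc N → ℝ), StrictMono φ ∧ Continuous U ∧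
        ∀ y, Tendsto (fun k => u (φ k) y) atTop (𝓝 (U y)) := by
    intro p q s t A B u v hp h
    have hC : 0 ≤ C := ((h 0).mem₁ 0 (hsub 0)).1.le.trans ((h 0).mem₁ 0 (hsub 0)).2
    refine exists_subseq_tendsto_of_fderiv (M := C)
      (L := gradConst N * (1⁻¹ * C + 1 * (Λ * C ^ p)))
      (mul_nonneg (gradConst_nonneg N) (by positivity))
      (fun k => (h k).contDiff₁.differentiable two_ne_zero) (fun k => ?_) fun k y hy => ?_
    · rw [abs_of_nonneg ((h k).nonneg₁ 0)]
      exact ((h k).mem₁ 0 (hsub k)).2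
    · exact ((h k).mono (by linarith)).norm_fderiv_le hp hΛ hy
  obtain ⟨φ, U, hφ, hU, hu⟩ := sub hp h
  have h' : ∀ k : ℕ, StableSol p q C Λ s t (k + 2) (A (φ k)) (B (φ k)) (u (φ k)) (v (φ k)) :=
    fun k => (h (φ k)).mono (by
      have : (k : ℝ) ≤ φ k := by exact_mod_cast hφ.le_apply
      linarith)
  obtain ⟨ψ, V, hψ, hV, hv⟩ := sub hq fun k => (h' k).symm
  have h'' := fun k => (h' (ψ k)).mono (ρ' := k + 2) (by
      have : (k : ℝ) ≤ ψ k := by exact_mod_cast hψ.le_apply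
      linarith)
  have hφψ := hφ.tendsto_atTop.comp hψ.tendsto_atTop
  exact ⟨U, V, exists_entire_of_tendsto h'' hp hq hs ht hΛ
    (fun y => (hu y).comp hψ.tendsto_atTop) hv (fun y => (hA y).comp hφψ)
    (fun y => (hB y).comp hφψ) hU hV⟩

end Limit

end StableSol

/-- A normalized positive stable solution of the rescaled Hénon–Lane–Emden system
`-Δu = |e + τ z| ^ a v ^ p`, `-Δv = |e + τ z| ^ b u ^ q` in a ball. -/
structure ScaledSol (p q a b C s t r : ℝ) (e : Euc N) (τ : ℝ) (u v : Euc N → ℝ) : Prop where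
  norm_eq : ‖e‖ = 1
  nonneg : 0 ≤ τ
  mul_le : τ * r ≤ 1 / 2
  contDiffOn₁ : ContDiffOn ℝ 2 u (ball 0 r)
  contDiffOn₂ : ContDiffOn ℝ 2 v (ball 0 r)
  mem₁ : ∀ y ∈ ball (0 : Euc N) r, u y ∈ Ioc 0 C
  mem₂ : ∀ y ∈ ball (0 : Euc N) r, v y ∈ Ioc 0 C
  eq₁ : ∀ y ∈ ball (0 : Euc N) r, -lap u y = ‖e + τ • y‖ ^ a * v y ^ p
  eq₂ : ∀ y ∈ ball (0 : Euc N) r, -lap v y = ‖e + τ • y‖ ^ b * u y ^ q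
  normalized : u 0 ^ s + v 0 ^ t = 1
  stable : ∃ ξ ζ : Euc N → ℝ, ContDiffOn ℝ 2 ξ (ball 0 r) ∧ ContDiffOn ℝ 2 ζ (ball 0 r) ∧
    (∀ y ∈ ball (0 : Euc N) r, 0 < ξ y) ∧ (∀ y ∈ ball (0 : Euc N) r, 0 < ζ y) ∧
    (∀ y ∈ ball (0 : Euc N) r, p * ‖e + τ • y‖ ^ a * v y ^ (p - 1) * ζ y ≤ -lap ξ y) ∧
    (∀ y ∈ ball (0 : Euc N) r, q * ‖e + τ • y‖ ^ b * u y ^ (q - 1) * ξ y ≤ -lap ζ y)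

lemma abs_norm_add_smul_sub_one_le {e : Euc N} (he : ‖e‖ = 1) {τ : ℝ} (hτ : 0 ≤ τ) (y : Euc N) :
    |‖e + τ • y‖ - 1| ≤ τ * ‖y‖ := by
  have h := abs_norm_sub_norm_le (e + τ • y) e
  rwa [he, add_sub_cancel_left, norm_smul, Real.norm_of_nonneg hτ] at h

lemma norm_add_smul_mem_Icc {e : Euc N} (he : ‖e‖ = 1) {τ r : ℝ} (hτ : 0 ≤ τ)
    (hr : τ * r ≤ 1 / 2) {y : Euc N} (hy : y ∈ ball (0 : Euc N) r) :
    ‖e + τ • y‖ ∈ Icc (1 / 2 : ℝ) (3 / 2) := by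
  rw [mem_ball, dist_zero_right] at hy
  have h1 := abs_le.1 (abs_norm_add_smul_sub_one_le he hτ y)
  have h2 : τ * ‖y‖ ≤ τ * r := by gcongr
  exact ⟨by linarith, by linarith⟩

namespace ScaledSol

variable {p q a b C s t r : ℝ} {e : Euc N} {τ : ℝ} {u v : Euc N → ℝ}

lemma exists_stableSol {Λ : ℝ} (hp : 0 < p) (hq : 0 < q)
    (hΛ₁ : ∀ y ∈ Icc (1 / 2 : ℝ) (3 / 2), y ^ a ∈ Icc Λ⁻¹ Λ)
    (hΛ₂ : ∀ y ∈ Icc (1 / 2 : ℝ) (3 / 2), y ^ b ∈ Icc Λ⁻¹ Λ)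
    (h : ScaledSol p q a b C s t r e τ u v) {ρ : ℝ} (hρ : 0 < ρ) (hρr : ρ < r) :
    ∃ U V : Euc N → ℝ, StableSol p q C Λ s t ρ (fun y => ‖e + τ • y‖ ^ a)
      (fun y => ‖e + τ • y‖ ^ b) U V := by
  obtain ⟨ξ, ζ, hξ, hζ, hξ0, hζ0, hle₁, hle₂⟩ := h.stable
  have hn : ∀ y ∈ ball (0 : Euc N) r, ‖e + τ • y‖ ∈ Icc (1 / 2 : ℝ) (3 / 2) := fun y hy =>
    norm_add_smul_mem_Icc h.norm_eq h.nonneg h.mul_le hy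
  have hn0 : ∀ y ∈ ball (0 : Euc N) r, 0 < ‖e + τ • y‖ := fun y hy => by
    have := (hn y hy).1
    linarith
  have hcoef : ∀ (p a : ℝ) {v : Euc N → ℝ}, ContDiffOn ℝ 2 v (ball 0 r) →
      (∀ y ∈ ball (0 : Euc N) r, v y ∈ Ioc 0 C) →
      ContDiffOn ℝ 2 (fun y => p * ‖e + τ • y‖ ^ a * v y ^ (p - 1)) (ball 0 r) := by
    intro p a v hv hv0
    have h1 : ContDiff ℝ 2 fun y : Euc N => e + τ • y := by fun_prop
    have h2 : ContDiffOn ℝ 2 (fun y : Euc N => ‖e + τ • y‖) (ball 0 r) :=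
      h1.contDiffOn.norm ℝ fun y hy => norm_pos_iff.1 (hn0 y hy)
    exact (contDiffOn_const.mul (h2.rpow_const_of_ne fun y hy => (hn0 y hy).ne')).mul
      (hv.rpow_const_of_ne fun y hy => (hv0 y hy).1.ne')
  obtain ⟨U, hU, eU, pU⟩ := exists_contDiff_eq hρ hρr h.contDiffOn₁
  obtain ⟨V, hV, eV, pV⟩ := exists_contDiff_eq hρ hρr h.contDiffOn₂
  obtain ⟨X, hX, eX, pX⟩ := exists_contDiff_eq hρ hρr hξ
  obtain ⟨Z, hZ, eZ, pZ⟩ := exists_contDiff_eq hρ hρr hζ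
  obtain ⟨P, hP, eP, pP⟩ := exists_contDiff_eq hρ hρr (hcoef p a h.contDiffOn₂ h.mem₂)
  obtain ⟨Q, hQ, eQ, pQ⟩ := exists_contDiff_eq hρ hρr (hcoef q b h.contDiffOn₁ h.mem₁)
  have hs : ball (0 : Euc N) ρ ⊆ ball 0 r := ball_subset_ball hρr.le
  have hs' : ball (0 : Euc N) ρ ⊆ closedBall 0 ρ := ball_subset_closedBall
  have h0 : (0 : Euc N) ∈ ball (0 : Euc N) ρ := mem_ball_self hρ
  have vU : ∀ y ∈ ball (0 : Euc N) ρ, U y = u y := fun y hy => (eU y (hs' hy)).eq_of_nhds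
  have vV : ∀ y ∈ ball (0 : Euc N) ρ, V y = v y := fun y hy => (eV y (hs' hy)).eq_of_nhds
  have vX : ∀ y ∈ ball (0 : Euc N) ρ, X y = ξ y := fun y hy => (eX y (hs' hy)).eq_of_nhds
  have vZ : ∀ y ∈ ball (0 : Euc N) ρ, Z y = ζ y := fun y hy => (eZ y (hs' hy)).eq_of_nhds
  have vP : ∀ y ∈ ball (0 : Euc N) ρ, P y = p * ‖e + τ • y‖ ^ a * v y ^ (p - 1) :=
    fun y hy => (eP y (hs' hy)).eq_of_nhds
  have vQ : ∀ y ∈ ball (0 : Euc N) ρ, Q y = q * ‖e + τ • y‖ ^ b * u y ^ (q - 1) :=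
    fun y hy => (eQ y (hs' hy)).eq_of_nhds
  refine ⟨U, V, ?_⟩
  exact {
    contDiff₁ := hU
    contDiff₂ := hV
    nonneg₁ := pU fun y hy => (h.mem₁ y hy).1.le
    nonneg₂ := pV fun y hy => (h.mem₂ y hy).1.le
    mem₁ := fun y hy => vU y hy ▸ h.mem₁ y (hs hy)
    mem₂ := fun y hy => vV y hy ▸ h.mem₂ y (hs hy)
    coef₁ := fun y hy => hΛ₁ _ (hn y (hs hy))
    coef₂ := fun y hy => hΛ₂ _ (hn y (hs hy))
    eq₁ := fun y hy => by rw [lap_congr (eU y (hs' hy)), vV y hy, h.eq₁ y (hs hy)]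
    eq₂ := fun y hy => by rw [lap_congr (eV y (hs' hy)), vU y hy, h.eq₂ y (hs hy)]
    normalized := by rw [vU 0 h0, vV 0 h0, h.normalized]
    stable := ⟨P, Q, X, Z, hP, hQ,
      pP fun y hy => mul_nonneg (mul_nonneg hp.le (Real.rpow_nonneg (norm_nonneg _) _))
        (Real.rpow_nonneg (h.mem₂ y hy).1.le _),
      pQ fun y hy => mul_nonneg (mul_nonneg hq.le (Real.rpow_nonneg (norm_nonneg _) _))
        (Real.rpow_nonneg (h.mem₁ y hy).1.le _),
      fun y hy => by rw [vP y hy, vV y hy], fun y hy => by rw [vQ y hy, vU y hy],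
      ⟨hX, hZ, pX fun y hy => (hξ0 y hy).le, pZ fun y hy => (hζ0 y hy).le,
        fun y hy => by
          rw [lap_congr (eX y (hs' hy)), vP y hy, vZ y hy]; exact hle₁ y (hs hy),
        fun y hy => by
          rw [lap_congr (eZ y (hs' hy)), vQ y hy, vX y hy]; exact hle₂ y (hs hy)⟩,
      by rw [vX 0 h0]; exact hξ0 0 (hs h0), by rw [vZ 0 h0]; exact hζ0 0 (hs h0)⟩ }

/-- Rescaled solutions in arbitrarily large balls give rise to an entire bounded stable solution
of the Lane–Emden system. -/
lemma exists_entire (hp : 0 < p) (hq : 0 < q) (hs : 0 < s) (ht : 0 < t)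
    (h : ∀ R : ℝ, ∃ r, R ≤ r ∧ ∃ (e : Euc N) (τ : ℝ) (u v : Euc N → ℝ),
      ScaledSol p q a b C s t r e τ u v) :
    ∃ U V : Euc N → ℝ, ContDiff ℝ (⊤ : ℕ∞) U ∧ ContDiff ℝ (⊤ : ℕ∞) V ∧ (∀ x, 0 < U x) ∧
      (∀ x, 0 < V x) ∧ (∃ M : ℝ, ∀ x, U x ≤ M ∧ V x ≤ M) ∧ IsLESol p q U V ∧
      ∀ Ω : Set (Euc N), IsOpen Ω → Bornology.IsBounded Ω → LEStableOn p q U V Ω := by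
  obtain ⟨K₁, hK₁, h₁⟩ := exists_rpow_mem_Icc (c := 1 / 2) (C := 3 / 2) (by norm_num) a
  obtain ⟨K₂, hK₂, h₂⟩ := exists_rpow_mem_Icc (c := 1 / 2) (C := 3 / 2) (by norm_num) b
  choose r hr e τ u v hsol using fun k : ℕ => h (k + 3)
  have hr0 : ∀ k, 0 < r k := fun k => by linarith [hr k, Nat.cast_nonneg (α := ℝ) k]
  choose U V hUV using fun k : ℕ => (hsol k).exists_stableSol (Λ := max K₁ K₂) (ρ := k + 2) hp hq
    (fun y hy => Icc_inv_subset hK₁ (le_max_left _ _) (h₁ y hy))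
    (fun y hy => Icc_inv_subset hK₂ (le_max_right _ _) (h₂ y hy)) (by positivity)
    (by linarith [hr k])
  have hτ : Tendsto τ atTop (𝓝 0) := by
    refine squeeze_zero (fun k => (hsol k).nonneg) (fun k => ?_)
      tendsto_one_div_add_atTop_nhds_zero_nat
    rw [le_div_iff₀ (by positivity)]
    have h1 := (hsol k).mul_le
    have h2 : τ k * (k + 1) ≤ τ k * r k :=
      mul_le_mul_of_nonneg_left (by linarith [hr k]) (hsol k).nonneg
    linarith
  have hlim : ∀ (a : ℝ) (y : Euc N), Tendsto (fun k => ‖e k + τ k • y‖ ^ a) atTop (𝓝 1) := by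
    intro a y
    have h1 : Tendsto (fun k => ‖e k + τ k • y‖) atTop (𝓝 1) := by
      rw [tendsto_iff_dist_tendsto_zero]
      refine squeeze_zero (fun _ => dist_nonneg)
        (fun k => abs_norm_add_smul_sub_one_le (hsol k).norm_eq (hsol k).nonneg y) ?_
      simpa using hτ.mul_const ‖y‖
    simpa using h1.rpow_const (p := a) (Or.inl one_ne_zero)
  exact StableSol.exists_entire hUV hp hq hs ht (hK₁.trans (le_max_left _ _)) (hlim a) (hlim b)

end ScaledSol

/-- A positive solution of the Hénon–Lane–Emden system outside a closed ball, stable on every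
open set compactly contained in that exterior domain. -/
structure StableOutside (p q a b R : ℝ) (u v : Euc N → ℝ) : Prop where
  contDiffOn₁ : ContDiffOn ℝ 2 u (closedBall (0 : Euc N) R)ᶜ
  contDiffOn₂ : ContDiffOn ℝ 2 v (closedBall (0 : Euc N) R)ᶜ
  pos₁ : ∀ x ∉ closedBall (0 : Euc N) R, 0 < u x
  pos₂ : ∀ x ∉ closedBall (0 : Euc N) R, 0 < v x
  eq₁ : ∀ x ∉ closedBall (0 : Euc N) R, -lap u x = ‖x‖ ^ a * v x ^ p
  eq₂ : ∀ x ∉ closedBall (0 : Euc N) R, -lap v x = ‖x‖ ^ b * u x ^ q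
  stable : ∀ Ω : Set (Euc N), IsOpen Ω → IsCompact (closure Ω) →
    closure Ω ⊆ (closedBall (0 : Euc N) R)ᶜ → HLEStableOn p q a b u v Ω

lemma StableOutside.symm {p q a b R : ℝ} {u v : Euc N → ℝ} (h : StableOutside p q a b R u v) :
    StableOutside q p b a R v u where
  contDiffOn₁ := h.contDiffOn₂
  contDiffOn₂ := h.contDiffOn₁
  pos₁ := h.pos₂
  pos₂ := h.pos₁
  eq₁ := h.eq₂
  eq₂ := h.eq₁
  stable Ω h1 h2 h3 := by
    obtain ⟨ξ, ζ, hξ, hζ, hξ0, hζ0, hle₁, hle₂⟩ := h.stable Ω h1 h2 h3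
    exact ⟨ζ, ξ, hζ, hξ, hζ0, hξ0, hle₂, hle₁⟩

/-- The quantity `(|x| ^ γ₁ u) ^ (1 / α) + (|x| ^ γ₂ v) ^ (1 / β)` whose decay rate is
controlled by the blow-up argument. -/
def blowUpRate (α β γ₁ γ₂ : ℝ) (u v : Euc N → ℝ) (x : Euc N) : ℝ :=
  (‖x‖ ^ γ₁ * u x) ^ α⁻¹ + (‖x‖ ^ γ₂ * v x) ^ β⁻¹

/-- Point selection for the blow-up argument. -/
lemma exists_doubling_point {M : Euc N → ℝ} {x₀ : Euc N} {d : ℝ} (hd : 0 < d)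
    (hM : ContinuousOn M (closedBall x₀ d)) (h0 : ∀ x ∈ closedBall x₀ d, 0 < M x) :
    ∃ y, dist y x₀ < d ∧ M x₀ * d ≤ M y * (d - dist y x₀) ∧
      ∀ x ∈ ball y ((d - dist y x₀) / 2), M x ≤ 2 * M y := by
  have hc : ContinuousOn (fun x => M x * (d - dist x x₀)) (closedBall x₀ d) := by fun_prop
  obtain ⟨y, hy, hmax⟩ := (isCompact_closedBall x₀ d).exists_isMaxOn
    ⟨x₀, mem_closedBall_self hd.le⟩ hc
  rw [isMaxOn_iff] at hmax
  have h1 := hmax x₀ (mem_closedBall_self hd.le)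
  rw [dist_self, sub_zero] at h1
  have hy0 := h0 y hy
  have hx0 := h0 x₀ (mem_closedBall_self hd.le)
  have hD : 0 < d - dist y x₀ := by
    by_contra hneg
    have := mul_nonpos_of_nonneg_of_nonpos hy0.le (not_lt.1 hneg)
    nlinarith [mul_pos hx0 hd]
  refine ⟨y, by linarith, h1, fun x hx => ?_⟩
  rw [mem_ball] at hx
  have h2 := dist_triangle x y x₀
  have hx' : x ∈ closedBall x₀ d := by
    rw [mem_closedBall]
    linarith
  have h3 := hmax x hx'
  have h4 : M x * ((d - dist y x₀) / 2) ≤ M x * (d - dist x x₀) :=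
    mul_le_mul_of_nonneg_left (by linarith) (h0 x hx').le
  nlinarith

lemma rpow_mul_scale_rpow {p a α β γ₁ γ₂ Y l n : ℝ} (hY : 0 < Y) (hl : 0 < l) (hn : 0 ≤ n)
    (h1 : p * β = α + 2) (h2 : p * γ₂ = γ₁ + a) :
    n ^ a * (Y ^ γ₂ * l ^ β) ^ p = Y ^ γ₁ * l ^ α * l ^ 2 * (Y * n) ^ a := by
  rw [Real.mul_rpow (by positivity) (by positivity), ← Real.rpow_mul hY.le, ← Real.rpow_mul hl.le,
    mul_comm γ₂, mul_comm β, h1, h2, Real.rpow_add hY, Real.rpow_add hl, Real.rpow_two,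
    Real.mul_rpow hY.le hn]
  ring

lemma scale_mul_le {α γ Y l n K w : ℝ} (hα : 0 < α) (hY : 0 < Y) (hl : 0 < l) (hn : 0 < n)
    (hw : 0 < w) (hK : n ^ (-γ) ≤ K) (h : ((Y * n) ^ γ * w) ^ α⁻¹ ≤ 2 / l) :
    Y ^ γ * l ^ α * w ≤ K * 2 ^ α := by
  have h1 : (Y * n) ^ γ * w ≤ (2 / l) ^ α := by
    have h2 : 0 ≤ (Y * n) ^ γ * w := by positivity
    have := Real.rpow_le_rpow (by positivity) h hα.le
    rwa [← Real.rpow_mul h2, inv_mul_cancel₀ hα.ne', Real.rpow_one] at this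
  rw [Real.div_rpow (by norm_num) hl.le, le_div_iff₀ (by positivity),
    Real.mul_rpow hY.le hn.le] at h1
  have h3 : n ^ (-γ) * n ^ γ = 1 := by rw [← Real.rpow_add hn]; simp
  calc Y ^ γ * l ^ α * w = n ^ (-γ) * n ^ γ * (Y ^ γ * l ^ α * w) := by rw [h3, one_mul]
    _ = n ^ (-γ) * (Y ^ γ * n ^ γ * w * l ^ α) := by ring
    _ ≤ K * 2 ^ α := by gcongr; exact (by positivity : (0:ℝ) ≤ n ^ (-γ)).trans hK

lemma scale_mul_rpow {α γ Y l w : ℝ} (hα : 0 < α) (hY : 0 < Y) (hl : 0 < l) (hw : 0 < w) :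
    (Y ^ γ * l ^ α * w) ^ α⁻¹ = l * (Y ^ γ * w) ^ α⁻¹ := by
  rw [show Y ^ γ * l ^ α * w = l ^ α * (Y ^ γ * w) by ring,
    Real.mul_rpow (by positivity) (by positivity), ← Real.rpow_mul hl.le,
    mul_inv_cancel₀ hα.ne', Real.rpow_one]

section
variable {p q a b α β γ₁ γ₂ : ℝ}

lemma StableOutside.scaledSol {R K₁ K₂ : ℝ} {u v : Euc N → ℝ}
    (h : StableOutside p q a b R u v) (hα : 0 < α) (hβ : 0 < β)
    (h₁ : p * β = α + 2) (h₂ : q * α = β + 2) (h₃ : p * γ₂ = γ₁ + a) (h₄ : q * γ₁ = γ₂ + b)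
    (hK₁ : ∀ n ∈ Icc (1 / 2 : ℝ) (3 / 2), n ^ (-γ₁) ≤ K₁)
    (hK₂ : ∀ n ∈ Icc (1 / 2 : ℝ) (3 / 2), n ^ (-γ₂) ≤ K₂)
    {y : Euc N} (hy : y ≠ 0) {l r : ℝ} (hl : 0 < l) (hr : l * r ≤ ‖y‖ / 2)
    (hsub : closedBall y (l * r) ⊆ (closedBall 0 R)ᶜ) (hr0 : 0 < r)
    (hle : ∀ x ∈ ball y (l * r), blowUpRate α β γ₁ γ₂ u v x ≤ 2 / l)
    (heq : l * blowUpRate α β γ₁ γ₂ u v y = 1) :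
    ScaledSol p q a b (max (K₁ * 2 ^ α) (K₂ * 2 ^ β)) α⁻¹ β⁻¹ r (‖y‖⁻¹ • y) (l / ‖y‖)
      (fun z => ‖y‖ ^ γ₁ * l ^ α * u (y + l • z)) (fun z => ‖y‖ ^ γ₂ * l ^ β * v (y + l • z)) := by
  have hY : 0 < ‖y‖ := norm_pos_iff.2 hy
  have he : ‖‖y‖⁻¹ • y‖ = 1 := norm_smul_inv_norm hy
  have hτ : 0 ≤ l / ‖y‖ := by positivity
  have hτr : l / ‖y‖ * r ≤ 1 / 2 := by
    rw [div_mul_eq_mul_div, div_le_iff₀ hY]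
    linarith
  have hmaps : ∀ z ∈ ball (0 : Euc N) r, y + l • z ∈ ball y (l * r) := fun z hz => by
    rw [mem_ball, dist_zero_right] at hz
    rw [mem_ball, dist_eq_norm, add_sub_cancel_left, norm_smul, Real.norm_of_nonneg hl.le]
    gcongr
  have hsub' : ball y (l * r) ⊆ (closedBall 0 R)ᶜ := ball_subset_closedBall.trans hsub
  have hnorm : ∀ z, ‖y + l • z‖ = ‖y‖ * ‖‖y‖⁻¹ • y + (l / ‖y‖) • z‖ := fun z => by
    rw [← norm_smul_of_nonneg hY.le, smul_add, smul_smul, smul_smul, mul_inv_cancel₀ hY.ne',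
      one_smul, mul_div_cancel₀ _ hY.ne']
  have hmem := fun z (hz : z ∈ ball (0 : Euc N) r) => norm_add_smul_mem_Icc he hτ hτr hz
  have hcd : ∀ (A : ℝ) {f : Euc N → ℝ}, ContDiffOn ℝ 2 f (ball y (l * r)) →
      ContDiffOn ℝ 2 (fun z => A * f (y + l • z)) (ball 0 r) := fun A f hf =>
    contDiffOn_const.mul (hf.comp (by fun_prop) hmaps)
  have hlap : ∀ (A : ℝ) {f : Euc N → ℝ}, ContDiffOn ℝ 2 f (ball y (l * r)) →
      ∀ z ∈ ball (0 : Euc N) r,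
        -lap (fun z => A * f (y + l • z)) z = A * l ^ 2 * -lap f (y + l • z) := by
    intro A f hf z hz
    rw [lap_comp_affine_of_contDiffOn isOpen_ball hf A l y z (hmaps z hz), mul_neg]
  have hu := h.contDiffOn₁.mono hsub'
  have hv := h.contDiffOn₂.mono hsub'
  have hu0 : ∀ z ∈ ball (0 : Euc N) r, 0 < u (y + l • z) := fun z hz =>
    h.pos₁ _ (hsub' (hmaps z hz))
  have hv0 : ∀ z ∈ ball (0 : Euc N) r, 0 < v (y + l • z) := fun z hz =>
    h.pos₂ _ (hsub' (hmaps z hz))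
  have hc₁ : 0 < ‖y‖ ^ γ₁ * l ^ α := by positivity
  have hc₂ : 0 < ‖y‖ ^ γ₂ * l ^ β := by positivity
  refine ⟨he, hτ, hτr, hcd _ hu, hcd _ hv, fun z hz => ⟨mul_pos hc₁ (hu0 z hz), ?_⟩,
    fun z hz => ⟨mul_pos hc₂ (hv0 z hz), ?_⟩, fun z hz => ?_, fun z hz => ?_, ?_, ?_⟩
  · refine le_max_of_le_left (scale_mul_le hα hY hl (by linarith [(hmem z hz).1]) (hu0 z hz)
      (hK₁ _ (hmem z hz)) ?_)
    rw [← hnorm]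
    refine le_trans (le_add_of_nonneg_right ?_) (hle _ (hmaps z hz))
    have := hv0 z hz
    positivity
  · refine le_max_of_le_right (scale_mul_le hβ hY hl (by linarith [(hmem z hz).1]) (hv0 z hz)
      (hK₂ _ (hmem z hz)) ?_)
    rw [← hnorm]
    refine le_trans (le_add_of_nonneg_left ?_) (hle _ (hmaps z hz))
    have := hu0 z hz
    positivity
  · rw [hlap _ hu z hz, h.eq₁ _ (hsub' (hmaps z hz)), hnorm,
      Real.mul_rpow hc₂.le (hv0 z hz).le, ← mul_assoc (_ ^ a),
      rpow_mul_scale_rpow hY hl (norm_nonneg _) h₁ h₃]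
    ring
  · rw [hlap _ hv z hz, h.eq₂ _ (hsub' (hmaps z hz)), hnorm,
      Real.mul_rpow hc₁.le (hu0 z hz).le, ← mul_assoc (_ ^ b),
      rpow_mul_scale_rpow hY hl (norm_nonneg _) h₂ h₄]
    ring
  · have hy0 : y ∈ (closedBall (0 : Euc N) R)ᶜ := hsub (mem_closedBall_self (by positivity))
    rw [blowUpRate, mul_add] at heq
    rw [smul_zero, add_zero, scale_mul_rpow hα hY hl (h.pos₁ y hy0),
      scale_mul_rpow hβ hY hl (h.pos₂ y hy0), heq]
  · obtain ⟨ξ, ζ, hξ, hζ, hξ0, hζ0, hle₁, hle₂⟩ := h.stable (ball y (l * r)) isOpen_ball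
      ((isCompact_closedBall y (l * r)).of_isClosed_subset isClosed_closure
        closure_ball_subset_closedBall) (closure_ball_subset_closedBall.trans hsub)
    refine ⟨fun z => ‖y‖ ^ γ₁ * l ^ α * ξ (y + l • z), fun z => ‖y‖ ^ γ₂ * l ^ β * ζ (y + l • z),
      hcd _ hξ, hcd _ hζ, fun z hz => mul_pos hc₁ (hξ0 _ (hmaps z hz)),
      fun z hz => mul_pos hc₂ (hζ0 _ (hmaps z hz)), fun z hz => ?_, fun z hz => ?_⟩
    · have hE := rpow_mul_scale_rpow (n := ‖‖y‖⁻¹ • y + (l / ‖y‖) • z‖) hY hl (norm_nonneg _) h₁ h₃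
      rw [hlap _ hξ z hz]
      refine le_trans (le_of_eq ?_) (mul_le_mul_of_nonneg_left (hle₁ _ (hmaps z hz))
        (by positivity))
      rw [hnorm, Real.mul_rpow hc₂.le (hv0 z hz).le]
      rw [← sub_add_cancel p 1, Real.rpow_add hc₂, Real.rpow_one] at hE
      linear_combination p * v (y + l • z) ^ (p - 1) * ζ (y + l • z) * hE
    · have hE := rpow_mul_scale_rpow (n := ‖‖y‖⁻¹ • y + (l / ‖y‖) • z‖) hY hl (norm_nonneg _) h₂ h₄
      rw [hlap _ hζ z hz]
      refine le_trans (le_of_eq ?_) (mul_le_mul_of_nonneg_left (hle₂ _ (hmaps z hz))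
        (by positivity))
      rw [hnorm, Real.mul_rpow hc₁.le (hu0 z hz).le]
      rw [← sub_add_cancel q 1, Real.rpow_add hc₁, Real.rpow_one] at hE
      linear_combination q * u (y + l • z) ^ (q - 1) * ξ (y + l • z) * hE

/-- The blow-up rate of stable solutions outside a ball is at most `C / |x|`. -/
lemma exists_norm_mul_blowUpRate_le (hp : 0 < p) (hq : 0 < q)
    (hLE : ¬ ∃ u v : Euc N → ℝ, ContDiff ℝ (⊤ : ℕ∞) u ∧ ContDiff ℝ (⊤ : ℕ∞) v ∧
        (∀ x, 0 < u x) ∧ (∀ x, 0 < v x) ∧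
        (∃ M : ℝ, ∀ x, u x ≤ M ∧ v x ≤ M) ∧ IsLESol p q u v ∧
        ∀ Ω : Set (Euc N), IsOpen Ω → Bornology.IsBounded Ω → LEStableOn p q u v Ω)
    (hα : 0 < α) (hβ : 0 < β) (h₁ : p * β = α + 2) (h₂ : q * α = β + 2) (h₃ : p * γ₂ = γ₁ + a)
    (h₄ : q * γ₁ = γ₂ + b) {σ : ℝ} (hσ : 1 < σ) :
    ∃ C : ℝ, ∀ R, 0 ≤ R → ∀ u v : Euc N → ℝ, StableOutside p q a b R u v →
      ∀ x : Euc N, σ * R < ‖x‖ → ‖x‖ * blowUpRate α β γ₁ γ₂ u v x ≤ C := by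
  by_contra! hcon
  obtain ⟨K₁, -, hK₁⟩ := exists_rpow_mem_Icc (C := 3 / 2) (by norm_num : (0 : ℝ) < 1 / 2) (-γ₁)
  obtain ⟨K₂, -, hK₂⟩ := exists_rpow_mem_Icc (C := 3 / 2) (by norm_num : (0 : ℝ) < 1 / 2) (-γ₂)
  refine hLE (ScaledSol.exists_entire (a := a) (b := b) (C := max (K₁ * 2 ^ α) (K₂ * 2 ^ β)) hp hq
    (inv_pos.2 hα) (inv_pos.2 hβ) fun r₀ => ?_)
  have hσ0 : 0 < σ := by linarith
  obtain ⟨δ, hδ0, hδ₁, hδ₂⟩ : ∃ δ : ℝ, 0 < δ ∧ δ ≤ 1 - σ⁻¹ ∧ δ ≤ 1 / 4 :=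
    ⟨min (1 - σ⁻¹) (1 / 4), lt_min (sub_pos.2 (inv_lt_one_of_one_lt₀ hσ)) (by norm_num),
      min_le_left _ _, min_le_right _ _⟩
  obtain ⟨R, hR, u, v, h, x₀, hx₀, hC⟩ := hcon (2 * r₀ / δ)
  have hX : 0 < ‖x₀‖ := lt_of_le_of_lt (by positivity) hx₀
  have hsub : closedBall x₀ (δ * ‖x₀‖) ⊆ (closedBall (0 : Euc N) R)ᶜ := fun z hz => by
    rw [mem_closedBall, dist_eq_norm] at hz
    rw [mem_compl_iff, mem_closedBall, dist_zero_right, not_le]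
    have h1 := norm_sub_norm_le x₀ z
    rw [norm_sub_rev] at h1
    have h2 : R < σ⁻¹ * ‖x₀‖ := by rwa [lt_inv_mul_iff₀ hσ0]
    nlinarith
  have hnz : ∀ z ∈ (closedBall (0 : Euc N) R)ᶜ, 0 < ‖z‖ := fun z hz => by
    rw [mem_compl_iff, mem_closedBall, dist_zero_right, not_le] at hz
    linarith
  have hpart : ∀ {w : Euc N → ℝ} (γ e : ℝ), ContinuousOn w (closedBall (0 : Euc N) R)ᶜ →
      (∀ z ∉ closedBall (0 : Euc N) R, 0 < w z) →
      ContinuousOn (fun z => (‖z‖ ^ γ * w z) ^ e) (closedBall (0 : Euc N) R)ᶜ := by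
    intro w γ e hw hw0
    refine ContinuousOn.rpow_const ((continuous_norm.continuousOn.rpow_const
      fun z hz => Or.inl (hnz z hz).ne').mul hw) fun z hz => Or.inl ?_
    have := hnz z hz
    have := hw0 z hz
    positivity
  have hM : ContinuousOn (blowUpRate α β γ₁ γ₂ u v) (closedBall (0 : Euc N) R)ᶜ :=
    (hpart _ _ h.contDiffOn₁.continuousOn h.pos₁).add (hpart _ _ h.contDiffOn₂.continuousOn h.pos₂)
  have hM0 : ∀ z ∈ (closedBall (0 : Euc N) R)ᶜ, 0 < blowUpRate α β γ₁ γ₂ u v z := fun z hz => by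
    have := hnz z hz
    have := h.pos₁ z hz
    have := h.pos₂ z hz
    unfold blowUpRate
    positivity
  obtain ⟨y, hyd, hyM, hy2⟩ := exists_doubling_point (mul_pos hδ0 hX) (hM.mono hsub)
    fun x hx => hM0 x (hsub hx)
  set D := δ * ‖x₀‖ - dist y x₀ with hD
  have hD0 : 0 < D := sub_pos.2 hyd
  have hyR : y ∈ (closedBall (0 : Euc N) R)ᶜ := hsub (mem_closedBall.2 hyd.le)
  have hMy := hM0 y hyR
  have hYle : D / 2 ≤ ‖y‖ / 2 := by
    have h1 := norm_sub_norm_le x₀ y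
    rw [norm_sub_rev, ← dist_eq_norm] at h1
    nlinarith [dist_nonneg (x := y) (y := x₀)]
  have hlr : (blowUpRate α β γ₁ γ₂ u v y)⁻¹ * (D * blowUpRate α β γ₁ γ₂ u v y / 2) = D / 2 := by
    field_simp
  refine ⟨D * blowUpRate α β γ₁ γ₂ u v y / 2, ?_, _, _, _, _, h.scaledSol hα hβ h₁ h₂ h₃ h₄
    (fun n hn => (hK₁ n hn).2) (fun n hn => (hK₂ n hn).2) (norm_pos_iff.1 (hnz y hyR))
    (inv_pos.2 hMy) (hlr.trans_le hYle) ?_ (by positivity) ?_ (inv_mul_cancel₀ hMy.ne')⟩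
  · rw [div_lt_iff₀ hδ0] at hC
    nlinarith
  · rw [hlr]
    refine (closedBall_subset_closedBall' ?_).trans hsub
    linarith
  · rw [hlr, div_inv_eq_mul]
    exact hy2

end

lemma norm_gradient (f : Euc N → ℝ) (x : Euc N) : ‖gradient f x‖ = ‖fderiv ℝ f x‖ :=
  (InnerProductSpace.toDual ℝ (Euc N)).symm.norm_map _

/-- Weighted interior gradient estimate in an exterior domain. -/
lemma exists_norm_gradient_le {σ' σ : ℝ} (hσ' : 1 ≤ σ') (hσ : σ' < σ) (A C₁ C₂ : ℝ) :
    ∃ C : ℝ, ∀ R, 0 ≤ R → ∀ f : Euc N → ℝ, ContDiffOn ℝ 2 f (closedBall (0 : Euc N) R)ᶜ →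
      (∀ y : Euc N, σ' * R < ‖y‖ → ‖y‖ ^ A * |f y| ≤ C₁) →
      (∀ y : Euc N, σ' * R < ‖y‖ → ‖y‖ ^ (A + 2) * |lap f y| ≤ C₂) →
      ∀ x : Euc N, σ * R < ‖x‖ → ‖x‖ ^ (A + 1) * ‖gradient f x‖ ≤ C := by
  have hσ0 : 0 < σ := by linarith
  obtain ⟨δ, hδ0, hδ₁, hδ₂⟩ : ∃ δ : ℝ, 0 < δ ∧ δ ≤ 1 - σ' / σ ∧ δ ≤ 1 / 2 :=
    ⟨min (1 - σ' / σ) (1 / 2), lt_min (sub_pos.2 ((div_lt_one hσ0).2 hσ)) (by norm_num),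
      min_le_left _ _, min_le_right _ _⟩
  obtain ⟨K₁, -, hK₁⟩ := exists_rpow_mem_Icc (C := 3 / 2) (by norm_num : (0 : ℝ) < 1 / 2) (-A)
  obtain ⟨K₂, -, hK₂⟩ := exists_rpow_mem_Icc (C := 3 / 2) (by norm_num : (0 : ℝ) < 1 / 2) (-(A + 2))
  refine ⟨gradConst N * (2 / δ * (K₁ * C₁) + δ / 2 * (K₂ * C₂)), fun R hR f hf h₁ h₂ x hx => ?_⟩
  have hX : 0 < ‖x‖ := lt_of_le_of_lt (by positivity) hx
  have hfar : ∀ y ∈ ball x (δ * ‖x‖), σ' * R < ‖y‖ ∧ ‖y‖ / ‖x‖ ∈ Icc (1 / 2 : ℝ) (3 / 2) := by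
    intro y hy
    rw [mem_ball, dist_eq_norm] at hy
    have h3 := abs_le.1 (abs_norm_sub_norm_le y x)
    have h4 : R < ‖x‖ / σ := by rwa [lt_div_iff₀ hσ0, mul_comm]
    have h5 : σ' * R < σ' / σ * ‖x‖ := by
      rw [div_mul_eq_mul_div, mul_div_assoc]
      exact mul_lt_mul_of_pos_left h4 (by linarith)
    refine ⟨by nlinarith, ?_, ?_⟩
    · rw [le_div_iff₀ hX]
      nlinarith
    · rw [div_le_iff₀ hX]
      nlinarith
  have hsub : ball x (δ * ‖x‖) ⊆ (closedBall (0 : Euc N) R)ᶜ := fun y hy => by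
    rw [mem_compl_iff, mem_closedBall, dist_zero_right, not_le]
    nlinarith [(hfar y hy).1]
  have hshift : ∀ {B K D : ℝ} {w : ℝ} {y : Euc N}, y ∈ ball x (δ * ‖x‖) → 0 ≤ w →
      (∀ n ∈ Icc (1 / 2 : ℝ) (3 / 2), n ^ (-B) ≤ K) → ‖y‖ ^ B * w ≤ D →
      w ≤ K * D * ‖x‖ ^ (-B) := by
    intro B K D w y hy hw hK hD
    obtain ⟨h3, h4⟩ := hfar y hy
    have hy0 : 0 < ‖y‖ := lt_of_le_of_lt (by positivity) h3
    have h5 := hK _ h4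
    have h6 : 0 < (‖y‖ / ‖x‖) ^ (-B) := by positivity
    have h7 : (‖y‖ / ‖x‖) ^ (-B) * ‖x‖ ^ (-B) * ‖y‖ ^ B = 1 := by
      rw [← Real.mul_rpow (by positivity) hX.le, div_mul_cancel₀ _ hX.ne', ← Real.rpow_add hy0]
      simp
    calc w = (‖y‖ / ‖x‖) ^ (-B) * (‖y‖ ^ B * w) * ‖x‖ ^ (-B) := by
          linear_combination -w * h7
      _ ≤ K * D * ‖x‖ ^ (-B) := by gcongr; exact h6.le.trans h5
  have hd : 0 < δ * ‖x‖ := by positivity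
  obtain ⟨F, hF, hFe, -⟩ := exists_contDiff_eq (half_pos hd) (half_lt_self hd) (hf.mono hsub)
  have hcb : closedBall x (δ * ‖x‖ / 2) ⊆ ball x (δ * ‖x‖) :=
    closedBall_subset_ball (half_lt_self hd)
  have hgrad := norm_fderiv_le (x := x) hF (half_pos hd)
    (A := K₁ * C₁ * ‖x‖ ^ (-A)) (B := K₂ * C₂ * ‖x‖ ^ (-(A + 2)))
    (fun y hy => by
      rw [(hFe y hy).eq_of_nhds]
      exact hshift (hcb hy) (abs_nonneg _) (fun n hn => (hK₁ n hn).2) (h₁ y (hfar y (hcb hy)).1))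
    (fun y hy => by
      rw [lap_congr (hFe y hy)]
      exact hshift (hcb hy) (abs_nonneg _) (fun n hn => (hK₂ n hn).2) (h₂ y (hfar y (hcb hy)).1))
  rw [(hFe x (mem_closedBall_self (half_pos hd).le)).fderiv_eq] at hgrad
  rw [norm_gradient]
  refine (mul_le_mul_of_nonneg_left hgrad (by positivity)).trans_eq ?_
  have e1 : ‖x‖ ^ (A + 1) * ‖x‖ ^ (-A) = ‖x‖ := by
    rw [← Real.rpow_add hX]
    simp
  have e2 : ‖x‖ ^ (A + 1) * ‖x‖ ^ (-(A + 2)) = ‖x‖⁻¹ := by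
    rw [← Real.rpow_add hX, ← Real.rpow_neg_one]
    ring_nf
  calc ‖x‖ ^ (A + 1) * (gradConst N * ((δ * ‖x‖ / 2)⁻¹ * (K₁ * C₁ * ‖x‖ ^ (-A)) +
        δ * ‖x‖ / 2 * (K₂ * C₂ * ‖x‖ ^ (-(A + 2)))))
      = gradConst N * ((δ * ‖x‖ / 2)⁻¹ * (K₁ * C₁) * (‖x‖ ^ (A + 1) * ‖x‖ ^ (-A)) +
        δ * ‖x‖ / 2 * (K₂ * C₂) * (‖x‖ ^ (A + 1) * ‖x‖ ^ (-(A + 2)))) := by ring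
    _ = _ := by
      rw [e1, e2]
      field_simp

lemma rpow_mul_le_of_mul_rpow_le {α γ X w C : ℝ} (hα : 0 < α) (hX : 0 < X) (hw : 0 < w)
    (h : X * (X ^ γ * w) ^ α⁻¹ ≤ C) : X ^ (α + γ) * w ≤ C ^ α := by
  have h0 : 0 ≤ X ^ γ * w := by positivity
  have h1 := Real.rpow_le_rpow (by positivity) h hα.le
  rwa [Real.mul_rpow hX.le (by positivity), ← Real.rpow_mul h0, inv_mul_cancel₀ hα.ne',
    Real.rpow_one, ← mul_assoc, ← Real.rpow_add hX] at h1

lemma exists_gradient_decay {p a A B σ' σ : ℝ} (hp : 0 < p) (hAB : p * B = A + 2 + a)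
    (hσ' : 1 ≤ σ') (hσ : σ' < σ) (C₁ C₂ : ℝ) :
    ∃ C : ℝ, ∀ R, 0 ≤ R → ∀ (u v : Euc N → ℝ) (q b : ℝ), StableOutside p q a b R u v →
      (∀ y : Euc N, σ' * R < ‖y‖ → ‖y‖ ^ A * u y ≤ C₁ ∧ ‖y‖ ^ B * v y ≤ C₂) →
      ∀ x : Euc N, σ * R < ‖x‖ → ‖x‖ ^ (A + 1) * ‖gradient u x‖ ≤ C := by
  obtain ⟨C, hC⟩ := exists_norm_gradient_le (N := N) hσ' hσ A C₁ (C₂ ^ p)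
  refine ⟨C, fun R hR u v q b h hle => hC R hR u h.contDiffOn₁ (fun y hy => ?_) fun y hy => ?_⟩
  all_goals
    have hy0 : 0 < ‖y‖ := lt_of_le_of_lt (by positivity) hy
    have hyR : y ∉ closedBall (0 : Euc N) R := by
      rw [mem_closedBall, dist_zero_right, not_le]
      nlinarith
  · rw [abs_of_pos (h.pos₁ y hyR)]
    exact (hle y hy).1
  · have hv := h.pos₂ y hyR
    have h1 := Real.rpow_le_rpow (by positivity) (hle y hy).2 hp.le
    rwa [Real.mul_rpow (by positivity) hv.le, ← Real.rpow_mul hy0.le, mul_comm B, hAB,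
      Real.rpow_add hy0, mul_assoc, ← h.eq₁ y hyR, ← abs_of_nonneg
        (h.eq₁ y hyR ▸ by positivity : 0 ≤ -lap u y), abs_neg] at h1

end

/-- Proposition 3.5: uniform decay estimates for positive solutions of the Hénon–Lane–Emden
system on the exterior of a ball which are stable on compactly contained open sets, assuming
the Lane–Emden system has no bounded positive smooth solution stable in every bounded open
set. The constant is independent of `R₀` and of the solution. -/
theorem stmt_19 (N : ℕ) (hN : 0 < N) (p q a b : ℝ)
    (hp : 0 < p) (hq : 0 < q) (hpq : 1 < p * q)
    (hLE : ¬ ∃ u v : Euc N → ℝ, ContDiff ℝ (⊤ : ℕ∞) u ∧ ContDiff ℝ (⊤ : ℕ∞) v ∧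
        (∀ x, 0 < u x) ∧ (∀ x, 0 < v x) ∧
        (∃ M : ℝ, ∀ x, u x ≤ M ∧ v x ≤ M) ∧ IsLESol p q u v ∧
        ∀ Ω : Set (Euc N), IsOpen Ω → Bornology.IsBounded Ω → LEStableOn p q u v Ω)
    (σ : ℝ) (hσ : 1 < σ) :
    ∃ C : ℝ, 0 < C ∧ ∀ R₀ : ℝ, 0 ≤ R₀ → ∀ u v : Euc N → ℝ,
      ContDiffOn ℝ 2 u (closedBall (0 : Euc N) R₀)ᶜ →
      ContDiffOn ℝ 2 v (closedBall (0 : Euc N) R₀)ᶜ →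
      (∀ x ∉ closedBall (0 : Euc N) R₀, 0 < u x) →
      (∀ x ∉ closedBall (0 : Euc N) R₀, 0 < v x) →
      (∀ x ∉ closedBall (0 : Euc N) R₀, -lap u x = ‖x‖ ^ a * v x ^ p) →
      (∀ x ∉ closedBall (0 : Euc N) R₀, -lap v x = ‖x‖ ^ b * u x ^ q) →
      (∀ Ω : Set (Euc N), IsOpen Ω → IsCompact (closure Ω) →
        closure Ω ⊆ (closedBall (0 : Euc N) R₀)ᶜ → HLEStableOn p q a b u v Ω) →
      ∀ x : Euc N, σ * R₀ < ‖x‖ →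
        ‖x‖ ^ ((2 * (p + 1) + a + p * b) / (p * q - 1)) * u x +
          ‖x‖ ^ ((2 * (p + 1) + a + p * b) / (p * q - 1) + 1) * ‖gradient u x‖ +
          ‖x‖ ^ ((2 * (q + 1) + b + q * a) / (p * q - 1)) * v x +
          ‖x‖ ^ ((2 * (q + 1) + b + q * a) / (p * q - 1) + 1) * ‖gradient v x‖ ≤ C := by
  have hd : 0 < p * q - 1 := by linarith
  have hd0 := hd.ne'
  have hd1 : q * p - 1 ≠ 0 := by rwa [mul_comm q]
  have hα : 0 < 2 * (p + 1) / (p * q - 1) := by positivity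
  have hβ : 0 < 2 * (q + 1) / (p * q - 1) := by positivity
  have h₁ : p * (2 * (q + 1) / (p * q - 1)) = 2 * (p + 1) / (p * q - 1) + 2 := by
    field_simp
    ring
  have h₂ : q * (2 * (p + 1) / (p * q - 1)) = 2 * (q + 1) / (p * q - 1) + 2 := by
    field_simp
    ring
  have h₃ : p * ((b + q * a) / (p * q - 1)) = (a + p * b) / (p * q - 1) + a := by
    field_simp
    ring
  have h₄ : q * ((a + p * b) / (p * q - 1)) = (b + q * a) / (p * q - 1) + b := by
    field_simp
    ring
  have hA : (2 * (p + 1) + a + p * b) / (p * q - 1) =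
      2 * (p + 1) / (p * q - 1) + (a + p * b) / (p * q - 1) := by
    ring
  have hB : (2 * (q + 1) + b + q * a) / (p * q - 1) =
      2 * (q + 1) / (p * q - 1) + (b + q * a) / (p * q - 1) := by
    ring
  generalize 2 * (p + 1) / (p * q - 1) = α at *
  generalize 2 * (q + 1) / (p * q - 1) = β at *
  generalize (a + p * b) / (p * q - 1) = γ₁ at *
  generalize (b + q * a) / (p * q - 1) = γ₂ at *
  rw [hA, hB]
  have hσ₁ : 1 < (1 + σ) / 2 := by linarith
  have hσ₂ : (1 + σ) / 2 < σ := by linarith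
  obtain ⟨C, hC⟩ := exists_norm_mul_blowUpRate_le hp hq hLE hα hβ h₁ h₂ h₃ h₄ hσ₁
  obtain ⟨C₁, hC₁⟩ := exists_gradient_decay (N := N) (A := α + γ₁) (B := β + γ₂) (a := a) hp
    (by linear_combination h₁ + h₃) hσ₁.le hσ₂ (C ^ α) (C ^ β)
  obtain ⟨C₂, hC₂⟩ := exists_gradient_decay (N := N) (A := β + γ₂) (B := α + γ₁) (a := b) hq
    (by linear_combination h₂ + h₄) hσ₁.le hσ₂ (C ^ β) (C ^ α)
  refine ⟨max 1 (C ^ α + C₁ + C ^ β + C₂), by positivity,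
    fun R hR u v hu hv hu0 hv0 hu1 hv1 hst x hx => le_max_of_le_right ?_⟩
  have h : StableOutside p q a b R u v := ⟨hu, hv, hu0, hv0, hu1, hv1, hst⟩
  have hle : ∀ y : Euc N, (1 + σ) / 2 * R < ‖y‖ →
      ‖y‖ ^ (α + γ₁) * u y ≤ C ^ α ∧ ‖y‖ ^ (β + γ₂) * v y ≤ C ^ β := by
    intro y hy
    have hy0 : 0 < ‖y‖ := lt_of_le_of_lt (by positivity) hy
    have hyR : y ∉ closedBall (0 : Euc N) R := by
      rw [mem_closedBall, dist_zero_right, not_le]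
      nlinarith
    have hu' := hu0 y hyR
    have hv' := hv0 y hyR
    have hy1 := hC R hR u v h y hy
    rw [blowUpRate, mul_add] at hy1
    exact ⟨rpow_mul_le_of_mul_rpow_le hα hy0 hu' (le_trans (le_add_of_nonneg_right
      (by positivity)) hy1), rpow_mul_le_of_mul_rpow_le hβ hy0 hv' (le_trans
      (le_add_of_nonneg_left (by positivity)) hy1)⟩
  obtain ⟨hx1, hx2⟩ := hle x (by nlinarith)
  linarith [hC₁ R hR u v q b h hle x hx,
    hC₂ R hR v u p a h.symm (fun y hy => (hle y hy).symm) x hx]
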